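/- For every connected finite simple graph G, φ(G) ≥ (16/3)·s(G) − 1, where φ(G) = Σ_{v ∈ V(G)} φ(deg_G(v)) and φ(d) = 0 for d ∈ {0,1,2}, φ(3) = 4/3, and φ(d) = d/2 for d ≥ 4. -/

import Mathlib

open SimpleGraph

/-- `G` has a `K₄` minor (branch-set formulation: four nonempty, pairwise disjoint,
connected branch sets with an edge between every two of them). -/
def HasK4Minor {V : Type*} (G : SimpleGraph V) : Prop :=
  ∃ B : Fin 4 → Set V,
    (∀ i, (B i).Nonempty) ∧
    (∀ i, (G.induce (B i)).Connected) ∧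
    (∀ i j, i ≠ j → Disjoint (B i) (B j)) ∧
    (∀ i j, i ≠ j → ∃ u ∈ B i, ∃ v ∈ B j, G.Adj u v)

/-- `X` is a transversal of `G`: the graph `G − X` has no `K₄` minor. -/
def IsTransversal {V : Type*} (G : SimpleGraph V) (X : Finset V) : Prop :=
  ¬ HasK4Minor (G.induce ((↑X : Set V)ᶜ))

/-- `s(G)`: the minimum size of a transversal of `G`. -/
noncomputable def transNum {V : Type*} (G : SimpleGraph V) : ℕ :=
  sInf {n : ℕ | ∃ X : Finset V, X.card = n ∧ IsTransversal G X}

/-- The potential function: `φ(d) = 0` for `d ∈ {0,1,2}`, `φ(3) = 4/3`, and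
`φ(d) = d/2` for `d ≥ 4`. -/
noncomputable def phi (d : ℕ) : ℝ :=
  if d ≤ 2 then 0 else if d = 3 then 4 / 3 else (d : ℝ) / 2

/-- The potential of a graph: `φ(G) = Σ_{v ∈ V(G)} φ(deg_G(v))`. -/
noncomputable def phiSum {V : Type*} [Fintype V] (G : SimpleGraph V) : ℝ :=
  ∑ v : V, phi ((G.neighborSet v).ncard)

namespace K4T

/-- Cut-based connectivity of a vertex set. -/
def SC {V : Type*} (G : SimpleGraph V) (B : Set V) : Prop :=
  B.Nonempty ∧ ∀ A : Set V, A ⊆ B → A.Nonempty → A ≠ B → ∃ a ∈ A, ∃ b ∈ B \ A, G.Adj a b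

/-- `K₄` minor, with cut-based connectivity of the branch sets. -/
def K4 {V : Type*} (G : SimpleGraph V) : Prop :=
  ∃ B : Fin 4 → Set V, (∀ i, SC G (B i)) ∧ (∀ i j, i ≠ j → Disjoint (B i) (B j)) ∧
    (∀ i j, i ≠ j → ∃ u ∈ B i, ∃ v ∈ B j, G.Adj u v)

/-- Keep only the edges inside `A`. -/
def res {V : Type*} (G : SimpleGraph V) (A : Set V) : SimpleGraph V where
  Adj a b := G.Adj a b ∧ a ∈ A ∧ b ∈ A
  symm := ⟨fun _ _ h => ⟨h.1.symm, h.2.2, h.2.1⟩⟩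
  loopless := ⟨fun _ h => h.1.ne rfl⟩

/-- Delete (the edges at) the vertex `v`. -/
def del {V : Type*} (G : SimpleGraph V) (v : V) : SimpleGraph V where
  Adj a b := G.Adj a b ∧ a ≠ v ∧ b ≠ v
  symm := ⟨fun _ _ h => ⟨h.1.symm, h.2.2, h.2.1⟩⟩
  loopless := ⟨fun _ h => h.1.ne rfl⟩

theorem res_adj {V : Type*} (G : SimpleGraph V) (A : Set V) (a b : V) :
    (res G A).Adj a b ↔ G.Adj a b ∧ a ∈ A ∧ b ∈ A := Iff.rfl

theorem del_adj {V : Type*} (G : SimpleGraph V) (v a b : V) :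
    (del G v).Adj a b ↔ G.Adj a b ∧ a ≠ v ∧ b ≠ v := Iff.rfl

theorem SC.mono {V : Type*} {G H : SimpleGraph V} (h : ∀ a b, G.Adj a b → H.Adj a b) {B : Set V}
    (hB : SC G B) : SC H B :=
  ⟨hB.1, fun A h1 h2 h3 => by
    obtain ⟨a, ha, b, hb, hab⟩ := hB.2 A h1 h2 h3
    exact ⟨a, ha, b, hb, h _ _ hab⟩⟩

theorem K4.mono {V : Type*} {G H : SimpleGraph V} (hG : K4 G) (h : ∀ a b, G.Adj a b → H.Adj a b) : K4 H := by
  obtain ⟨B, h1, h2, h3⟩ := hG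
  refine ⟨B, fun i => (h1 i).mono h, h2, fun i j hij => ?_⟩
  obtain ⟨u, hu, v, hv, huv⟩ := h3 i j hij
  exact ⟨u, hu, v, hv, h _ _ huv⟩

/-- Removing a vertex of degree at most two, joining its neighbours, keeps `K₄` minors. -/
theorem K4.suppress {V : Type*} {G H : SimpleGraph V} (hG : K4 G) (x a0 b0 : V)
    (hx : ∀ y, G.Adj x y → y = a0 ∨ y = b0)
    (hH : ∀ u v, G.Adj u v → u ≠ x → v ≠ x → H.Adj u v)
    (hj : ∀ y z, G.Adj x y → G.Adj x z → y ≠ z → H.Adj y z) : K4 H := by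
  obtain ⟨B, h1, h2, h3⟩ := hG
  have hne : ∀ i, (B i \ {x}).Nonempty := by
    intro i
    by_contra hcon
    rw [Set.not_nonempty_iff_eq_empty, Set.sdiff_eq_empty] at hcon
    have key : ∀ j, i ≠ j → ∃ v ∈ B j, G.Adj x v := by
      intro j hij
      obtain ⟨u, hu, v, hv, huv⟩ := h3 i j hij
      have : u = x := hcon hu
      subst this
      exact ⟨v, hv, huv⟩
    have : ∃ j k l : Fin 4, i ≠ j ∧ i ≠ k ∧ i ≠ l ∧ j ≠ k ∧ j ≠ l ∧ k ≠ l := by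
      clear hcon key; revert i; decide
    obtain ⟨j, k, l, hj1, hk1, hl1, hjk, hjl, hkl⟩ := this
    obtain ⟨u, hu, hxu⟩ := key j hj1
    obtain ⟨v, hv, hxv⟩ := key k hk1
    obtain ⟨w, hw, hxw⟩ := key l hl1
    have e1 : u ≠ v := fun h => Set.disjoint_left.1 (h2 j k hjk) hu (h ▸ hv)
    have e2 : u ≠ w := fun h => Set.disjoint_left.1 (h2 j l hjl) hu (h ▸ hw)
    have e3 : v ≠ w := fun h => Set.disjoint_left.1 (h2 k l hkl) hv (h ▸ hw)
    rcases hx u hxu with h | h <;> rcases hx v hxv with h' | h' <;> rcases hx w hxw with h'' | h'' <;>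
      simp_all
  refine ⟨fun i => B i \ {x}, fun i => ⟨hne i, ?_⟩, fun i j hij =>
    (h2 i j hij).mono Set.sdiff_subset Set.sdiff_subset, ?_⟩
  · intro A hA hAn hAne
    obtain ⟨a, ha, b, hb, hab⟩ := (h1 i).2 A (hA.trans Set.sdiff_subset) hAn (by
      rintro rfl
      apply hAne
      exact Set.Subset.antisymm hA Set.sdiff_subset)
    have hax : a ≠ x := (hA ha).2
    by_cases hbx : b = x
    · subst hbx
      obtain ⟨c, hc, d, hd, hcd⟩ := (h1 i).2 (insert b A) (Set.insert_subset hb.1 (hA.trans Set.sdiff_subset))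
        ⟨b, by simp⟩ (by
          intro h
          apply hAne
          apply Set.Subset.antisymm hA
          intro y hy
          have : y ∈ insert b A := h ▸ hy.1
          rcases this with h | h
          · exact absurd h hy.2
          · exact h)
      have hdb : d ≠ b := fun h => hd.2 (h ▸ Set.mem_insert _ _)
      have hdA : d ∉ A := fun h => hd.2 (Set.mem_insert_of_mem _ h)
      rcases hc with h | h
      · subst h
        exact ⟨a, ha, d, ⟨⟨hd.1, hdb⟩, hdA⟩, hj a d hab.symm hcd (fun h => hdA (h ▸ ha))⟩
      · exact ⟨c, h, d, ⟨⟨hd.1, hdb⟩, hdA⟩, hH _ _ hcd (hA h).2 hdb⟩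
    · exact ⟨a, ha, b, ⟨⟨hb.1, hbx⟩, hb.2⟩, hH _ _ hab hax hbx⟩
  · -- adjacency
    have key : ∀ i j, i ≠ j → ∀ v ∈ B j, x ∈ B i → G.Adj x v →
        ∃ u ∈ B i \ {x}, ∃ v ∈ B j \ {x}, H.Adj u v := by
      intro i j hij v hv hxi hxv
      obtain ⟨a, ha, b, hb, hab⟩ := (h1 i).2 {x} (by simpa using hxi) ⟨x, rfl⟩ (by
        intro h
        obtain ⟨y, hy⟩ := hne i
        exact hy.2 (h ▸ hy.1))
      have hax : a = x := ha
      subst hax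
      refine ⟨b, hb, v, ⟨hv, hxv.ne'⟩, hj _ _ hab hxv ?_⟩
      rintro rfl
      exact Set.disjoint_left.1 (h2 i j hij) hb.1 hv
    intro i j hij
    obtain ⟨u, hu, v, hv, huv⟩ := h3 i j hij
    by_cases hux : u = x
    · subst hux
      exact key i j hij v hv hu huv
    · by_cases hvx : v = x
      · subst hvx
        obtain ⟨p, hp, q, hq, hpq⟩ := key j i hij.symm u hu hv huv.symm
        exact ⟨q, hq, p, hp, hpq.symm⟩
      · exact ⟨u, ⟨hu, hux⟩, v, ⟨hv, hvx⟩, hH _ _ huv hux hvx⟩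

theorem SC.side {V : Type*} {G : SimpleGraph V} (v : V) (C : Set V)
    (hC : ∀ a b, a ∈ C → b ∉ C → G.Adj a b → b = v) {B : Set V} (hB : SC G B) 
    (hn : (B ∩ (C ∪ {v})).Nonempty) : SC (res G (C ∪ {v})) (B ∩ (C ∪ {v})) := by
  refine ⟨hn, ?_⟩
  have key : ∀ A : Set V, A ⊆ B ∩ (C ∪ {v}) → A.Nonempty → A ≠ B ∩ (C ∪ {v}) → v ∉ A →
      ∃ a ∈ A, ∃ b ∈ (B ∩ (C ∪ {v})) \ A, (res G (C ∪ {v})).Adj a b := by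
    intro A hA hAn hAne hvA
    have hAC : A ⊆ C := by
      intro y hy
      rcases (hA hy).2 with h | h
      · exact h
      · exact absurd (h ▸ hy) hvA
    by_cases hAB : A = B
    · exfalso
      apply hAne
      apply Set.Subset.antisymm hA
      intro y hy
      rw [hAB]; exact hy.1
    obtain ⟨a, ha, b, hb, hab⟩ := hB.2 A (fun y hy => (hA hy).1) hAn hAB
    have hbC : b ∈ C ∪ {v} := by
      by_cases hbC : b ∈ C
      · exact Or.inl hbC
      · exact Or.inr (hC a b (hAC ha) hbC hab)
    exact ⟨a, ha, b, ⟨⟨hb.1, hbC⟩, hb.2⟩, hab, Or.inl (hAC ha), hbC⟩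
  intro A hA hAn hAne
  by_cases hvA : v ∈ A
  · obtain ⟨a, ha, b, hb, hab⟩ := key ((B ∩ (C ∪ {v})) \ A) Set.sdiff_subset (by
      rw [Set.nonempty_iff_ne_empty]
      intro h
      apply hAne
      exact Set.Subset.antisymm hA (Set.sdiff_eq_empty.1 h)) (by
      intro h
      have : v ∈ (B ∩ (C ∪ {v})) \ A := by rw [h]; exact hA hvA
      exact this.2 hvA) (fun h => h.2 hvA)
    refine ⟨b, ?_, a, ha, hab.symm⟩
    by_contra hbA
    exact hb.2 ⟨hb.1, hbA⟩
  · exact key A hA hAn hAne hvA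

/-- A `K₄` minor lives on one side of a cut vertex. -/
theorem K4.side {V : Type*} {G : SimpleGraph V} (hG : K4 G) (v : V) (C : Set V)
    (hC : ∀ a b, a ∈ C → b ∉ C → G.Adj a b → b = v) (hv : v ∉ C) :
    K4 (res G (C ∪ {v})) ∨ K4 (res G Cᶜ) := by
  obtain ⟨B, h1, h2, h3⟩ := hG
  have main : ∀ (D : Set V), (∀ a b, a ∈ D → b ∉ D → G.Adj a b → b = v) →
      (∀ i, v ∉ B i → B i ⊆ D) → K4 (res G (D ∪ {v})) := by
    intro D hD hsub
    refine ⟨fun i => B i ∩ (D ∪ {v}), fun i => SC.side v D hD (h1 i) ?_, fun i j hij =>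
      (h2 i j hij).mono Set.inter_subset_left Set.inter_subset_left, ?_⟩
    · by_cases hvi : v ∈ B i
      · exact ⟨v, hvi, Or.inr rfl⟩
      · obtain ⟨y, hy⟩ := (h1 i).1
        exact ⟨y, hy, Or.inl (hsub i hvi hy)⟩
    · have key : ∀ i j, i ≠ j → v ∉ B i → ∃ u ∈ B i ∩ (D ∪ {v}), ∃ w ∈ B j ∩ (D ∪ {v}),
          (res G (D ∪ {v})).Adj u w := by
        intro i j hij hvi
        obtain ⟨u, hu, w, hw, huw⟩ := h3 i j hij
        have huD : u ∈ D := hsub i hvi hu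
        have hwD : w ∈ D ∪ {v} := by
          by_cases h : w ∈ D
          · exact Or.inl h
          · exact Or.inr (hD u w huD h huw)
        exact ⟨u, ⟨hu, Or.inl huD⟩, w, ⟨hw, hwD⟩, huw, Or.inl huD, hwD⟩
      intro i j hij
      by_cases hvi : v ∈ B i
      · have hvj : v ∉ B j := fun h => Set.disjoint_left.1 (h2 i j hij) hvi h
        obtain ⟨u, hu, w, hw, huw⟩ := key j i hij.symm hvj
        exact ⟨w, hw, u, hu, huw.symm⟩
      · exact key i j hij hvi
  have hC' : ∀ a b, a ∈ Cᶜ \ {v} → b ∉ Cᶜ \ {v} → G.Adj a b → b = v := by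
    intro a b ha hb hab
    by_cases hbC : b ∈ C
    · exact absurd (hC b a hbC ha.1 hab.symm) ha.2
    · by_contra hbv
      exact hb ⟨hbC, hbv⟩
  have hE : Cᶜ \ {v} ∪ {v} = Cᶜ := by
    ext y
    by_cases hy : y = v
    · subst hy; simp [hv]
    · simp [hy]
  -- v-free branch sets are on one side
  have side : ∀ i, v ∉ B i → B i ⊆ C ∨ B i ⊆ Cᶜ \ {v} := by
    intro i hvi
    by_contra hcon
    push Not at hcon
    obtain ⟨y, hy, hyC⟩ := Set.not_subset.1 hcon.1
    obtain ⟨z, hz, hzC⟩ := Set.not_subset.1 hcon.2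
    have hzv : z ≠ v := fun h => hvi (h ▸ hz)
    have hzC' : z ∈ C := by
      by_contra h
      exact hzC ⟨h, hzv⟩
    obtain ⟨a, ha, b, hb, hab⟩ := (h1 i).2 (B i ∩ C) Set.inter_subset_left ⟨z, hz, hzC'⟩ (by
      intro h
      rw [← h] at hy
      exact hyC hy.2)
    have hbC : b ∉ C := fun h => hb.2 ⟨hb.1, h⟩
    exact hvi (hC a b ha.2 hbC hab ▸ hb.1)
  by_cases hall : ∀ i, v ∉ B i → B i ⊆ C
  · exact Or.inl (main C hC hall)
  · right
    rw [← hE]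
    apply main _ hC'
    push Not at hall
    obtain ⟨i, hvi, hi⟩ := hall
    have hi' := (side i hvi).resolve_left hi
    intro j hvj
    rcases side j hvj with h | h
    · by_cases hij : i = j
      · subst hij; exact hi'
      · obtain ⟨u, hu, w, hw, huw⟩ := h3 i j hij
        have := hC w u (h hw) (hi' hu).1 huw.symm
        exact absurd (this ▸ hu) hvi
    · exact h

/-- The frozen notion of a minor implies the cut-based one. -/
theorem K4_of_minor {V : Type*} {G : SimpleGraph V} {S : Set V} (h : HasK4Minor (G.induce S)) :
    K4 (res G S) := by
  obtain ⟨B, h0, h1, h2, h3⟩ := h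
  refine ⟨fun i => Subtype.val '' B i, fun i => ⟨(h0 i).image _, ?_⟩, fun i j hij => ?_, ?_⟩
  · intro A hA hAn hAne
    by_contra hcon
    push Not at hcon
    apply hAne
    apply Set.Subset.antisymm hA
    rintro _ ⟨y, hy, rfl⟩
    obtain ⟨a, haA⟩ := hAn
    obtain ⟨a', ha', rfl⟩ := hA haA
    have hreach := (h1 i).preconnected ⟨a', ha'⟩ ⟨y, hy⟩
    obtain ⟨p⟩ := hreach
    have gen : ∀ (u w : (B i : Set S)), ((G.induce S).induce (B i)).Walk u w →
        (u.1.1 ∈ A) → w.1.1 ∈ A := by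
      intro u w p
      induction p with
      | nil => exact id
      | cons hadj _ ih =>
        rename_i p q r _
        intro hu
        apply ih
        by_contra hq
        refine hcon _ hu q.1.1 ⟨⟨q.1, q.2, rfl⟩, hq⟩ ⟨?_, p.1.2, q.1.2⟩
        simpa using hadj
    exact gen _ _ p haA
  · rw [Set.disjoint_left]
    rintro _ ⟨y, hy, rfl⟩ ⟨z, hz, hzy⟩
    have : z = y := Subtype.ext hzy
    subst this
    exact Set.disjoint_left.1 (h2 i j hij) hy hz
  · intro i j hij
    obtain ⟨u, hu, v, hv, huv⟩ := h3 i j hij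
    exact ⟨u.1, ⟨u, hu, rfl⟩, v.1, ⟨v, hv, rfl⟩, by simpa using huv, u.2, v.2⟩

end K4T

namespace K4T

open Classical

set_option linter.unusedSectionVars false
set_option linter.unusedVariables false

theorem not_K4_of_noedge {V : Type*} {G : SimpleGraph V} (h : ∀ a b, ¬ G.Adj a b) : ¬ K4 G := by
  rintro ⟨B, -, -, h3⟩
  obtain ⟨u, -, v, -, huv⟩ := h3 0 1 (by decide)
  exact h _ _ huv

/-- Minimum transversal size (cut-based notion of minor). -/
noncomputable def sn {V : Type*} (G : SimpleGraph V) : ℕ :=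
  sInf {n : ℕ | ∃ X : Finset V, X.card = n ∧ ¬ K4 (res G ((↑X : Set V)ᶜ))}

section
variable {V : Type*} [Fintype V]

theorem sn_le {G : SimpleGraph V} (X : Finset V) (h : ¬ K4 (res G ((↑X : Set V)ᶜ))) :
    sn G ≤ X.card := Nat.sInf_le ⟨X, rfl, h⟩

theorem sn_spec (G : SimpleGraph V) : ∃ X : Finset V, X.card = sn G ∧ ¬ K4 (res G ((↑X : Set V)ᶜ)) := by
  have : {n : ℕ | ∃ X : Finset V, X.card = n ∧ ¬ K4 (res G ((↑X : Set V)ᶜ))}.Nonempty := by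
    refine ⟨_, Finset.univ, rfl, not_K4_of_noedge ?_⟩
    rintro a b ⟨-, h, -⟩
    simp at h
  exact Nat.sInf_mem this

theorem transNum_le (G : SimpleGraph V) : transNum G ≤ sn G := by
  obtain ⟨X, hX, h⟩ := sn_spec G
  exact Nat.sInf_le ⟨X, hX, fun h' => h (K4_of_minor h')⟩

theorem sn_mono {G H : SimpleGraph V} (h : ∀ a b, G.Adj a b → H.Adj a b) : sn G ≤ sn H := by
  obtain ⟨X, hX, hK⟩ := sn_spec H
  rw [← hX]
  apply sn_le
  intro h'
  exact hK (h'.mono fun a b hab => ⟨h _ _ hab.1, hab.2⟩)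

theorem sn_zero {G : SimpleGraph V} (h : ∀ a b, ¬ G.Adj a b) : sn G = 0 := by
  have := sn_le (G := G) ∅ (not_K4_of_noedge fun a b hab => h a b hab.1)
  simpa using this

theorem sn_del (G : SimpleGraph V) (v : V) : sn G ≤ sn (del G v) + 1 := by
  obtain ⟨X, hX, hK⟩ := sn_spec (del G v)
  rw [← hX]
  refine le_trans (sn_le (insert v X) ?_) (Finset.card_insert_le _ _)
  intro h'
  refine hK (h'.mono fun a b hab => ?_)
  obtain ⟨h1, h2, h3⟩ := hab
  simp only [Finset.coe_insert, Set.mem_compl_iff, Set.mem_insert_iff, not_or] at h2 h3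
  exact ⟨⟨h1, h2.1, h3.1⟩, h2.2, h3.2⟩

theorem sn_suppress {G H : SimpleGraph V} (x a0 b0 : V)
    (hx : ∀ y, G.Adj x y → y = a0 ∨ y = b0)
    (hH : ∀ u v, G.Adj u v → u ≠ x → v ≠ x → H.Adj u v)
    (hj : ∀ y z, G.Adj x y → G.Adj x z → y ≠ z → H.Adj y z) : sn G ≤ sn H := by
  obtain ⟨X, hX, hK⟩ := sn_spec H
  rw [← hX]
  apply sn_le
  intro h'
  refine hK (h'.suppress x a0 b0 (fun y hy => hx y hy.1) ?_ ?_)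
  · intro u v huv h1 h2
    exact ⟨hH u v huv.1 h1 h2, huv.2⟩
  · intro y z h1 h2 h3
    exact ⟨hj y z h1.1 h2.1 h3, h1.2.2, h2.2.2⟩

theorem sn_side {G : SimpleGraph V} (v : V) (C : Set V)
    (hC : ∀ a b, a ∈ C → b ∉ C → G.Adj a b → b = v) (hv : v ∉ C) :
    sn G ≤ sn (res G (C ∪ {v})) + sn (res G Cᶜ) := by
  obtain ⟨X, hX, hK⟩ := sn_spec (res G (C ∪ {v}))
  obtain ⟨Y, hY, hL⟩ := sn_spec (res G Cᶜ)
  rw [← hX, ← hY]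
  refine le_trans (sn_le (X ∪ Y) ?_) (Finset.card_union_le _ _)
  intro h'
  rcases h'.side v C (fun a b ha hb hab => hC a b ha hb hab.1) hv with h | h
  · refine hK (h.mono ?_)
    rintro a b ⟨⟨h1, h2, h3⟩, h4⟩
    simp only [Finset.coe_union, Set.compl_union] at h2 h3
    exact ⟨⟨h1, h4⟩, h2.1, h3.1⟩
  · refine hL (h.mono ?_)
    rintro a b ⟨⟨h1, h2, h3⟩, h4⟩
    simp only [Finset.coe_union, Set.compl_union] at h2 h3
    exact ⟨⟨h1, h4⟩, h2.2, h3.2⟩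

theorem sn_super {G : SimpleGraph V} (A B : Set V) (hAB : Disjoint A B) :
    sn (res G A) + sn (res G B) ≤ sn G := by
  obtain ⟨X, hX, hK⟩ := sn_spec G
  rw [← hX]
  have key : ∀ A : Set V, sn (res G A) ≤ (X.filter (· ∈ A)).card := by
    intro A
    apply sn_le
    intro h'
    refine hK (h'.mono ?_)
    rintro a b ⟨⟨h1, h2, h3⟩, h4, h5⟩
    simp at h4 h5
    exact ⟨h1, fun h => h4 h h2, fun h => h5 h h3⟩
  calc sn (res G A) + sn (res G B) ≤ (X.filter (· ∈ A)).card + (X.filter (· ∈ B)).card :=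
        add_le_add (key A) (key B)
    _ = (X.filter (· ∈ A) ∪ X.filter (· ∈ B)).card := by
        rw [Finset.card_union_of_disjoint]
        rw [Finset.disjoint_left]
        intro a ha hb
        exact Set.disjoint_left.1 hAB (Finset.mem_filter.1 ha).2 (Finset.mem_filter.1 hb).2
    _ ≤ X.card := Finset.card_le_card (by
        intro y hy
        rcases Finset.mem_union.1 hy with h | h <;> exact (Finset.mem_filter.1 h).1)

/-- Neighbourhood as a finset. -/
noncomputable def nb (G : SimpleGraph V) (v : V) : Finset V := Finset.univ.filter (fun x => G.Adj v x)

/-- Degree. -/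
noncomputable def dg (G : SimpleGraph V) (v : V) : ℕ := (nb G v).card

theorem mem_nb {G : SimpleGraph V} {v x : V} : x ∈ nb G v ↔ G.Adj v x := by simp [nb]

theorem dg_eq_ncard (G : SimpleGraph V) (v : V) : (G.neighborSet v).ncard = dg G v := by
  have : G.neighborSet v = ↑(nb G v) := by ext x; simp [mem_nb]
  rw [this, Set.ncard_coe_finset]; rfl

theorem dg_pos {G : SimpleGraph V} {v : V} : 0 < dg G v ↔ ∃ x, G.Adj v x := by
  rw [dg, Finset.card_pos]
  constructor
  · rintro ⟨x, hx⟩; exact ⟨x, mem_nb.1 hx⟩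
  · rintro ⟨x, hx⟩; exact ⟨x, mem_nb.2 hx⟩

theorem dg_pos_of_adj {G : SimpleGraph V} {v x : V} (h : G.Adj v x) : 0 < dg G v := dg_pos.2 ⟨x, h⟩

theorem dg_mono {G H : SimpleGraph V} (h : ∀ a b, G.Adj a b → H.Adj a b) (v : V) : dg G v ≤ dg H v :=
  Finset.card_le_card fun x hx => mem_nb.2 (h _ _ (mem_nb.1 hx))

theorem dg_congr {G H : SimpleGraph V} {v w : V} (h : ∀ b, G.Adj v b ↔ H.Adj w b) : dg G v = dg H w := by
  unfold dg; congr 1; ext x; rw [mem_nb, mem_nb, h]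

theorem dg_del_self (G : SimpleGraph V) (v : V) : dg (del G v) v = 0 := by
  by_contra h
  obtain ⟨x, hx⟩ := dg_pos.1 (Nat.pos_of_ne_zero h)
  exact hx.2.1 rfl

theorem dg_del_adj {G : SimpleGraph V} {v x : V} (h : G.Adj v x) : dg (del G v) x + 1 = dg G x := by
  have : nb (del G v) x = (nb G x).erase v := by
    ext y
    rw [mem_nb, Finset.mem_erase, mem_nb, del_adj]
    constructor
    · rintro ⟨a, b, c⟩; exact ⟨c, a⟩
    · rintro ⟨c, a⟩; exact ⟨a, h.ne', c⟩
  unfold dg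
  rw [this, Finset.card_erase_add_one (mem_nb.2 h.symm)]

theorem dg_del_nadj {G : SimpleGraph V} {v x : V} (hne : x ≠ v) (h : ¬ G.Adj v x) :
    dg (del G v) x = dg G x := by
  apply dg_congr
  intro b
  rw [del_adj]
  constructor
  · exact fun h => h.1
  · intro hb
    refine ⟨hb, hne, ?_⟩
    rintro rfl
    exact h hb.symm

/-- Scaled potential. -/
def psi (d : ℕ) : ℤ := if d ≤ 2 then 0 else if d = 3 then 8 else 3 * d

/-- Increment of the scaled potential. -/
def gg (d : ℕ) : ℤ := psi d - psi (d - 1)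

theorem psi_le {a b : ℕ} (h : a ≤ b) : psi a ≤ psi b := by
  unfold psi; split_ifs <;> omega

theorem gg_nonneg (d : ℕ) : 0 ≤ gg d := by
  unfold gg; have := psi_le (Nat.sub_le d 1); omega

theorem gg3 : gg 3 = 8 := by decide
theorem gg4 : gg 4 = 4 := by decide
theorem gg_ge5 {d : ℕ} (h : 5 ≤ d) : gg d = 3 := by
  unfold gg psi; split_ifs <;> omega
theorem gg_ge3 {d : ℕ} (h : 3 ≤ d) : 3 ≤ gg d := by
  unfold gg psi; split_ifs <;> omega

/-- The excess. -/
noncomputable def F (G : SimpleGraph V) : ℤ := ∑ v, psi (dg G v) - 32 * (sn G : ℤ)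

/-- The measure. -/
noncomputable def mu (G : SimpleGraph V) : ℕ := ∑ v, dg G v

theorem mu_lt {G H : SimpleGraph V} (h : ∀ a b, G.Adj a b → H.Adj a b) (a b : V) (hH : H.Adj a b)
    (hG : ¬ G.Adj a b) : mu G < mu H := by
  apply Finset.sum_lt_sum (fun v _ => dg_mono h v)
  refine ⟨a, Finset.mem_univ _, Finset.card_lt_card ?_⟩
  rw [Finset.ssubset_iff_of_subset]
  · exact ⟨b, mem_nb.2 hH, fun h => hG (mem_nb.1 h)⟩
  · intro x hx; exact mem_nb.2 (h _ _ (mem_nb.1 hx))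

theorem mu_del {G : SimpleGraph V} {v : V} (h : 0 < dg G v) : mu (del G v) < mu G := by
  obtain ⟨x, hx⟩ := dg_pos.1 h
  exact mu_lt (fun a b hab => hab.1) v x hx (fun h => h.2.1 rfl)

theorem psum_del (G : SimpleGraph V) (v : V) : ∑ x, psi (dg G x) =
    ∑ x, psi (dg (del G v) x) + psi (dg G v) + ∑ x ∈ nb G v, gg (dg G x) := by
  have h1 : ∀ x, psi (dg G x) = psi (dg (del G v) x) + (if x = v then psi (dg G v) else 0)
      + (if x ∈ nb G v then gg (dg G x) else 0) := by
    intro x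
    by_cases hxv : x = v
    · subst hxv
      have : x ∉ nb G x := fun h => (mem_nb.1 h).ne rfl
      rw [dg_del_self]; simp [this, psi]
    · by_cases hx : G.Adj v x
      · have := dg_del_adj hx
        have h2 : dg (del G v) x = dg G x - 1 := by omega
        simp only [hxv, if_false, mem_nb, hx, if_true, h2, gg]
        ring
      · rw [dg_del_nadj hxv hx]; simp [hxv, mem_nb, hx]
  rw [Finset.sum_congr rfl (fun x _ => h1 x), Finset.sum_add_distrib, Finset.sum_add_distrib]
  simp [Finset.sum_ite_mem]

theorem F_del (G : SimpleGraph V) (v : V) :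
    F (del G v) + psi (dg G v) + ∑ x ∈ nb G v, gg (dg G x) - 32 ≤ F G := by
  have h1 := psum_del G v
  have h2 := sn_del G v
  unfold F
  omega

/-- `F_del` with the same transversal number. -/
theorem F_del' {G : SimpleGraph V} {v : V} (h : sn G ≤ sn (del G v)) :
    F (del G v) + psi (dg G v) + ∑ x ∈ nb G v, gg (dg G x) ≤ F G := by
  have h1 := psum_del G v
  unfold F
  omega

theorem F_noedge {G : SimpleGraph V} (h : ∀ a b, ¬ G.Adj a b) : F G = 0 := by
  have h1 : ∀ v, dg G v = 0 := by
    intro v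
    by_contra h'
    obtain ⟨x, hx⟩ := dg_pos.1 (Nat.pos_of_ne_zero h')
    exact h _ _ hx
  unfold F
  rw [sn_zero h]
  simp [h1, psi]

/-- Every degree is 0 or at least 3. -/
def Min3 (G : SimpleGraph V) : Prop := ∀ a b, G.Adj a b → 3 ≤ dg G a

theorem gsum_ge {G : SimpleGraph V} {v : V} (hm : Min3 G) (T : Finset V) (hT : ∀ t ∈ T, G.Adj v t) :
    ∑ t ∈ T, gg (dg G t) + 3 * ((dg G v : ℤ) - T.card) ≤ ∑ x ∈ nb G v, gg (dg G x) := by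
  have hsub : T ⊆ nb G v := fun t ht => mem_nb.2 (hT t ht)
  rw [← Finset.sum_sdiff hsub]
  have h1 : (∑ x ∈ nb G v \ T, (3 : ℤ)) ≤ ∑ x ∈ nb G v \ T, gg (dg G x) := by
    apply Finset.sum_le_sum
    intro x hx
    have hx' := mem_nb.1 (Finset.mem_sdiff.1 hx).1
    exact gg_ge3 (hm x v hx'.symm)
  rw [Finset.sum_const, Finset.card_sdiff_of_subset hsub] at h1
  have h2 := Finset.card_le_card hsub
  simp only [nsmul_eq_mul] at h1
  push_cast [h2] at h1
  unfold dg at *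
  linarith

/-- Connectivity (up to isolated vertices). -/
def Conn (G : SimpleGraph V) : Prop :=
  ∀ A : Set V, (∀ a b, G.Adj a b → a ∈ A → b ∈ A) → (∃ a ∈ A, ∃ b, G.Adj a b) →
    ∀ a b, G.Adj a b → a ∈ A

theorem Conn_of_connected {G : SimpleGraph V} (h : G.Connected) : Conn G := by
  intro A hA ⟨a, ha, _⟩ x _ _
  obtain ⟨p⟩ := h.preconnected a x
  induction p with
  | nil => exact ha
  | cons hadj _ ih => exact ih (hA _ _ hadj ha) ⟨_, hadj.symm⟩ (by assumption)

end
end K4T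

namespace K4T

open Classical

set_option linter.unusedSectionVars false
set_option linter.unusedVariables false

section
variable {V : Type*} [Fintype V]

/-- The four claims proved by simultaneous induction. -/
def Cl (G : SimpleGraph V) : Prop :=
  -6 ≤ F G ∧ ((∃ v, dg G v = 3 ∨ dg G v = 4) → -4 ≤ F G) ∧
  ((∀ v, dg G v ≤ 4) → ((∃ v, dg G v = 3) ∨ ∀ v, dg G v ≤ 3) → 0 ≤ F G) ∧
  (∀ a b c, G.Adj a b → G.Adj b c → G.Adj a c → dg G a = 3 → dg G b = 3 → dg G c = 3 →
    (∃ v, 4 ≤ dg G v) → 1 ≤ F G)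

/-- Induction hypothesis. -/
def IH (G : SimpleGraph V) : Prop := ∀ H : SimpleGraph V, mu H < mu G → Conn H → Cl H

theorem Cl.one {G : SimpleGraph V} (h : Cl G) : -6 ≤ F G := h.1
theorem Cl.two {G : SimpleGraph V} (h : Cl G) (v : V) (hv : dg G v = 3 ∨ dg G v = 4) : -4 ≤ F G :=
  h.2.1 ⟨v, hv⟩
theorem Cl.three {G : SimpleGraph V} (h : Cl G) (h4 : ∀ v, dg G v ≤ 4) (v : V) (hv : dg G v = 3) :
    0 ≤ F G := h.2.2.1 h4 (Or.inl ⟨v, hv⟩)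
theorem Cl.cubic {G : SimpleGraph V} (h : Cl G) (h4 : ∀ v, dg G v ≤ 3) :
    0 ≤ F G := h.2.2.1 (fun v => (h4 v).trans (by norm_num)) (Or.inr h4)
theorem Cl.tri1 {G : SimpleGraph V} (h : Cl G) {a b c : V} (h1 : G.Adj a b) (h2 : G.Adj b c)
    (h3 : G.Adj a c) (ha : dg G a = 3) (hb : dg G b = 3) (hc : dg G c = 3) (v : V)
    (hv : 4 ≤ dg G v) : 1 ≤ F G := h.2.2.2 a b c h1 h2 h3 ha hb hc ⟨v, hv⟩
theorem Cl.tri0 {G : SimpleGraph V} (h : Cl G) {a b c : V} (h1 : G.Adj a b) (h2 : G.Adj b c)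
    (h3 : G.Adj a c) (ha : dg G a = 3) (hb : dg G b = 3) (hc : dg G c = 3) : 0 ≤ F G := by
  by_cases hv : ∃ v, 4 ≤ dg G v
  · have := h.2.2.2 a b c h1 h2 h3 ha hb hc hv
    omega
  · push Not at hv
    exact h.cubic fun v => by have := hv v; omega

theorem Conn_suppress {G H : SimpleGraph V} (x : V) (hG : Conn G)
    (hH : ∀ u v, G.Adj u v → u ≠ x → v ≠ x → H.Adj u v)
    (hj : ∀ y z, G.Adj x y → G.Adj x z → y ≠ z → H.Adj y z)
    (hr : ∀ u v, H.Adj u v → u ≠ x ∧ (G.Adj u v ∨ G.Adj x u)) : Conn H := by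
  intro A hA ⟨a, ha, b, hab⟩ c d hcd
  have key := hG {y | (y ≠ x ∧ y ∈ A) ∨ (y = x ∧ ∃ w ∈ A, G.Adj x w)} ?_ ?_ c
  · have hc : ∃ e, G.Adj c e := by
      rcases (hr c d hcd).2 with h | h
      · exact ⟨_, h⟩
      · exact ⟨_, h.symm⟩
    obtain ⟨e, he⟩ := hc
    rcases key e he with h | h
    · exact h.2
    · exact absurd h.1 (hr c d hcd).1
  · intro p q hpq hp
    by_cases hq : q = x
    · subst hq
      right
      refine ⟨rfl, p, ?_, hpq.symm⟩
      rcases hp with h | h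
      · exact h.2
      · exact absurd h.1 hpq.ne
    · left
      refine ⟨hq, ?_⟩
      rcases hp with h | ⟨rfl, w, hw, hxw⟩
      · exact hA p q (hH _ _ hpq h.1 hq) h.2
      · by_cases hwq : w = q
        · exact hwq ▸ hw
        · exact hA w q (hj w q hxw hpq hwq) hw
  · refine ⟨a, Or.inl ⟨(hr a b hab).1, ha⟩, ?_⟩
    rcases (hr a b hab).2 with h | h
    · exact ⟨_, h⟩
    · exact ⟨_, h.symm⟩

/-- Removing a vertex of degree at most two whose neighbours are adjacent. -/
theorem D2gen {G : SimpleGraph V} (x : V) (hG : Conn G) (hd : dg G x ≤ 2)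
    (hj : ∀ y z, G.Adj x y → G.Adj x z → y ≠ z → G.Adj y z) :
    Conn (del G x) ∧ F (del G x) + ∑ y ∈ nb G x, gg (dg G y) ≤ F G := by
  have hj' : ∀ y z, G.Adj x y → G.Adj x z → y ≠ z → (del G x).Adj y z :=
    fun y z h1 h2 h3 => ⟨hj y z h1 h2 h3, h1.ne', h2.ne'⟩
  refine ⟨Conn_suppress x hG (fun u v h1 h2 h3 => ⟨h1, h2, h3⟩) hj'
    (fun u v h => ⟨h.2.1, Or.inl h.1⟩), ?_⟩
  have h2 : ∃ a b, ∀ y, G.Adj x y → y = a ∨ y = b := by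
    by_cases h0 : dg G x = 0
    · refine ⟨x, x, fun y hy => ?_⟩
      have := dg_pos_of_adj hy
      omega
    · by_cases h1 : dg G x = 1
      · obtain ⟨a, ha⟩ := Finset.card_eq_one.1 h1
        refine ⟨a, a, fun y hy => ?_⟩
        have := mem_nb.2 hy
        rw [ha] at this
        simp at this; simp [this]
      · obtain ⟨a, b, -, ha⟩ := Finset.card_eq_two.1 (show (nb G x).card = 2 by unfold dg at *; omega)
        refine ⟨a, b, fun y hy => ?_⟩
        have := mem_nb.2 hy
        rw [ha] at this
        simpa using this
  obtain ⟨a, b, hab⟩ := h2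
  have h := F_del' (v := x) (sn_suppress x a b hab (fun u v h1 h2 h3 => ⟨h1, h2, h3⟩) hj')
  have hp : psi (dg G x) = 0 := by simp [psi, hd]
  omega

theorem nb_two {G : SimpleGraph V} {x p q : V} (hd : dg G x = 2) (hp : G.Adj x p) (hq : G.Adj x q)
    (hpq : p ≠ q) : nb G x = {p, q} := by
  symm
  apply Finset.eq_of_subset_of_card_le
  · intro y hy
    simp at hy
    rcases hy with rfl | rfl <;> rw [mem_nb] <;> assumption
  · rw [Finset.card_pair hpq]; exact hd.le

theorem D2 {G : SimpleGraph V} {x p q : V} (hG : Conn G) (hd : dg G x = 2) (hp : G.Adj x p)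
    (hq : G.Adj x q) (hpq : G.Adj p q) :
    Conn (del G x) ∧ F (del G x) + gg (dg G p) + gg (dg G q) ≤ F G := by
  have hn := nb_two hd hp hq hpq.ne
  have := D2gen x hG hd.le (by
    intro y z hy hz hyz
    have h1 := mem_nb.2 hy
    have h2 := mem_nb.2 hz
    rw [hn] at h1 h2
    simp at h1 h2
    rcases h1 with rfl | rfl <;> rcases h2 with rfl | rfl
    · exact absurd rfl hyz
    · exact hpq
    · exact hpq.symm
    · exact absurd rfl hyz)
  rw [hn, Finset.sum_pair hpq.ne] at this
  exact ⟨this.1, by linarith [this.2]⟩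

theorem step01 {G : SimpleGraph V} (x : V) (hG : Conn G) (ih : IH G) (hd0 : 0 < dg G x)
    (hd : dg G x ≤ 2) (hj : ∀ y z, G.Adj x y → G.Adj x z → y ≠ z → G.Adj y z) : Cl G := by
  obtain ⟨hc, hF⟩ := D2gen x hG hd hj
  have hcl := ih _ (mu_del hd0) hc
  have hg : ∀ y, G.Adj x y → F (del G x) + gg (dg G y) ≤ F G := by
    intro y hy
    have := Finset.single_le_sum (f := fun y => gg (dg G y)) (fun i _ => gg_nonneg _) (mem_nb.2 hy)
    linarith
  have hg0 : F (del G x) ≤ F G := by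
    obtain ⟨y, hy⟩ := dg_pos.1 hd0
    have := hg y hy
    have := gg_nonneg (dg G y)
    linarith
  have hle : ∀ v, dg (del G x) v ≤ dg G v := dg_mono (fun a b h => h.1)
  have h1 := hcl.one
  refine ⟨by linarith, ?_, ?_, ?_⟩
  · rintro ⟨v, hv⟩
    by_cases hxv : G.Adj x v
    · have h2 := hg v hxv
      rcases hv with hv | hv <;> rw [hv] at h2
      · rw [gg3] at h2; linarith
      · rw [gg4] at h2; linarith
    · have hne : v ≠ x := by rintro rfl; omega
      have := hcl.two v (by rw [dg_del_nadj hne hxv]; exact hv)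
      linarith
  · intro h4 h
    rcases h with ⟨v, hv⟩ | h3
    · by_cases hxv : G.Adj x v
      · have h2 := hg v hxv
        rw [hv, gg3] at h2; linarith
      · have hne : v ≠ x := by rintro rfl; omega
        have := hcl.three (fun y => (hle y).trans (h4 y)) v (by rw [dg_del_nadj hne hxv]; exact hv)
        linarith
    · have := hcl.cubic (fun y => (hle y).trans (h3 y))
      linarith
  · rintro a b c hab hbc hac ha hb hc ⟨v, hv⟩
    have hit : ∀ t, dg G t = 3 → G.Adj x t → 1 ≤ F G := by
      intro t ht hxt
      have h2 := hg t hxt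
      rw [ht, gg3] at h2; linarith
    by_cases hxa : G.Adj x a
    · exact hit a ha hxa
    by_cases hxb : G.Adj x b
    · exact hit b hb hxb
    by_cases hxc : G.Adj x c
    · exact hit c hc hxc
    have hax : a ≠ x := by rintro rfl; omega
    have hbx : b ≠ x := by rintro rfl; omega
    have hcx : c ≠ x := by rintro rfl; omega
    have hvx : v ≠ x := by rintro rfl; omega
    have e1 : (del G x).Adj a b := ⟨hab, hax, hbx⟩
    have e2 : (del G x).Adj b c := ⟨hbc, hbx, hcx⟩
    have e3 : (del G x).Adj a c := ⟨hac, hax, hcx⟩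
    have d1 : dg (del G x) a = 3 := by rw [dg_del_nadj hax hxa]; exact ha
    have d2 : dg (del G x) b = 3 := by rw [dg_del_nadj hbx hxb]; exact hb
    have d3 : dg (del G x) c = 3 := by rw [dg_del_nadj hcx hxc]; exact hc
    by_cases hxv : G.Adj x v
    · have := hcl.tri0 e1 e2 e3 d1 d2 d3
      have h2 := hg v hxv
      have := gg_ge3 (d := dg G v) (by omega)
      linarith
    · have := hcl.tri1 e1 e2 e3 d1 d2 d3 v (by rw [dg_del_nadj hvx hxv]; exact hv)
      linarith

theorem step2 {G : SimpleGraph V} {x p q : V} (hG : Conn G) (ih : IH G) (hd : dg G x = 2)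
    (hp : G.Adj x p) (hq : G.Adj x q) (hpq : p ≠ q) (hnadj : ¬ G.Adj p q) : Cl G := by
  have hn := nb_two hd hp hq hpq
  have hnb : ∀ y, G.Adj x y ↔ y = p ∨ y = q := by
    intro y; rw [← mem_nb, hn]; simp
  obtain ⟨H, hHdef⟩ : ∃ H : SimpleGraph V, ∀ u v, H.Adj u v ↔ (del G x).Adj u v ∨ (u = p ∧ v = q) ∨
      (u = q ∧ v = p) := by
    refine ⟨del G x ⊔ SimpleGraph.edge p q, fun u v => ?_⟩
    rw [SimpleGraph.sup_adj, SimpleGraph.edge_adj]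
    constructor
    · rintro (h | h)
      · exact Or.inl h
      · exact Or.inr h.1
    · rintro (h | ⟨rfl, rfl⟩ | ⟨rfl, rfl⟩)
      · exact Or.inl h
      · exact Or.inr ⟨Or.inl ⟨rfl, rfl⟩, hpq⟩
      · exact Or.inr ⟨Or.inr ⟨rfl, rfl⟩, hpq.symm⟩
  have hHG : ∀ u v, G.Adj u v → u ≠ x → v ≠ x → H.Adj u v := fun u v h1 h2 h3 =>
    (hHdef u v).2 (Or.inl ⟨h1, h2, h3⟩)
  have hj : ∀ y z, G.Adj x y → G.Adj x z → y ≠ z → H.Adj y z := by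
    intro y z hy hz hyz
    rw [hnb] at hy hz
    rw [hHdef]
    rcases hy with rfl | rfl <;> rcases hz with rfl | rfl <;> simp_all
  have hc : Conn H := by
    refine Conn_suppress x hG hHG hj ?_
    intro u v huv
    rw [hHdef] at huv
    rcases huv with h | ⟨rfl, rfl⟩ | ⟨rfl, rfl⟩
    · exact ⟨h.2.1, Or.inl h.1⟩
    · exact ⟨hp.ne', Or.inr hp⟩
    · exact ⟨hq.ne', Or.inr hq⟩
  have hs : sn G ≤ sn H := sn_suppress x p q (fun y hy => (hnb y).1 hy) hHG hj
  have hdp : ∀ p q : V, G.Adj x p → G.Adj x q → p ≠ q → ¬ G.Adj p q → (∀ u, H.Adj p u ↔ (del G x).Adj p u ∨ u = q) →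
      dg H p = dg G p := by
    intro p q hp hq hpq hnadj h
    have : nb H p = insert q (nb (del G x) p) := by
      ext u; rw [mem_nb, h, Finset.mem_insert, mem_nb]; tauto
    unfold dg
    rw [this, Finset.card_insert_of_notMem]
    · exact dg_del_adj hp
    · rw [mem_nb]; exact fun h => hnadj h.1
  have hdeg : ∀ y, y ≠ x → dg H y = dg G y := by
    intro y hy
    by_cases hyp : y = p
    · subst hyp
      exact hdp y q hp hq hpq hnadj (fun u => by rw [hHdef]; simp [hpq])
    by_cases hyq : y = q
    · subst hyq
      exact hdp y p hq hp hpq.symm (fun h => hnadj h.symm) (fun u => by rw [hHdef]; simp [hpq.symm])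
    have hxy : ¬ G.Adj x y := by rw [hnb]; tauto
    rw [← dg_del_nadj hy hxy]
    apply dg_congr
    intro b
    rw [hHdef]; simp [hyp, hyq]
  have hdx : dg H x = 0 := by
    by_contra h
    obtain ⟨y, hy⟩ := dg_pos.1 (Nat.pos_of_ne_zero h)
    rw [hHdef] at hy
    rcases hy with h | ⟨h, _⟩ | ⟨h, _⟩
    · exact h.2.1 rfl
    · exact hp.ne h
    · exact hq.ne h
  have hle : ∀ y, dg H y ≤ dg G y := by
    intro y
    by_cases hy : y = x
    · subst hy; omega
    · exact (hdeg y hy).le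
  have hmu : mu H < mu G := by
    apply Finset.sum_lt_sum (fun v _ => hle v)
    exact ⟨x, Finset.mem_univ _, by omega⟩
  have hF : F H ≤ F G := by
    have : ∑ v, psi (dg H v) ≤ ∑ v, psi (dg G v) := Finset.sum_le_sum fun v _ => psi_le (hle v)
    unfold F
    omega
  have hcl := ih H hmu hc
  have hx3 : ∀ v, 3 ≤ dg G v → v ≠ x := by rintro v h rfl; omega
  refine ⟨hcl.one.trans hF, ?_, ?_, ?_⟩
  · rintro ⟨v, hv⟩
    refine (hcl.two v ?_).trans hF
    rw [hdeg v (hx3 v (by omega))]; exact hv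
  · intro h4 h
    rcases h with ⟨v, hv⟩ | h3
    · refine (hcl.three (fun y => (hle y).trans (h4 y)) v ?_).trans hF
      rw [hdeg v (hx3 v (by omega))]; exact hv
    · exact (hcl.cubic (fun y => (hle y).trans (h3 y))).trans hF
  · rintro a b c hab hbc hac ha hb hc ⟨v, hv⟩
    have hax := hx3 a (by omega)
    have hbx := hx3 b (by omega)
    have hcx := hx3 c (by omega)
    have hvx := hx3 v (by omega)
    refine (hcl.tri1 (hHG _ _ hab hax hbx) (hHG _ _ hbc hbx hcx) (hHG _ _ hac hax hcx) ?_ ?_ ?_ v ?_).trans hF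
    · rw [hdeg _ hax]; exact ha
    · rw [hdeg _ hbx]; exact hb
    · rw [hdeg _ hcx]; exact hc
    · rw [hdeg _ hvx]; exact hv

theorem step012 {G : SimpleGraph V} (hG : Conn G) (ih : IH G) (hm : ¬ Min3 G) : Cl G := by
  unfold Min3 at hm
  push Not at hm
  obtain ⟨x, y, hxy, hd⟩ := hm
  have h0 := dg_pos_of_adj hxy
  by_cases hj : ∀ y z, G.Adj x y → G.Adj x z → y ≠ z → G.Adj y z
  · exact step01 x hG ih h0 (by omega) hj
  · push Not at hj
    obtain ⟨p, q, hp, hq, hpq, hn⟩ := hj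
    refine step2 hG ih ?_ hp hq hpq hn
    have : 2 ≤ dg G x := by
      rw [← Finset.card_pair hpq]
      apply Finset.card_le_card
      intro y hy
      simp at hy
      rcases hy with rfl | rfl <;> rw [mem_nb] <;> assumption
    omega

end
end K4T

namespace K4T

open Classical

set_option linter.unusedSectionVars false
set_option linter.unusedVariables false

section
variable {V : Type*} [Fintype V]

/-- A piece hanging at the vertex `v`. -/
structure Piece (K : SimpleGraph V) (v : V) (C : Set V) : Prop where
  hv : v ∉ C
  out : ∀ a b, a ∈ C → b ∉ C → K.Adj a b → b = v
  att : ∃ x ∈ C, K.Adj v x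
  c1 : Conn (res K C)
  c2 : Conn (res K Cᶜ)
  oth : ∃ x x', x ∉ C ∧ (del K v).Adj x x'

theorem reach_piece {K : SimpleGraph V} {v a a' : V} (hK : Conn K) (haa' : (del K v).Adj a a')
    (x x' : V) (hxx' : (del K v).Adj x x') (hax : ¬ (del K v).Reachable a x) :
    Piece K v {y | (del K v).Reachable a y} := by
  have hv : v ∉ {y | (del K v).Reachable a y} := by
    rintro ⟨p⟩
    have hp := p.reverse
    cases hp with
    | nil => exact haa'.2.1 rfl
    | cons h _ => exact h.2.1 rfl
  have out : ∀ p q, p ∈ {y | (del K v).Reachable a y} → q ∉ {y | (del K v).Reachable a y} → K.Adj p q → q = v := by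
    intro p q hp hq hpq
    by_contra hqv
    apply hq
    have hpv : p ≠ v := fun h => hv (h ▸ hp)
    exact hp.trans (SimpleGraph.Adj.reachable (⟨hpq, hpv, hqv⟩ : (del K v).Adj p q))
  have att : ∃ y ∈ {y | (del K v).Reachable a y}, K.Adj v y := by
    by_contra hcon
    push Not at hcon
    apply hax
    refine hK {y | (del K v).Reachable a y} ?_ ⟨a, SimpleGraph.Reachable.refl _, a', haa'.1⟩ x x' hxx'.1
    intro p q hpq hp
    by_contra hq
    have := out p q hp hq hpq
    subst this
    exact hcon p hp hpq.symm
  refine ⟨hv, out, att, ?_, ?_, ⟨x, x', hax, hxx'⟩⟩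
  · intro A hA ⟨p, hp, p', hpp'⟩ q q' hqq'
    have hr : (del K v).Reachable p q := hpp'.2.1.symm.trans hqq'.2.1
    obtain ⟨w⟩ := hr
    have gen : ∀ p q, (del K v).Walk p q → p ∈ {y | (del K v).Reachable a y} → p ∈ A → q ∈ A := by
      intro p q w
      induction w with
      | nil => exact fun _ h => h
      | cons h _ ih =>
        intro h1 h2
        have h3 := h1.trans h.reachable
        exact ih h3 (hA _ _ ⟨h.1, h1, h3⟩ h2)
    exact gen p q w hpp'.2.1 hp
  · intro A hA ⟨p, hp, p', hpp'⟩ q q' hqq'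
    generalize {y | (del K v).Reachable a y} = C at *
    by_cases hvA : v ∈ A
    · have := hK (A ∪ C) ?_ ⟨p, Or.inl hp, p', hpp'.1⟩ q q' hqq'.1
      · exact this.resolve_right hqq'.2.1
      · intro y z hyz hy
        by_cases hz : z ∈ C
        · exact Or.inr hz
        · by_cases hyC : y ∈ C
          · left; rw [out y z hyC hz hyz]; exact hvA
          · exact Or.inl (hA y z ⟨hyz, hyC, hz⟩ (hy.resolve_right hyC))
    · exfalso
      obtain ⟨y, hyC, hvy⟩ := att
      have := hK (A \ C) ?_ ⟨p, ⟨hp, hpp'.2.1⟩, p', hpp'.1⟩ y v hvy.symm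
      · exact this.2 hyC
      · intro s t hst hs
        by_cases ht : t ∈ C
        · have := out t s ht hs.2 hst.symm
          exact absurd (this ▸ hs.1) hvA
        · exact ⟨hA s t ⟨hst, hs.2, ht⟩ hs.1, ht⟩

theorem cutl {K : SimpleGraph V} {v : V} (hK : Conn K) (hc : ¬ Conn (del K v)) :
    ∃ C, Piece K v C ∧ sn K ≤ sn (res K C) + sn (res K Cᶜ) := by
  unfold Conn at hc
  push Not at hc
  obtain ⟨A, hA, ⟨a, ha, a', haa'⟩, x, x', hxx', hxA⟩ := hc
  have hrA : ∀ y, (del K v).Reachable a y → y ∈ A := by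
    rintro y ⟨w⟩
    have gen : ∀ p q, (del K v).Walk p q → p ∈ A → q ∈ A := by
      intro p q w
      induction w with
      | nil => exact fun h => h
      | cons h _ ih => exact fun h1 => ih (hA _ _ h h1)
    exact gen _ _ w ha
  have hax : ¬ (del K v).Reachable a x := fun h => hxA (hrA x h)
  have P1 := reach_piece hK haa' x x' hxx' hax
  have P2 := reach_piece hK hxx' a a' haa' (fun h => hax h.symm)
  have hdis : ∀ y, (del K v).Reachable a y → ¬ (del K v).Reachable x y := fun y h1 h2 => hax (h1.trans h2.symm)
  have hdis' : ∀ y, y ∈ {y | (del K v).Reachable a y} → y ∉ {y | (del K v).Reachable x y} := hdis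
  clear hdis hax hrA
  generalize {y | (del K v).Reachable a y} = C at *
  generalize {y | (del K v).Reachable x y} = D at *
  by_cases h1 : sn (res K (C ∪ {v})) ≤ sn (res K C)
  · exact ⟨C, P1, (sn_side v C P1.out P1.hv).trans (by omega)⟩
  have h1' : sn (res K (C ∪ {v})) ≤ sn (res K C) + 1 := by
    have := sn_del (res K (C ∪ {v})) v
    have h2 : sn (del (res K (C ∪ {v})) v) ≤ sn (res K C) := by
      apply sn_mono
      rintro p q ⟨⟨h1, h2, h3⟩, h4, h5⟩
      exact ⟨h1, h2.resolve_right h4, h3.resolve_right h5⟩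
    omega
  by_cases h2 : sn (res K (Cᶜ \ {v})) + 1 ≤ sn (res K Cᶜ)
  · refine ⟨C, P1, ?_⟩
    have e1 := sn_del K v
    have e2 := sn_side (G := del K v) v C (fun a b ha hb hab => P1.out a b ha hb hab.1) P1.hv
    have e3 : sn (res (del K v) (C ∪ {v})) ≤ sn (res K C) := by
      apply sn_mono
      rintro p q ⟨⟨h1, h4, h5⟩, h2, h3⟩
      exact ⟨h1, h2.resolve_right h4, h3.resolve_right h5⟩
    have e4 : sn (res (del K v) Cᶜ) ≤ sn (res K (Cᶜ \ {v})) := by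
      apply sn_mono
      rintro p q ⟨⟨h1, h4, h5⟩, h2, h3⟩
      exact ⟨h1, ⟨h2, h4⟩, h3, h5⟩
    omega
  · refine ⟨D, P2, ?_⟩
    have e1 := sn_side v C P1.out P1.hv
    have e2 := sn_side (G := res K (Cᶜ \ {v})) v D (fun a b ha hb hab => P2.out a b ha hb hab.1) P2.hv
    have e3 : sn (res (res K (Cᶜ \ {v})) (D ∪ {v})) ≤ sn (res K D) := by
      apply sn_mono
      rintro p q ⟨⟨h1, h4, h5⟩, h2, h3⟩
      exact ⟨h1, h2.resolve_right h4.2, h3.resolve_right h5.2⟩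
    have e4 := sn_super (G := res K Dᶜ) (C ∪ {v}) (Cᶜ \ {v}) (by
      rw [Set.disjoint_left]
      rintro y (hy | hy) h
      · exact h.1 hy
      · exact h.2 hy)
    have e5 : sn (res (res K (Cᶜ \ {v})) Dᶜ) ≤ sn (res (res K Dᶜ) (Cᶜ \ {v})) := by
      apply sn_mono
      rintro p q ⟨⟨h1, h4⟩, h2⟩
      exact ⟨⟨h1, h2⟩, h4⟩
    have e6 : sn (res K (C ∪ {v})) ≤ sn (res (res K Dᶜ) (C ∪ {v})) := by
      apply sn_mono
      have : ∀ y, y ∈ C ∪ {v} → y ∈ Dᶜ := by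
        rintro y (hy | hy)
        · exact hdis' y hy
        · rw [show y = v from hy]; exact P2.hv
      rintro p q ⟨h1, h2, h3⟩
      exact ⟨⟨h1, this p h2, this q h3⟩, h2, h3⟩
    omega

/-- Neighbours of `v` inside `C`. -/
noncomputable def nbC (K : SimpleGraph V) (v : V) (C : Set V) : Finset V := (nb K v).filter (· ∈ C)

theorem mem_nbC {K : SimpleGraph V} {v x : V} {C : Set V} : x ∈ nbC K v C ↔ K.Adj v x ∧ x ∈ C := by
  simp [nbC, mem_nb]

theorem dg_resC_out {K : SimpleGraph V} {C : Set V} {x : V} (h : x ∉ C) : dg (res K C) x = 0 := by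
  by_contra h0
  obtain ⟨y, hy⟩ := dg_pos.1 (Nat.pos_of_ne_zero h0)
  exact h hy.2.1

theorem dg_resC_nadj {K : SimpleGraph V} {v : V} {C : Set V} (P : Piece K v C) {x : V} (h : x ∈ C)
    (hx : ¬ K.Adj v x) : dg (res K C) x = dg K x := by
  apply dg_congr
  intro b
  refine ⟨fun h => h.1, fun hb => ⟨hb, h, ?_⟩⟩
  by_contra hbC
  have := P.out x b h hbC hb
  subst this
  exact hx hb.symm

theorem dg_resC_adj {K : SimpleGraph V} {v : V} {C : Set V} (P : Piece K v C) {x : V} (h : x ∈ C)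
    (hx : K.Adj v x) : dg (res K C) x + 1 = dg K x := by
  rw [← dg_del_adj hx]
  congr 1
  apply dg_congr
  intro b
  constructor
  · rintro ⟨h1, h2, h3⟩
    exact ⟨h1, hx.ne', fun h => P.hv (h ▸ h3)⟩
  · rintro ⟨h1, h2, h3⟩
    refine ⟨h1, h, ?_⟩
    by_contra hbC
    exact h3 (P.out x b h hbC h1)

theorem dg_resD {K : SimpleGraph V} {v : V} {C : Set V} (P : Piece K v C) {x : V} (h : x ∉ C)
    (hx : x ≠ v) : dg (res K Cᶜ) x = dg K x := by
  apply dg_congr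
  intro b
  refine ⟨fun h => h.1, fun hb => ⟨hb, h, ?_⟩⟩
  intro hbC
  exact hx (P.out b x hbC h hb.symm)

theorem dg_resD_v {K : SimpleGraph V} {v : V} {C : Set V} (P : Piece K v C) :
    dg (res K Cᶜ) v + (nbC K v C).card = dg K v := by
  have h : nb (res K Cᶜ) v = (nb K v).filter (fun x => ¬ x ∈ C) := by
    ext y
    rw [mem_nb, Finset.mem_filter, mem_nb]
    exact ⟨fun h => ⟨h.1, h.2.2⟩, fun h => ⟨h.1, P.hv, h.2⟩⟩
  unfold dg nbC
  rw [h, add_comm, Finset.card_filter_add_card_filter_not]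

theorem F_cut {K : SimpleGraph V} {v : V} {C : Set V} (P : Piece K v C)
    (hs : sn K ≤ sn (res K C) + sn (res K Cᶜ)) :
    F (res K C) + F (res K Cᶜ) + ∑ x ∈ nbC K v C, gg (dg K x) +
      (psi (dg K v) - psi (dg (res K Cᶜ) v)) ≤ F K := by
  have h1 : ∀ x, psi (dg K x) = psi (dg (res K C) x) + psi (dg (res K Cᶜ) x) +
      (if x ∈ nbC K v C then gg (dg K x) else 0) +
      (if x = v then (psi (dg K v) - psi (dg (res K Cᶜ) v)) else 0) := by
    intro x
    by_cases hxv : x = v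
    · subst hxv
      rw [dg_resC_out P.hv]
      simp [mem_nbC, psi]
    by_cases hxC : x ∈ C
    · have : dg (res K Cᶜ) x = 0 := dg_resC_out (by simpa using hxC)
      rw [this]
      by_cases hx : K.Adj v x
      · have := dg_resC_adj P hxC hx
        rw [show dg (res K C) x = dg K x - 1 by omega]
        simp only [mem_nbC, hx, hxC, and_self, if_true, hxv, if_false, gg, psi]
        simp
      · rw [dg_resC_nadj P hxC hx]
        simp [mem_nbC, hx, hxv, psi]
    · rw [dg_resD P hxC hxv, dg_resC_out hxC]
      simp [mem_nbC, hxC, hxv, psi]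
  have h2 : ∑ x, psi (dg K x) = ∑ x, psi (dg (res K C) x) + ∑ x, psi (dg (res K Cᶜ) x) +
      ∑ x ∈ nbC K v C, gg (dg K x) + (psi (dg K v) - psi (dg (res K Cᶜ) v)) := by
    rw [Finset.sum_congr rfl (fun x _ => h1 x), Finset.sum_add_distrib, Finset.sum_add_distrib,
      Finset.sum_add_distrib]
    simp [Finset.sum_ite_mem]
  unfold F
  omega

theorem mu_resC {K : SimpleGraph V} {v : V} {C : Set V} (P : Piece K v C) : mu (res K C) < mu K := by
  obtain ⟨x, hx, hvx⟩ := P.att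
  exact mu_lt (fun a b h => h.1) v x hvx (fun h => P.hv h.2.1)

theorem mu_resD {K : SimpleGraph V} {v : V} {C : Set V} (P : Piece K v C) : mu (res K Cᶜ) < mu K := by
  obtain ⟨x, hx, hvx⟩ := P.att
  exact mu_lt (fun a b h => h.1) v x hvx (fun h => h.2.2 hx)

/-- Lower bound for the sum over the neighbours in the piece. -/
theorem sumC_ge {K : SimpleGraph V} {v : V} {C : Set V} (T : Finset V)
    (hT : ∀ t ∈ T, K.Adj v t ∧ t ∈ C) :
    ∑ t ∈ T, gg (dg K t) ≤ ∑ x ∈ nbC K v C, gg (dg K x) :=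
  Finset.sum_le_sum_of_subset_of_nonneg (fun t ht => mem_nbC.2 (hT t ht)) (fun _ _ _ => gg_nonneg _)

theorem psi_drop_ge {a b : ℕ} (h : a < b) (hb : 3 ≤ b) :
    3 ≤ psi b - psi a ∧ (b ≤ 4 → 4 ≤ psi b - psi a) ∧ (b = 3 → 8 = psi b - psi a) ∧
    (a ≤ 3 → 4 ≤ psi b - psi a) ∧ (a ≤ 2 → 8 ≤ psi b - psi a):= by
  unfold psi; split_ifs <;> omega

theorem gg_cases {d : ℕ} (h : 3 ≤ d) : 3 ≤ gg d ∧ (d ≤ 4 → 4 ≤ gg d) ∧ (d = 3 → gg d = 8) ∧ (d = 4 → gg d = 4) := by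
  unfold gg psi; split_ifs <;> omega

end
end K4T

namespace K4T

open Classical

set_option linter.unusedSectionVars false
set_option linter.unusedVariables false

section
variable {V : Type*} [Fintype V]

theorem step3 {G : SimpleGraph V} (hG : Conn G) (ih : IH G) (hm : Min3 G) {v : V}
    (hcut : ¬ Conn (del G v)) : Cl G := by
  obtain ⟨C, P, hs⟩ := cutl hG hcut
  have hF := F_cut P hs
  have cl1 := ih _ (mu_resC P) P.c1
  have cl2 := ih _ (mu_resD P) P.c2
  have l1 := cl1.one
  have l2 := cl2.one
  obtain ⟨x, hx, hvx⟩ := P.att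
  have hxd : 3 ≤ dg G x := hm x v hvx.symm
  have hvd : 3 ≤ dg G v := hm v x hvx
  have hvD := dg_resD_v P
  have hj : 0 < (nbC G v C).card := Finset.card_pos.2 ⟨x, mem_nbC.2 ⟨hvx, hx⟩⟩
  obtain ⟨q3, q4, q8, qa3, qa2⟩ := psi_drop_ge (a := dg (res G Cᶜ) v) (b := dg G v) (by omega) hvd
  have S1 : ∀ t, G.Adj v t → t ∈ C → gg (dg G t) ≤ ∑ x ∈ nbC G v C, gg (dg G x) := by
    intro t h1 h2
    have := sumC_ge (K := G) (v := v) (C := C) {t} (by simp [h1, h2])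
    simpa using this
  have S2 : ∀ t u, t ≠ u → G.Adj v t → t ∈ C → G.Adj v u → u ∈ C →
      gg (dg G t) + gg (dg G u) ≤ ∑ x ∈ nbC G v C, gg (dg G x) := by
    intro t u h0 h1 h2 h3 h4
    have := sumC_ge (K := G) (v := v) (C := C) {t, u} (by
      intro y hy; simp at hy; rcases hy with rfl | rfl <;> simp [*])
    rwa [Finset.sum_pair h0] at this
  have hPx := S1 x hvx hx
  obtain ⟨gx3, gx4, -, -⟩ := gg_cases hxd
  have hle1 : ∀ y, dg (res G C) y ≤ dg G y := dg_mono fun a b h => h.1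
  have hle2 : ∀ y, dg (res G Cᶜ) y ≤ dg G y := dg_mono fun a b h => h.1
  refine ⟨by omega, ?_, ?_, ?_⟩
  · rintro ⟨u, hu⟩
    by_cases huC : u ∈ C
    · by_cases hvu : G.Adj v u
      · have e1 := dg_resC_adj P huC hvu
        have e2 := S1 u hvu huC
        obtain ⟨-, -, g3, g4⟩ := gg_cases (d := dg G u) (by omega)
        rcases hu with hu | hu
        · have := g3 hu; omega
        · have := cl1.two u (by omega); omega
      · have := cl1.two u (by rw [dg_resC_nadj P huC hvu]; exact hu)
        omega
    · by_cases huv : u = v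
      · subst huv
        by_cases h2 : dg (res G Cᶜ) u ≤ 2
        · have := qa2 h2; omega
        · have := cl2.two u (by omega); omega
      · have := cl2.two u (by rw [dg_resD P huC huv]; exact hu)
        omega
  · intro h4 h
    have hx4 := gx4 (h4 x)
    have hv4 := q4 (h4 v)
    rcases h with ⟨u, hu⟩ | h3
    · by_cases huC : u ∈ C
      · by_cases hvu : G.Adj v u
        · have e2 := S1 u hvu huC
          rw [hu, gg3] at e2
          omega
        · have := cl1.three (fun y => (hle1 y).trans (h4 y)) u (by rw [dg_resC_nadj P huC hvu]; exact hu)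
          omega
      · by_cases huv : u = v
        · subst huv
          have := q8 hu; omega
        · have := cl2.three (fun y => (hle2 y).trans (h4 y)) u (by rw [dg_resD P huC huv]; exact hu)
          omega
    · have e1 := cl1.cubic (fun y => (hle1 y).trans (h3 y))
      have e2 := cl2.cubic (fun y => (hle2 y).trans (h3 y))
      omega
  · -- triangles
    have caseV : ∀ b c, G.Adj v b → G.Adj b c → G.Adj v c → dg G v = 3 → dg G b = 3 → dg G c = 3 → 1 ≤ F G := by
      intro b c hvb hbc hvc dv db dc
      have hv8 := q8 dv
      by_cases hbC : b ∈ C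
      · have hcC : c ∈ C := by
          by_contra h
          exact hvc.ne (P.out b c hbC h hbc).symm
        have := S2 b c hbc.ne hvb hbC hvc hcC
        rw [db, dc, gg3] at this
        omega
      · have hcC : c ∉ C := by
          intro h
          exact hvb.ne (P.out c b h hbC hbc.symm).symm
        have a1 : (res G Cᶜ).Adj v b := ⟨hvb, P.hv, hbC⟩
        have a2 : (res G Cᶜ).Adj v c := ⟨hvc, P.hv, hcC⟩
        have a3 : (res G Cᶜ).Adj b c := ⟨hbc, hbC, hcC⟩
        have d2 : dg (res G Cᶜ) v = 2 := by
          have : 2 ≤ dg (res G Cᶜ) v := by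
            rw [← Finset.card_pair hbc.ne]
            apply Finset.card_le_card
            intro y hy
            simp at hy
            rcases hy with rfl | rfl <;> rw [mem_nb] <;> assumption
          omega
        obtain ⟨e1, e2⟩ := D2 P.c2 d2 a1 a2 a3
        rw [dg_resD P hbC hvb.ne', dg_resD P hcC hvc.ne', db, dc, gg3] at e2
        have := (ih _ ((mu_del (by omega)).trans (mu_resD P)) e1).one
        omega
    have caseC : ∀ a b c, G.Adj a b → G.Adj b c → G.Adj a c → dg G a = 3 → dg G b = 3 → dg G c = 3 →
        a ∈ C → b ∈ C → c ∈ C → G.Adj v a → 1 ≤ F G := by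
      intro a b c hab hbc hac da db dc ha hb hc hva
      by_cases hvb : G.Adj v b
      · have := S2 a b hab.ne hva ha hvb hb
        rw [da, db, gg3] at this
        omega
      by_cases hvc : G.Adj v c
      · have := S2 a c hac.ne hva ha hvc hc
        rw [da, dc, gg3] at this
        omega
      have d2 := dg_resC_adj P ha hva
      obtain ⟨e1, e2⟩ := D2 P.c1 (x := a) (p := b) (q := c) (by omega) ⟨hab, ha, hb⟩ ⟨hac, ha, hc⟩ ⟨hbc, hb, hc⟩
      rw [dg_resC_nadj P hb hvb, dg_resC_nadj P hc hvc, db, dc, gg3] at e2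
      have := (ih _ ((mu_del (by omega)).trans (mu_resC P)) e1).one
      omega
    rintro a b c hab hbc hac da db dc ⟨w, hw⟩
    by_cases hav : a = v
    · subst hav; exact caseV b c hab hbc hac da db dc
    by_cases hbv : b = v
    · subst hbv; exact caseV a c hab.symm hac hbc db da dc
    by_cases hcv : c = v
    · subst hcv; exact caseV a b hac.symm hab hbc.symm dc da db
    by_cases ha : a ∈ C
    · have hb : b ∈ C := by
        by_contra h
        exact hbv (P.out a b ha h hab)
      have hc : c ∈ C := by
        by_contra h
        exact hcv (P.out a c ha h hac)
      by_cases hva : G.Adj v a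
      · exact caseC a b c hab hbc hac da db dc ha hb hc hva
      by_cases hvb : G.Adj v b
      · exact caseC b a c hab.symm hac hbc db da dc hb ha hc hvb
      by_cases hvc : G.Adj v c
      · exact caseC c a b hac.symm hab hbc.symm dc da db hc ha hb hvc
      have e1 : (res G C).Adj a b := ⟨hab, ha, hb⟩
      have e2 : (res G C).Adj b c := ⟨hbc, hb, hc⟩
      have e3 : (res G C).Adj a c := ⟨hac, ha, hc⟩
      have d1 : dg (res G C) a = 3 := by rw [dg_resC_nadj P ha hva, da]
      have d2 : dg (res G C) b = 3 := by rw [dg_resC_nadj P hb hvb, db]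
      have d3 : dg (res G C) c = 3 := by rw [dg_resC_nadj P hc hvc, dc]
      by_cases h4 : ∃ y, 4 ≤ dg (res G C) y
      · obtain ⟨y, hy⟩ := h4
        have := cl1.tri1 e1 e2 e3 d1 d2 d3 y hy
        omega
      · push Not at h4
        have := cl1.tri0 e1 e2 e3 d1 d2 d3
        have h5 := h4 x
        have h6 := dg_resC_adj P hx hvx
        have := gx4 (by omega)
        omega
    · have hb : b ∉ C := by
        intro h
        exact hav (P.out b a h ha hab.symm)
      have hc : c ∉ C := by
        intro h
        exact hav (P.out c a h ha hac.symm)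
      have e1 : (res G Cᶜ).Adj a b := ⟨hab, ha, hb⟩
      have e2 : (res G Cᶜ).Adj b c := ⟨hbc, hb, hc⟩
      have e3 : (res G Cᶜ).Adj a c := ⟨hac, ha, hc⟩
      have d1 : dg (res G Cᶜ) a = 3 := by rw [dg_resD P ha hav, da]
      have d2 : dg (res G Cᶜ) b = 3 := by rw [dg_resD P hb hbv, db]
      have d3 : dg (res G Cᶜ) c = 3 := by rw [dg_resD P hc hcv, dc]
      by_cases h4 : ∃ y, 4 ≤ dg (res G Cᶜ) y
      · obtain ⟨y, hy⟩ := h4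
        have := cl2.tri1 e1 e2 e3 d1 d2 d3 y hy
        omega
      · push Not at h4
        have := cl2.tri0 e1 e2 e3 d1 d2 d3
        have h5 := h4 v
        have := qa3 (by omega)
        omega

/-- Two-connectedness, in the sense that no vertex deletion disconnects. -/
def TC (G : SimpleGraph V) : Prop := Conn G ∧ ∀ v, Conn (del G v)

end
end K4T

namespace K4T

open Classical

set_option linter.unusedSectionVars false
set_option linter.unusedVariables false

section
variable {V : Type*} [Fintype V]

theorem dg_del_le (G : SimpleGraph V) (v y : V) : dg (del G v) y ≤ dg G y :=
  dg_mono (G := del G v) (H := G) (fun a b h => h.1) y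

theorem gsum_gec {G : SimpleGraph V} {v : V} (c : ℤ) (hc : ∀ x, G.Adj v x → c ≤ gg (dg G x))
    (T : Finset V) (hT : ∀ t ∈ T, G.Adj v t) :
    ∑ t ∈ T, gg (dg G t) + c * ((dg G v : ℤ) - T.card) ≤ ∑ x ∈ nb G v, gg (dg G x) := by
  have hsub : T ⊆ nb G v := fun t ht => mem_nb.2 (hT t ht)
  rw [← Finset.sum_sdiff hsub]
  have h1 : (∑ x ∈ nb G v \ T, (c : ℤ)) ≤ ∑ x ∈ nb G v \ T, gg (dg G x) := by
    apply Finset.sum_le_sum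
    intro x hx
    exact hc x (mem_nb.1 (Finset.mem_sdiff.1 hx).1)
  rw [Finset.sum_const, Finset.card_sdiff_of_subset hsub] at h1
  have h2 := Finset.card_le_card hsub
  simp only [nsmul_eq_mul] at h1
  push_cast [h2] at h1
  unfold dg at *
  linarith

/-- Bonus of a neighbour of degree `d`. -/
def bo (d : ℕ) : ℤ := gg d - 3

theorem bo_nonneg {d : ℕ} (h : 3 ≤ d) : 0 ≤ bo d := by have := gg_ge3 h; unfold bo; omega
theorem bo3 : bo 3 = 5 := by decide
theorem bo4 : bo 4 = 1 := by decide
theorem bo5 : bo 5 = 0 := by decide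
theorem bo_le4 {d : ℕ} (h : 3 ≤ d) (h4 : d ≤ 4) : 1 ≤ bo d := by
  have := (gg_cases h).2.1 h4; unfold bo; omega

/-- Cost of deleting a vertex of degree `d` before bonuses. -/
def base (d : ℕ) : ℤ := psi d + 3 * d - 32

theorem base3 : base 3 = -15 := by decide
theorem base4 : base 4 = -8 := by decide
theorem base5 : base 5 = -2 := by decide
theorem base6 {d : ℕ} (h : 6 ≤ d) : 4 ≤ base d := by
  unfold base psi; split_ifs <;> omega

theorem FdT {G : SimpleGraph V} {v : V} (hm : Min3 G) (T : Finset V) (hT : ∀ t ∈ T, G.Adj v t) :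
    F (del G v) + base (dg G v) + ∑ t ∈ T, bo (dg G t) ≤ F G := by
  have h1 := F_del G v
  have h2 := gsum_gec 3 (fun x hx => gg_ge3 (hm x v hx.symm)) T hT
  have h3 : ∑ t ∈ T, bo (dg G t) = ∑ t ∈ T, gg (dg G t) - 3 * T.card := by
    unfold bo; rw [Finset.sum_sub_distrib]; simp; ring
  unfold base
  linarith

theorem Fd0 {G : SimpleGraph V} {v : V} (hm : Min3 G) : F (del G v) + base (dg G v) ≤ F G := by
  simpa using FdT (v := v) hm ∅ (by simp)

theorem Fd1 {G : SimpleGraph V} {v a : V} (hm : Min3 G) (ha : G.Adj v a) :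
    F (del G v) + base (dg G v) + bo (dg G a) ≤ F G := by
  simpa using FdT (v := v) hm {a} (by simpa using ha)

theorem Fd2 {G : SimpleGraph V} {v a b : V} (hm : Min3 G) (ha : G.Adj v a) (hb : G.Adj v b)
    (hab : a ≠ b) : F (del G v) + base (dg G v) + bo (dg G a) + bo (dg G b) ≤ F G := by
  have := FdT (v := v) hm {a, b} (by simp [ha, hb])
  rw [Finset.sum_pair hab] at this
  linarith

theorem Fd3 {G : SimpleGraph V} {v a b c : V} (hm : Min3 G) (ha : G.Adj v a) (hb : G.Adj v b)
    (hc : G.Adj v c) (hab : a ≠ b) (hac : a ≠ c) (hbc : b ≠ c) :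
    F (del G v) + base (dg G v) + bo (dg G a) + bo (dg G b) + bo (dg G c) ≤ F G := by
  have := FdT (v := v) hm {a, b, c} (by simp [ha, hb, hc])
  rw [Finset.sum_insert (by simp [hab, hac]), Finset.sum_pair hbc] at this
  linarith

theorem Fd4 {G : SimpleGraph V} {v a b c d : V} (hm : Min3 G) (ha : G.Adj v a) (hb : G.Adj v b)
    (hc : G.Adj v c) (hd : G.Adj v d) (hab : a ≠ b) (hac : a ≠ c) (had : a ≠ d) (hbc : b ≠ c)
    (hbd : b ≠ d) (hcd : c ≠ d) :
    F (del G v) + base (dg G v) + bo (dg G a) + bo (dg G b) + bo (dg G c) + bo (dg G d) ≤ F G := by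
  have := FdT (v := v) hm {a, b, c, d} (by simp [ha, hb, hc, hd])
  rw [Finset.sum_insert (by simp [hab, hac, had]), Finset.sum_insert (by simp [hbc, hbd]),
    Finset.sum_pair hcd] at this
  linarith

theorem step4 {G : SimpleGraph V} (hT : TC G) (ih : IH G) (hm : Min3 G) {v : V} (hv : 6 ≤ dg G v) :
    Cl G := by
  have hcl := ih _ (mu_del (v := v) (by omega)) (hT.2 v)
  have h1 := Fd0 (v := v) hm
  have h2 := base6 hv
  have h3 := hcl.one
  refine ⟨by omega, fun _ => by omega, fun h => absurd (h v) (by omega), ?_⟩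
  rintro a b c hab hbc hac ha hb hc -
  have hit : ∀ t, dg G t = 3 → G.Adj v t → 1 ≤ F G := by
    intro t ht hvt
    have := Fd1 hm hvt
    rw [ht, bo3] at this
    omega
  by_cases hxa : G.Adj v a
  · exact hit a ha hxa
  by_cases hxb : G.Adj v b
  · exact hit b hb hxb
  by_cases hxc : G.Adj v c
  · exact hit c hc hxc
  have hax : a ≠ v := by rintro rfl; omega
  have hbx : b ≠ v := by rintro rfl; omega
  have hcx : c ≠ v := by rintro rfl; omega
  have := hcl.tri0 (a := a) (b := b) (c := c) ⟨hab, hax, hbx⟩ ⟨hbc, hbx, hcx⟩ ⟨hac, hax, hcx⟩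
    (by rw [dg_del_nadj hax hxa]; exact ha) (by rw [dg_del_nadj hbx hxb]; exact hb)
    (by rw [dg_del_nadj hcx hxc]; exact hc)
  omega

theorem card_le_dg {G : SimpleGraph V} {v : V} (T : Finset V) (hT : ∀ t ∈ T, G.Adj v t) :
    T.card ≤ dg G v := Finset.card_le_card fun t ht => mem_nb.2 (hT t ht)

/-- More neighbours than a given finset. -/
theorem exists_nb {G : SimpleGraph V} {v : V} (T : Finset V) (h : T.card < dg G v) :
    ∃ x, G.Adj v x ∧ x ∉ T := by
  obtain ⟨x, hx, hxT⟩ := Finset.exists_mem_notMem_of_card_lt_card h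
  exact ⟨x, mem_nb.1 hx, hxT⟩

/-- A full list of neighbours. -/
theorem nb_full {G : SimpleGraph V} {v : V} (T : Finset V) (hT : ∀ t ∈ T, G.Adj v t)
    (h : dg G v ≤ T.card) : ∀ x, G.Adj v x ↔ x ∈ T := by
  have : T = nb G v := Finset.eq_of_subset_of_card_le (fun t ht => mem_nb.2 (hT t ht)) h
  intro x; rw [this, mem_nb]

theorem third_nb {G : SimpleGraph V} {v a b : V} (h : dg G v = 3) (ha : G.Adj v a) (hb : G.Adj v b)
    (hab : a ≠ b) : ∃ c, c ≠ a ∧ c ≠ b ∧ ∀ x, G.Adj v x ↔ x = a ∨ x = b ∨ x = c := by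
  obtain ⟨c, hc, hcT⟩ := exists_nb (G := G) (v := v) {a, b} (by rw [Finset.card_pair hab]; omega)
  simp at hcT
  refine ⟨c, hcT.1, hcT.2, ?_⟩
  have hca : a ≠ c := fun h => hcT.1 h.symm
  have hcb : b ≠ c := fun h => hcT.2 h.symm
  have := nb_full (G := G) (v := v) {a, b, c} (by simp [ha, hb, hc]) (by
    rw [Finset.card_insert_of_notMem (by simp [hab, hca]), Finset.card_pair hcb]; omega)
  intro x; rw [this]; simp

theorem tri_lemma {G : SimpleGraph V} (hT : TC G) (ih : IH G) (hm : Min3 G)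
    (h5 : ∀ v, dg G v ≤ 5) {a b c w : V} (hab : G.Adj a b) (hbc : G.Adj b c) (hac : G.Adj a c)
    (ha : dg G a = 3) (hb : dg G b = 3) (hc : dg G c = 3) (hw : 4 ≤ dg G w) : 1 ≤ F G := by
  -- main case: the outside neighbour of `a` is not adjacent to `b`, `c`.
  have main : ∀ a b c o, G.Adj a b → G.Adj b c → G.Adj a c → dg G a = 3 → dg G b = 3 → dg G c = 3 →
      G.Adj a o → o ≠ b → o ≠ c → ¬ G.Adj o b → ¬ G.Adj o c → 1 ≤ F G := by
    intro a b c o hab hbc hac ha hb hc hao hob hoc nob noc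
    have hoa := hao.symm
    have c1 : Conn (del G o) := hT.2 o
    have a1 : (del G o).Adj a b := ⟨hab, hoa.ne', hob.symm⟩
    have a2 : (del G o).Adj a c := ⟨hac, hoa.ne', hoc.symm⟩
    have a3 : (del G o).Adj b c := ⟨hbc, hob.symm, hoc.symm⟩
    have d1 := dg_del_adj hoa
    have d2 := dg_del_nadj hob.symm nob
    have d3 := dg_del_nadj hoc.symm noc
    obtain ⟨c2, e2⟩ := D2 c1 (by omega) a1 a2 a3
    rw [d2, d3, hb, hc, gg3] at e2
    have hcl := ih _ ((mu_del (G := del G o) (v := a) (by omega)).trans (mu_del (dg_pos_of_adj hoa))) c2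
    have l1 := hcl.one
    have l2 := Fd1 hm hoa
    rw [ha, bo3] at l2
    have ho := h5 o
    have ho3 := hm o a hoa
    rcases (by omega : dg G o = 3 ∨ dg G o = 4 ∨ dg G o = 5) with h | h | h <;> rw [h] at l2
    · rw [base3] at l2
      obtain ⟨y, hy, hya⟩ := exists_nb (G := G) (v := o) {a} (by simp; omega)
      simp at hya
      have hyb : y ≠ b := by rintro rfl; exact nob hy
      have hyc : y ≠ c := by rintro rfl; exact noc hy
      have l3 := Fd2 hm hoa hy (Ne.symm hya)
      rw [h, ha, bo3, base3] at l3
      have hy3 := hm y o hy.symm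
      by_cases hy4 : dg G y ≤ 4
      · have := bo_le4 hy3 hy4
        omega
      · have hy5 := h5 y
        have e3 := dg_del_adj hy
        have hay : ¬ (del G o).Adj a y := by
          intro hay
          have : 4 ≤ dg G a := by
            have := card_le_dg (G := G) (v := a) {b, c, o, y} (by simp [hab, hac, hao, hay.1])
            rwa [Finset.card_insert_of_notMem (by simp [hbc.ne, hob.symm, Ne.symm hyb]),
              Finset.card_insert_of_notMem (by simp [hoc.symm, Ne.symm hyc]),
              Finset.card_pair hy.ne] at this
          omega
        have e4 := dg_del_nadj hya hay
        have := hcl.two y (by omega)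
        have := bo_nonneg hy3
        omega
    · rw [base4] at l2; omega
    · rw [base5] at l2; omega
  obtain ⟨oa, na1, na2, hna⟩ := third_nb ha hab hac hbc.ne
  obtain ⟨ob, nb1, nb2, hnb⟩ := third_nb hb hab.symm hbc hac.ne
  obtain ⟨oc, nc1, nc2, hnc⟩ := third_nb hc hac.symm hbc.symm hab.ne
  have haoa : G.Adj a oa := (hna oa).2 (by simp)
  have hbob : G.Adj b ob := (hnb ob).2 (by simp)
  have hcoc : G.Adj c oc := (hnc oc).2 (by simp)
  have nadjB : ∀ o, o ≠ a → o ≠ c → o ≠ ob → ¬ G.Adj o b := by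
    intro o h1 h2 h3 h; have := (hnb o).1 h.symm; tauto
  have nadjA : ∀ o, o ≠ b → o ≠ c → o ≠ oa → ¬ G.Adj o a := by
    intro o h1 h2 h3 h; have := (hna o).1 h.symm; tauto
  have nadjC : ∀ o, o ≠ a → o ≠ b → o ≠ oc → ¬ G.Adj o c := by
    intro o h1 h2 h3 h; have := (hnc o).1 h.symm; tauto
  have hoaa := haoa.ne'
  have hobb := hbob.ne'
  have hocc := hcoc.ne'
  by_cases e1 : oa = ob
  · by_cases e2 : oa = oc
    · -- common outside neighbour
      exfalso
      subst e1 e2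
      have key := hT.2 oa {y | y = a ∨ y = b ∨ y = c} (by
        rintro p q ⟨hpq, hp, hq⟩ (rfl | rfl | rfl)
        · have := (hna q).1 hpq
          simp only [Set.mem_ofPred_eq]; tauto
        · have := (hnb q).1 hpq
          simp only [Set.mem_ofPred_eq]; tauto
        · have := (hnc q).1 hpq
          simp only [Set.mem_ofPred_eq]; tauto) ⟨a, by simp, b, hab, hoaa.symm, na1.symm⟩
      have edged : ∀ y, y ≠ oa → 3 ≤ dg G y → y = a ∨ y = b ∨ y = c := by
        intro y hy hd
        obtain ⟨z, hz, hzo⟩ := exists_nb (G := G) (v := y) {oa} (by simp; omega)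
        simp at hzo
        exact key y z ⟨hz, hy, hzo⟩
      by_cases hwo : w = oa
      · subst hwo
        obtain ⟨y, hy, hyT⟩ := exists_nb (G := G) (v := w) {a, b, c} (by
          have := Finset.card_le_three (a := a) (b := b) (c := c)
          omega)
        simp at hyT
        have := edged y hy.ne' (hm y w hy.symm)
        tauto
      · rcases edged w hwo (by omega) with rfl | rfl | rfl <;> omega
    · exact main c a b oc hac.symm hab hbc.symm hc ha hb hcoc nc1 nc2 (nadjA oc nc2 hocc (Ne.symm e2))
        (nadjB oc nc1 hocc (by rw [← e1]; exact Ne.symm e2))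
  · by_cases e2 : oa = oc
    · exact main b a c ob hab.symm hac hbc hb ha hc hbob nb1 nb2 (nadjA ob hobb nb2 (Ne.symm e1))
        (nadjC ob nb1 hobb (by rw [← e2]; exact Ne.symm e1))
    · exact main a b c oa hab hbc hac ha hb hc haoa na1 na2 (nadjB oa hoaa na2 e1)
        (nadjC oa hoaa na1 e2)

theorem step5a {G : SimpleGraph V} (hT : TC G) (ih : IH G) (hm : Min3 G)
    (h4 : ∀ v, dg G v ≤ 4) : -4 ≤ F G ∧ (((∃ v, dg G v = 3) ∨ ∀ v, dg G v ≤ 3) → 0 ≤ F G) := by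
  by_cases hE : ∀ a b, ¬ G.Adj a b
  · have := F_noedge hE; omega
  push Not at hE
  obtain ⟨p, q, hpq⟩ := hE
  have hle : ∀ v y, dg (del G v) y ≤ 4 := fun v y => (dg_del_le _ _ y).trans (h4 y)
  by_cases hA : ∃ v t, G.Adj v t ∧ dg G v = 4 ∧ dg G t = 3
  · obtain ⟨v, t, hvt, hv, ht⟩ := hA
    suffices 0 ≤ F G by omega
    have hcl := ih _ (mu_del (v := v) (by omega)) (hT.2 v)
    have l1 := hcl.one
    have l0 := F_del G v
    by_cases hu : ∃ u, G.Adj v u ∧ dg G u = 4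
    · obtain ⟨u, hvu, hu⟩ := hu
      have h1 := gsum_gec (G := G) (v := v) 4
        (fun x hx => (gg_cases (hm x v hx.symm)).2.1 (h4 x)) {t} (by simpa using hvt)
      rw [Finset.sum_singleton, ht, gg3, hv] at h1
      have := hcl.three (hle v) u (by have := dg_del_adj hvu; omega)
      have : psi 4 = 12 := by decide
      rw [hv] at l0
      simp at h1
      omega
    · push Not at hu
      have h1 := gsum_gec (G := G) (v := v) 8 (fun x hx => by
        have h1 := hm x v hx.symm
        have h2 := h4 x
        have h3 := hu x hx
        rw [(gg_cases h1).2.2.1 (by omega)]) ∅ (by simp)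
      have : psi 4 = 12 := by decide
      rw [hv] at l0 h1
      simp at h1
      omega
  · push Not at hA
    by_cases h3 : ∃ v, dg G v = 3
    · -- cubic
      obtain ⟨v, hv⟩ := h3
      have h3 : ∀ y, dg G y ≤ 3 := by
        intro y
        by_contra hy
        obtain ⟨z, hz⟩ := dg_pos.1 (show 0 < dg G y by omega)
        obtain ⟨u, hu⟩ := dg_pos.1 (show 0 < dg G v by omega)
        have := hT.1 {x | dg G x = 3} (by
          intro a b hab ha
          have h1 := hm b a hab.symm
          have h2 := h4 b
          by_contra hb
          exact hA b a hab.symm (by simp only [Set.mem_ofPred_eq] at hb; omega) ha) ⟨v, hv, u, hu⟩ y z hz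
        simp only [Set.mem_ofPred_eq] at this
        omega
      suffices 0 ≤ F G by omega
      have hcl := ih _ (mu_del (v := v) (by omega)) (hT.2 v)
      have l0 := F_del G v
      have h1 := gsum_gec (G := G) (v := v) 8 (fun x hx => by
        have h1 := hm x v hx.symm
        have h2 := h3 x
        rw [(gg_cases h1).2.2.1 (by omega)]) ∅ (by simp)
      have := hcl.cubic (fun y => (dg_del_le _ _ y).trans (h3 y))
      have : psi 3 = 8 := by decide
      rw [hv] at l0 h1
      simp at h1
      omega
    · push Not at h3
      have hp : dg G p = 4 := by
        have := hm p q hpq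
        have := h4 p
        have := h3 p
        omega
      refine ⟨?_, ?_⟩
      · have hcl := ih _ (mu_del (v := p) (by omega)) (hT.2 p)
        have l0 := F_del G p
        have h1 := gsum_gec (G := G) (v := p) 4
          (fun x hx => (gg_cases (hm x p hx.symm)).2.1 (h4 x)) ∅ (by simp)
        have hq : dg G q = 4 := by
          have := hm q p hpq.symm
          have := h4 q
          have := h3 q
          omega
        have := hcl.three (hle p) q (by have := dg_del_adj hpq; omega)
        have : psi 4 = 12 := by decide
        rw [hp] at l0 h1
        simp at h1
        omega
      · rintro (⟨v, hv⟩ | h)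
        · exact absurd hv (h3 v)
        · have := h p; omega

/-- The remaining case of the induction. -/
def Case5c (V : Type*) [Fintype V] : Prop := ∀ G : SimpleGraph V, TC G → IH G → Min3 G →
  (∀ v, dg G v ≤ 5) → (∃ v, dg G v = 5) → (∃ v, dg G v = 3 ∨ dg G v = 4) → -4 ≤ F G

theorem Cl_step (h5c : Case5c V) {G : SimpleGraph V} (hG : Conn G) (ih : IH G) : Cl G := by
  by_cases hm : Min3 G
  swap
  · exact step012 hG ih hm
  by_cases hT : ∀ v, Conn (del G v)
  swap
  · push Not at hT
    obtain ⟨v, hv⟩ := hT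
    exact step3 hG ih hm hv
  have hT : TC G := ⟨hG, hT⟩
  by_cases h6 : ∃ v, 6 ≤ dg G v
  · obtain ⟨v, hv⟩ := h6
    exact step4 hT ih hm hv
  push Not at h6
  have h5 : ∀ v, dg G v ≤ 5 := fun v => by have := h6 v; omega
  have tri : ∀ a b c, G.Adj a b → G.Adj b c → G.Adj a c → dg G a = 3 → dg G b = 3 → dg G c = 3 →
    (∃ v, 4 ≤ dg G v) → 1 ≤ F G := by
    rintro a b c hab hbc hac ha hb hc ⟨w, hw⟩
    exact tri_lemma hT ih hm h5 hab hbc hac ha hb hc hw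
  by_cases h4 : ∀ v, dg G v ≤ 4
  · obtain ⟨e1, e2⟩ := step5a hT ih hm h4
    exact ⟨by omega, fun _ => e1, fun _ => e2, tri⟩
  have h4' := h4
  push Not at h4
  obtain ⟨v, hv⟩ := h4
  have hv5 : dg G v = 5 := by have := h5 v; omega
  by_cases hl : ∃ v, dg G v = 3 ∨ dg G v = 4
  · have := h5c G hT ih hm h5 ⟨v, hv5⟩ hl
    exact ⟨by omega, fun _ => this, fun h => absurd h h4', tri⟩
  · refine ⟨?_, fun h => absurd h hl, fun h => absurd h h4', tri⟩
    push Not at hl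
    obtain ⟨u, hu⟩ := dg_pos.1 (show 0 < dg G v by omega)
    have h1 := Fd0 (v := v) hm
    rw [hv5, base5] at h1
    have hcl := ih _ (mu_del (v := v) (by omega)) (hT.2 v)
    have := dg_del_adj hu
    have e1 := hm u v hu.symm
    have e2 := h5 u
    have e3 := hl u
    have := hcl.two u (by omega)
    omega

theorem Cl_all (h5c : Case5c V) (G : SimpleGraph V) (hG : Conn G) : Cl G := by
  induction h : mu G using Nat.strong_induction_on generalizing G with
  | _ n ihn =>
    subst h
    exact Cl_step h5c hG fun H hH hHc => ihn _ hH H hHc rfl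

theorem psi_phi (d : ℕ) : (psi d : ℝ) = 6 * phi d := by
  unfold psi phi
  split_ifs <;> push_cast <;> ring

theorem final (h5c : Case5c V) (G : SimpleGraph V) (hG : G.Connected) :
    phiSum G ≥ (16 / 3) * (transNum G : ℝ) - 1 := by
  have h := (Cl_all h5c G (Conn_of_connected hG)).one
  have h1 := transNum_le G
  have h2 : (6 : ℝ) * phiSum G = ((∑ v, psi (dg G v) : ℤ) : ℝ) := by
    unfold phiSum
    rw [Finset.mul_sum]
    push_cast
    apply Finset.sum_congr rfl
    intro v _
    rw [psi_phi, dg_eq_ncard]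
  unfold F at h
  have h3 : ((-6 : ℤ) : ℝ) ≤ ((∑ v, psi (dg G v) - 32 * (sn G : ℤ) : ℤ) : ℝ) := by exact_mod_cast h
  have h4 : (transNum G : ℝ) ≤ sn G := by exact_mod_cast h1
  rw [Int.cast_sub, ← h2] at h3
  push_cast at h3
  linarith

end
end K4T

namespace K4T

open Classical

set_option linter.unusedSectionVars false
set_option linter.unusedVariables false

section
variable {V : Type*} [Fintype V]

/-- Standing assumptions. -/
structure Good (K : SimpleGraph V) : Prop where
  tc : TC K
  m3 : Min3 K
  d5 : ∀ v, dg K v ≤ 5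
  ih : IH K

theorem IH.mono {G H : SimpleGraph V} (h : IH G) (hm : mu H ≤ mu G) : IH H :=
  fun K hK hc => h K (hK.trans_le hm) hc

theorem Good.cl {K : SimpleGraph V} (hK : Good K) {v : V} (hv : 0 < dg K v) : Cl (del K v) :=
  hK.ih _ (mu_del hv) (hK.tc.2 v)

theorem Good.ge3 {K : SimpleGraph V} (hK : Good K) {v x : V} (h : K.Adj v x) : 3 ≤ dg K x :=
  hK.m3 x v h.symm

theorem Good.ge3' {K : SimpleGraph V} (hK : Good K) {v x : V} (h : K.Adj v x) : 3 ≤ dg K v :=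
  hK.m3 v x h

/-- If some neighbour of the deleted vertex has degree 4 or 5 the remainder is at least -4. -/
theorem Good.del_ge {K : SimpleGraph V} (hK : Good K) {v x : V} (h : K.Adj v x) (hx : 4 ≤ dg K x) :
    -4 ≤ F (del K v) := by
  have h1 := hK.cl (dg_pos_of_adj h)
  have h2 := dg_del_adj h
  have h3 := hK.d5 x
  exact h1.two x (by omega)

theorem W1 {K : SimpleGraph V} (hK : Good K) {v t : V} (h : K.Adj v t) (hv : dg K v = 5)
    (ht : dg K t = 3) : -2 ≤ F K := by
  obtain ⟨u, hu, hut⟩ := exists_nb (G := K) (v := v) {t} (by simp; omega)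
  simp at hut
  have h1 := Fd2 hK.m3 h hu (Ne.symm hut)
  rw [hv, base5, ht, bo3] at h1
  have hu3 := hK.ge3 hu
  by_cases hu4 : 4 ≤ dg K u
  · have := hK.del_ge hu hu4
    have := bo_nonneg hu3
    omega
  · have := (hK.cl (dg_pos_of_adj h)).one
    rw [show dg K u = 3 by omega, bo3] at h1
    omega

theorem W2 {K : SimpleGraph V} (hK : Good K) {v a b : V} (ha : K.Adj v a) (hb : K.Adj v b)
    (hab : a ≠ b) (hv : dg K v = 4) (da : dg K a = 3) (db : dg K b = 3) : -2 ≤ F K := by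
  obtain ⟨u, hu, hut⟩ := exists_nb (G := K) (v := v) {a, b} (by rw [Finset.card_pair hab]; omega)
  simp at hut
  have h1 := Fd3 hK.m3 ha hb hu hab (fun h => hut.1 h.symm) (fun h => hut.2 h.symm)
  rw [hv, base4, da, db, bo3] at h1
  have hu3 := hK.ge3 hu
  by_cases hu4 : 4 ≤ dg K u
  · have := hK.del_ge hu hu4
    have := bo_nonneg hu3
    omega
  · have := (hK.cl (dg_pos_of_adj ha)).one
    rw [show dg K u = 3 by omega, bo3] at h1
    omega

theorem W3 {K : SimpleGraph V} (hK : Good K) {w x y z : V} (hx : K.Adj w x) (hy : K.Adj w y)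
    (hz : K.Adj w z) (hxy : K.Adj x y) (hzx : z ≠ x) (hzy : z ≠ y) (hw : dg K w = 3)
    (dz : 4 ≤ dg K z) : -2 ≤ F K := by
  have x3 := hK.ge3 hx
  have y3 := hK.ge3 hy
  have x5 := hK.d5 x
  have y5 := hK.d5 y
  have z5 := hK.d5 z
  by_cases ex : dg K x = 5
  · exact W1 hK hx.symm ex hw
  by_cases ey : dg K y = 5
  · exact W1 hK hy.symm ey hw
  by_cases ez : dg K z = 5
  · exact W1 hK hz.symm ez hw
  have d4 : dg K z = 4 := by omega
  have d1 := dg_del_adj hz.symm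
  obtain ⟨c, e⟩ := D2 (G := del K z) (x := w) (p := x) (q := y) (hK.tc.2 z) (by omega)
    ⟨hx, hz.ne, hzx.symm⟩ ⟨hy, hz.ne, hzy.symm⟩ ⟨hxy, hzx.symm, hzy.symm⟩
  have hcl := hK.ih _ ((mu_del (G := del K z) (v := w) (by omega)).trans (mu_del (dg_pos_of_adj hz.symm))) c
  have l := hcl.one
  have key : ∀ x, x ≠ z → 3 ≤ dg K x → dg K x ≤ 4 → (K.Adj z x → 4 ≤ bo (dg K x) + gg (dg (del K z) x)) ∧
      (¬ K.Adj z x → 4 ≤ gg (dg (del K z) x)) := by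
    intro x hx h3 h4
    constructor
    · intro h
      have e1 := dg_del_adj h
      rcases (by omega : dg K x = 3 ∨ dg K x = 4) with h' | h'
      · rw [h', bo3]; have := gg_nonneg (dg (del K z) x); omega
      · rw [h', bo4, show dg (del K z) x = 3 by omega, gg3]; omega
    · intro h
      rw [dg_del_nadj hx h]
      exact (gg_cases h3).2.1 h4
  obtain ⟨kx1, kx2⟩ := key x hzx.symm x3 (by omega)
  obtain ⟨ky1, ky2⟩ := key y hzy.symm y3 (by omega)
  by_cases ax : K.Adj z x
  · have kx := kx1 ax
    by_cases ay : K.Adj z y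
    · have ky := ky1 ay
      have := Fd3 hK.m3 hz.symm ax ay hx.ne hy.ne hxy.ne
      rw [d4, hw, base4, bo3] at this
      omega
    · have ky := ky2 ay
      have := Fd2 hK.m3 hz.symm ax hx.ne
      rw [d4, hw, base4, bo3] at this
      omega
  · have kx := kx2 ax
    by_cases ay : K.Adj z y
    · have ky := ky1 ay
      have := Fd2 hK.m3 hz.symm ay hy.ne
      rw [d4, hw, base4, bo3] at this
      omega
    · have ky := ky2 ay
      have := Fd1 hK.m3 hz.symm
      rw [d4, hw, base4, bo3] at this
      omega

theorem W4 {K : SimpleGraph V} (hK : Good K) {v a b c d : V} (ha : K.Adj v a) (hb : K.Adj v b)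
    (hc : K.Adj v c) (hd : K.Adj v d) (hab : a ≠ b) (hac : a ≠ c) (had : a ≠ d) (hbc : b ≠ c)
    (hbd : b ≠ d) (hcd : c ≠ d) (hv : dg K v = 5) (da : dg K a = 4) (db : dg K b = 4)
    (dc : dg K c = 4) (dd : dg K d = 4) : -2 ≤ F K := by
  have h1 := Fd4 hK.m3 ha hb hc hd hab hac had hbc hbd hcd
  rw [hv, base5, da, db, dc, dd, bo4] at h1
  have := hK.del_ge ha (by omega)
  omega

theorem W4' {K : SimpleGraph V} (hK : Good K) {v a b c : V} (ha : K.Adj v a) (hb : K.Adj v b)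
    (hc : K.Adj v c) (hab : a ≠ b) (hac : a ≠ c) (hbc : b ≠ c)
    (hv : dg K v = 5) (da : dg K a = 4) (db : dg K b = 4)
    (dc : dg K c = 4) : -3 ≤ F K := by
  have h1 := Fd3 hK.m3 ha hb hc hab hac hbc
  rw [hv, base5, da, db, dc, bo4] at h1
  have := hK.del_ge ha (by omega)
  omega

/-- A cut vertex with low vertices on both sides. -/
theorem cut_low {K : SimpleGraph V} (hc : Conn K) (hm : Min3 K) (ih : IH K) {c : V}
    (hcut : ¬ Conn (del K c))
    (hl : ∀ C, Piece K c C → (∃ u ∈ C, dg K u = 3 ∨ dg K u = 4) ∧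
      (∃ u, u ∉ C ∧ u ≠ c ∧ (dg K u = 3 ∨ dg K u = 4))) : -2 ≤ F K := by
  obtain ⟨C, P, hs⟩ := cutl hc hcut
  have hF := F_cut P hs
  have cl1 := ih _ (mu_resC P) P.c1
  have cl2 := ih _ (mu_resD P) P.c2
  obtain ⟨⟨u, huC, hu⟩, w, hwC, hwc, hw⟩ := hl C P
  have l2 := cl2.two w (by rw [dg_resD P hwC hwc]; exact hw)
  have l1 := cl1.one
  obtain ⟨x, hx, hvx⟩ := P.att
  have hxd : 3 ≤ dg K x := hm x c hvx.symm
  have hvd : 3 ≤ dg K c := hm c x hvx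
  have hvD := dg_resD_v P
  have hj : 0 < (nbC K c C).card := Finset.card_pos.2 ⟨x, mem_nbC.2 ⟨hvx, hx⟩⟩
  obtain ⟨q3, -⟩ := psi_drop_ge (a := dg (res K Cᶜ) c) (b := dg K c) (by omega) hvd
  have S1 : ∀ t, K.Adj c t → t ∈ C → gg (dg K t) ≤ ∑ x ∈ nbC K c C, gg (dg K x) := by
    intro t h1 h2
    have := sumC_ge (K := K) (v := c) (C := C) {t} (by simp [h1, h2])
    simpa using this
  have hPx := S1 x hvx hx
  have gx3 := gg_ge3 hxd
  by_cases hcu : K.Adj c u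
  · have e1 := dg_resC_adj P huC hcu
    have e2 := S1 u hcu huC
    rcases hu with hu | hu
    · rw [hu, gg3] at e2; omega
    · have := cl1.two u (by omega); omega
  · have := cl1.two u (by rw [dg_resC_nadj P huC hcu]; exact hu)
    omega

theorem Good.step {K : SimpleGraph V} (hK : Good K) {u : V} (hu0 : 0 < dg K u)
    (hu : ∀ x, K.Adj u x → 4 ≤ dg K x) (hF : F (del K u) ≤ -3) : Good (del K u) := by
  have hm : Min3 (del K u) := by
    intro a b hab
    by_cases hua : K.Adj u a
    · have := dg_del_adj hua
      have := hu a hua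
      omega
    · rw [dg_del_nadj hab.2.1 hua]; exact hK.m3 a b hab.1
  have ih : IH (del K u) := hK.ih.mono (mu_del hu0).le
  refine ⟨⟨hK.tc.2 u, ?_⟩, hm, fun v => (dg_del_le _ _ v).trans (hK.d5 v), ih⟩
  intro c
  by_contra hcut
  have := cut_low (hK.tc.2 u) hm ih hcut ?_
  · omega
  intro C P
  have low : ∀ y, K.Adj u y → dg (del K u) y = 3 ∨ dg (del K u) y = 4 := by
    intro y hy
    have := dg_del_adj hy
    have := hu y hy
    have := hK.d5 y
    omega
  obtain ⟨x, hxC, hcx⟩ := P.att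
  have hcu : c ≠ u := hcx.2.1
  have hu3 : 3 ≤ dg K u := by
    obtain ⟨y, hy⟩ := dg_pos.1 hu0
    exact hK.m3 u y hy
  obtain ⟨u', huu', hu'c⟩ := exists_nb (G := K) (v := u) {c} (by simp; omega)
  simp at hu'c
  have uedge : (del K c).Adj u u' := ⟨huu', hcu.symm, hu'c⟩
  constructor
  · by_contra hcon
    push Not at hcon
    have hno : ∀ y ∈ C, ¬ K.Adj u y := by
      intro y hy h
      have := hcon y hy
      have := low y h
      tauto
    obtain ⟨x', hxx', hx'c⟩ := exists_nb (G := K) (v := x) {c} (by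
      have := hK.m3 x c hcx.1.symm; simp; omega)
    simp at hx'c
    have := hK.tc.2 c (C \ {u}) (by
      rintro a b ⟨hab, hac, hbc⟩ ⟨haC, hau⟩
      have hbu : b ≠ u := by
        rintro rfl
        exact hno a haC hab.symm
      refine ⟨?_, hbu⟩
      by_contra hbC
      exact hbc (P.out a b haC hbC ⟨hab, hau, hbu⟩)) ⟨x, ⟨hxC, hcx.2.2⟩, x', hxx', hcx.ne', hx'c⟩ u u' uedge
    exact this.2 rfl
  · by_contra hcon
    push Not at hcon
    have hno : ∀ y, y ∉ C → y ≠ c → ¬ K.Adj u y := by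
      intro y hy hyc h
      have := hcon y hy hyc
      have := low y h
      tauto
    obtain ⟨x, x', hxC, ⟨hxx', hxu, hx'u⟩, hxc, hx'c⟩ := P.oth
    have := hK.tc.2 c {y | y ∉ C ∧ y ≠ c ∧ y ≠ u} (by
      rintro a b ⟨hab, hac, hbc⟩ ⟨haC, -, hau⟩
      have hbu : b ≠ u := by
        rintro rfl
        exact hno a haC hac hab.symm
      refine ⟨?_, hbc, hbu⟩
      intro hbC
      exact hac (P.out b a hbC haC ⟨hab.symm, hbu, hau⟩)) ⟨x, ⟨hxC, hxc, hxu⟩, x', hxx', hxc, hx'c⟩ u u' uedge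
    exact this.2.2 rfl

end
end K4T

namespace K4T

open Classical

set_option linter.unusedSectionVars false
set_option linter.unusedVariables false

section
variable {V : Type*} [Fintype V]

/-- A potential counterexample in the last case. -/
structure Bad (G : SimpleGraph V) : Prop where
  good : Good G
  hF : F G ≤ -5
  no3 : ∀ v t, dg G v = 5 → G.Adj v t → dg G t = 4 ∨ dg G t = 5
  one4 : ∀ v a b, dg G v = 5 → G.Adj v a → G.Adj v b → dg G a = 4 → dg G b = 4 → a = b

theorem Bad.mk' {G : SimpleGraph V} (hG : Good G) (hF : F G ≤ -5) : Bad G := by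
  have hn : ∀ v t, dg G v = 5 → G.Adj v t → dg G t = 4 ∨ dg G t = 5 := by
    intro v t hv hvt
    have h3 := hG.ge3 hvt
    have h5 := hG.d5 t
    by_contra hcon
    have := W1 hG hvt hv (by omega)
    omega
  refine ⟨hG, hF, hn, ?_⟩
  intro v a b hv ha hb da db
  by_contra hab
  have := Fd2 hG.m3 ha hb hab
  rw [hv, da, db, base5, bo4] at this
  have := hG.del_ge ha (by omega)
  omega

/-- Deleting two vertices. -/
abbrev d2 (G : SimpleGraph V) (r s : V) : SimpleGraph V := del (del G r) s

theorem kd0 {G : SimpleGraph V} {r s t : V} (h1 : t ≠ r) (h2 : t ≠ s) (n1 : ¬ G.Adj r t)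
    (n2 : ¬ G.Adj s t) : dg (d2 G r s) t = dg G t := by
  rw [d2, dg_del_nadj (G := del G r) h2 (fun h => n2 h.1), dg_del_nadj h1 n1]

theorem kd1 {G : SimpleGraph V} {r s t : V} (h2 : t ≠ s) (n1 : G.Adj r t)
    (n2 : ¬ G.Adj s t) : dg (d2 G r s) t + 1 = dg G t := by
  rw [d2, dg_del_nadj (G := del G r) h2 (fun h => n2 h.1), dg_del_adj n1]

theorem kd2 {G : SimpleGraph V} {r s t : V} (hrs : r ≠ s) (h1 : t ≠ r) (n1 : ¬ G.Adj r t)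
    (n2 : G.Adj s t) : dg (d2 G r s) t + 1 = dg G t := by
  rw [d2, dg_del_adj (G := del G r) ⟨n2, hrs.symm, h1⟩, dg_del_nadj h1 n1]

theorem kd12 {G : SimpleGraph V} {r s t : V} (hrs : r ≠ s) (n1 : G.Adj r t)
    (n2 : G.Adj s t) : dg (d2 G r s) t + 2 = dg G t := by
  have h1 := dg_del_adj n1
  have h2 := dg_del_adj (G := del G r) (v := s) (x := t) ⟨n2, hrs.symm, n1.ne'⟩
  unfold d2
  omega

theorem Bad.del_good {G : SimpleGraph V} (hG : Bad G) {r : V} (hr : dg G r = 5) (T : Finset V)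
    (hT : ∀ t ∈ T, G.Adj r t ∧ dg G t = 4) : F (del G r) ≤ -3 - T.card ∧ Good (del G r) := by
  have h1 := FdT hG.good.m3 T (fun t ht => (hT t ht).1)
  have h2 : ∑ t ∈ T, bo (dg G t) = T.card := by
    rw [Finset.sum_congr rfl (fun t ht => by rw [(hT t ht).2, bo4])]; simp
  rw [hr, base5, h2] at h1
  have h3 := hG.hF
  refine ⟨by omega, hG.good.step (by omega) ?_ (by omega)⟩
  intro x hx
  have := hG.no3 r x hr hx
  omega

theorem Bad.F2 {G : SimpleGraph V} (hG : Bad G) {r s z : V} (hr : dg G r = 5) (hs : dg G s = 5)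
    (hrs : r ≠ s) (hn : ¬ G.Adj r s) (hz : dg G z = 4) (hrz : G.Adj r z) (hsz : G.Adj s z) : False := by
  obtain ⟨h1, h2⟩ := hG.del_good hr {z} (by simp [hz, hrz])
  have hs' : dg (del G r) s = 5 := by rw [dg_del_nadj hrs.symm hn, hs]
  have hz' := dg_del_adj hrz
  have h3 := W1 h2 (v := s) (t := z) ⟨hsz, hrs.symm, hrz.ne'⟩ hs' (by omega)
  simp at h1
  omega

theorem Bad.pair {G : SimpleGraph V} (hG : Bad G) {r s : V} (hr : dg G r = 5) (hs : dg G s = 5)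
    (hrs : r ≠ s) (hn : ¬ G.Adj r s) (T1 T2 : Finset V) (hT1 : ∀ t ∈ T1, G.Adj r t ∧ dg G t = 4)
    (hT2 : ∀ t ∈ T2, G.Adj s t ∧ (dg G t = 4 ∨ (dg G t = 5 ∧ G.Adj r t))) :
    F (d2 G r s) ≤ -1 - T1.card - T2.card ∧ T1.card + T2.card < 4 ∧
    (2 ≤ T1.card + T2.card → Good (d2 G r s)) := by
  obtain ⟨h1, h2⟩ := hG.del_good hr T1 hT1
  have hs' : dg (del G r) s = 5 := by rw [dg_del_nadj hrs.symm hn, hs]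
  have no4 : ∀ t, dg G t = 4 → G.Adj s t → ¬ G.Adj r t := fun t h4 h5 h6 =>
    hG.F2 hr hs hrs hn h4 h6 h5
  have hge : ∀ x, (del G r).Adj s x → 4 ≤ dg (del G r) x := by
    intro x hx
    have h3 := hG.no3 s x hs hx.1
    by_cases hrx : G.Adj r x
    · have := dg_del_adj hrx
      have := no4 x
      rcases h3 with h3 | h3
      · exact absurd hrx (this h3 hx.1)
      · omega
    · rw [dg_del_nadj hx.2.2 hrx]; omega
  have hadj : ∀ t ∈ T2, (del G r).Adj s t := by
    intro t ht
    refine ⟨(hT2 t ht).1, hrs.symm, ?_⟩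
    rintro rfl
    exact hn (hT2 t ht).1.symm
  have h3 := FdT h2.m3 T2 hadj
  have h4 : ∑ t ∈ T2, bo (dg (del G r) t) = T2.card := by
    rw [Finset.sum_congr rfl (g := fun _ => (1 : ℤ)), Finset.sum_const]; · simp
    intro t ht
    obtain ⟨e1, e2⟩ := hT2 t ht
    rcases e2 with e2 | ⟨e2, e3⟩
    · rw [dg_del_nadj (hadj t ht).2.2 (no4 t e2 e1), e2, bo4]
    · have := dg_del_adj e3
      rw [show dg (del G r) t = 4 by omega, bo4]
  rw [hs', base5, h4] at h3
  obtain ⟨y, hy⟩ := dg_pos.1 (show 0 < dg (del G r) s by omega)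
  have h5 := h2.del_ge hy (hge y hy)
  refine ⟨by unfold d2; omega, by omega, fun h => h2.step (by omega) hge (by omega)⟩

/-- A good pair: the graph left after deleting it still satisfies everything. -/
structure PG (G : SimpleGraph V) (r s : V) : Prop where
  dr : dg G r = 5
  ds : dg G s = 5
  ne : r ≠ s
  nadj : ¬ G.Adj r s
  good : Good (d2 G r s)
  hF : F (d2 G r s) ≤ -3

theorem Bad.pg {G : SimpleGraph V} (hG : Bad G) {r s : V} (hr : dg G r = 5) (hs : dg G s = 5)
    (hrs : r ≠ s) (hn : ¬ G.Adj r s) (T1 T2 : Finset V) (hT1 : ∀ t ∈ T1, G.Adj r t ∧ dg G t = 4)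
    (hT2 : ∀ t ∈ T2, G.Adj s t ∧ (dg G t = 4 ∨ (dg G t = 5 ∧ G.Adj r t)))
    (hc : 2 ≤ T1.card + T2.card) : PG G r s := by
  obtain ⟨h1, h2, h3⟩ := hG.pair hr hs hrs hn T1 T2 hT1 hT2
  exact ⟨hr, hs, hrs, hn, h3 hc, by omega⟩

/-- The pair with a 4-neighbour of the first and a common 5-neighbour. -/
theorem Bad.pg11 {G : SimpleGraph V} (hG : Bad G) {r s z w : V} (hr : dg G r = 5) (hs : dg G s = 5)
    (hrs : r ≠ s) (hn : ¬ G.Adj r s) (hz : dg G z = 4) (hrz : G.Adj r z) (hw : dg G w = 5)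
    (hrw : G.Adj r w) (hsw : G.Adj s w) : PG G r s :=
  hG.pg hr hs hrs hn {z} {w} (by simp [hrz, hz]) (by simp [*]) (by simp)

/-- The pair with a 4-neighbour of the first and three bonuses at the second is impossible. -/
theorem Bad.p13 {G : SimpleGraph V} (hG : Bad G) {r s z a b c : V} (hr : dg G r = 5)
    (hs : dg G s = 5) (hrs : r ≠ s) (hn : ¬ G.Adj r s) (hz : dg G z = 4) (hrz : G.Adj r z)
    (hab : a ≠ b) (hac : a ≠ c) (hbc : b ≠ c)
    (ha : G.Adj s a ∧ (dg G a = 4 ∨ (dg G a = 5 ∧ G.Adj r a)))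
    (hb : G.Adj s b ∧ (dg G b = 4 ∨ (dg G b = 5 ∧ G.Adj r b)))
    (hc : G.Adj s c ∧ (dg G c = 4 ∨ (dg G c = 5 ∧ G.Adj r c))) : False := by
  have := hG.pair hr hs hrs hn {z} {a, b, c} (by simp [hrz, hz]) (by
    intro t ht
    simp at ht
    rcases ht with rfl | rfl | rfl <;> assumption)
  rw [Finset.card_insert_of_notMem (by simp [hab, hac]), Finset.card_pair hbc] at this
  simp at this

theorem PG.w1 {G : SimpleGraph V} {r s w u : V} (P : PG G r s) (hw : dg G w = 5) (hrw : G.Adj r w)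
    (hsw : G.Adj s w) (hu : dg G u = 5) (hwu : G.Adj w u) (hur : u ≠ r) (hus : u ≠ s) :
    G.Adj r u ∨ G.Adj s u := by
  by_contra hcon
  push Not at hcon
  have e1 := kd12 P.ne hrw hsw
  have e2 := kd0 hur hus hcon.1 hcon.2
  have := W1 P.good (v := u) (t := w) ⟨⟨hwu.symm, hur, hrw.ne'⟩, hus, hsw.ne'⟩ (by omega) (by omega)
  have := P.hF
  omega

/-- `W2` in the remainder. -/
theorem PG.w2 {G : SimpleGraph V} {r s v a b : V} (P : PG G r s) (hva : G.Adj v a) (hvb : G.Adj v b)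
    (hab : a ≠ b) (h1 : v ≠ r) (h2 : v ≠ s) (h3 : a ≠ r) (h4 : a ≠ s) (h5 : b ≠ r) (h6 : b ≠ s)
    (dv : dg (d2 G r s) v = 4) (da : dg (d2 G r s) a = 3) (db : dg (d2 G r s) b = 3) : False := by
  have := W2 P.good (v := v) (a := a) (b := b) ⟨⟨hva, h1, h3⟩, h2, h4⟩ ⟨⟨hvb, h1, h5⟩, h2, h6⟩ hab dv da db
  have := P.hF
  omega

/-- `W3` in the remainder. -/
theorem PG.w3 {G : SimpleGraph V} {r s w x y z : V} (P : PG G r s) (dw : dg G w = 5)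
    (hrw : G.Adj r w) (hsw : G.Adj s w) (hx : G.Adj w x) (hy : G.Adj w y) (hz : G.Adj w z)
    (hxy : G.Adj x y) (hzx : z ≠ x) (hzy : z ≠ y)
    (xr : x ≠ r) (xs : x ≠ s) (yr : y ≠ r) (ys : y ≠ s) (zr : z ≠ r) (zs : z ≠ s)
    (dz : 4 ≤ dg (d2 G r s) z) : False := by
  have e1 := kd12 P.ne hrw hsw
  have h1 := hrw.ne'
  have h2 := hsw.ne'
  have := W3 P.good (w := w) (x := x) (y := y) (z := z) ⟨⟨hx, h1, xr⟩, h2, xs⟩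
    ⟨⟨hy, h1, yr⟩, h2, ys⟩ ⟨⟨hz, h1, zr⟩, h2, zs⟩ ⟨⟨hxy, xr, yr⟩, xs, ys⟩ hzx hzy (by omega) dz
  have := P.hF
  omega

/-- `W4` in the remainder. -/
theorem PG.w4 {G : SimpleGraph V} {r s v a b c d : V} (P : PG G r s) (ha : G.Adj v a) (hb : G.Adj v b)
    (hc : G.Adj v c) (hd : G.Adj v d) (hab : a ≠ b) (hac : a ≠ c) (had : a ≠ d) (hbc : b ≠ c)
    (hbd : b ≠ d) (hcd : c ≠ d) (vr : v ≠ r) (vs : v ≠ s) (ar : a ≠ r) (as' : a ≠ s) (br : b ≠ r)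
    (bs : b ≠ s) (cr : c ≠ r) (cs : c ≠ s) (dr : d ≠ r) (ds : d ≠ s)
    (hv : dg (d2 G r s) v = 5) (da : dg (d2 G r s) a = 4) (db : dg (d2 G r s) b = 4)
    (dc : dg (d2 G r s) c = 4) (dd : dg (d2 G r s) d = 4) : False := by
  have := W4 P.good (v := v) (a := a) (b := b) (c := c) (d := d) ⟨⟨ha, vr, ar⟩, vs, as'⟩
    ⟨⟨hb, vr, br⟩, vs, bs⟩ ⟨⟨hc, vr, cr⟩, vs, cs⟩ ⟨⟨hd, vr, dr⟩, vs, ds⟩ hab hac had hbc hbd hcd hv da db dc dd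
  have := P.hF
  omega

/-- Vertices of degree 5 with exactly one neighbour of degree 4, with neighbourhood listed. -/
theorem nb5_of {G : SimpleGraph V} {v a : V} (h : dg G v = 5) (ha : G.Adj v a) :
    ∃ b c d e, (∀ x, G.Adj v x ↔ x = a ∨ x = b ∨ x = c ∨ x = d ∨ x = e) ∧ a ≠ b ∧ a ≠ c ∧ a ≠ d ∧
      a ≠ e ∧ b ≠ c ∧ b ≠ d ∧ b ≠ e ∧ c ≠ d ∧ c ≠ e ∧ d ≠ e := by
  have h1 : ((nb G v).erase a).card = 4 := by
    rw [Finset.card_erase_of_mem (mem_nb.2 ha)]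
    unfold dg at h; omega
  obtain ⟨b, T, hbT, hT, hc⟩ := Finset.card_eq_succ.1 h1
  obtain ⟨c, d, e, h2, h3, h4, h5⟩ := Finset.card_eq_three.1 hc
  subst h5
  refine ⟨b, c, d, e, ?_, ?_⟩
  · intro x
    rw [← mem_nb]
    have : x ∈ nb G v ↔ x = a ∨ x ∈ (nb G v).erase a := by
      by_cases hx : x = a
      · subst hx; simp [mem_nb, ha]
      · simp [hx]
    rw [this, ← hT]; simp
  · simp at hbT
    have key : ∀ y ∈ (nb G v).erase a, a ≠ y := by
      intro y hy; exact (Finset.ne_of_mem_erase hy).symm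
    rw [← hT] at key
    simp at key
    tauto

theorem nb5_of2 {G : SimpleGraph V} {v a b : V} (h : dg G v = 5) (ha : G.Adj v a) (hb : G.Adj v b)
    (hab : a ≠ b) :
    ∃ c d e, (∀ x, G.Adj v x ↔ x = a ∨ x = b ∨ x = c ∨ x = d ∨ x = e) ∧ a ≠ c ∧ a ≠ d ∧
      a ≠ e ∧ b ≠ c ∧ b ≠ d ∧ b ≠ e ∧ c ≠ d ∧ c ≠ e ∧ d ≠ e := by
  obtain ⟨p, q, r, s, hn, h1⟩ := nb5_of h ha
  rcases (hn b).1 hb with h | h | h | h | h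
  · exact absurd h.symm hab
  · exact ⟨q, r, s, by intro x; rw [hn]; subst h; tauto, by subst h; tauto⟩
  · exact ⟨p, r, s, by intro x; rw [hn]; subst h; tauto, by subst h; tauto⟩
  · exact ⟨p, q, s, by intro x; rw [hn]; subst h; tauto, by subst h; tauto⟩
  · exact ⟨p, q, r, by intro x; rw [hn]; subst h; tauto, by subst h; tauto⟩

theorem nb5_of3 {G : SimpleGraph V} {v a b c : V} (h : dg G v = 5) (ha : G.Adj v a) (hb : G.Adj v b)
    (hc : G.Adj v c) (hab : a ≠ b) (hac : a ≠ c) (hbc : b ≠ c) :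
    ∃ d e, (∀ x, G.Adj v x ↔ x = a ∨ x = b ∨ x = c ∨ x = d ∨ x = e) ∧ a ≠ d ∧
      a ≠ e ∧ b ≠ d ∧ b ≠ e ∧ c ≠ d ∧ c ≠ e ∧ d ≠ e := by
  obtain ⟨q, r, s, hn, h1⟩ := nb5_of2 h ha hb hab
  rcases (hn c).1 hc with h | h | h | h | h
  · exact absurd h.symm hac
  · exact absurd h.symm hbc
  · exact ⟨r, s, by intro x; rw [hn]; subst h; tauto, by subst h; tauto⟩
  · exact ⟨q, s, by intro x; rw [hn]; subst h; tauto, by subst h; tauto⟩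
  · exact ⟨q, r, by intro x; rw [hn]; subst h; tauto, by subst h; tauto⟩

theorem nb5_of4 {G : SimpleGraph V} {v a b c d : V} (h : dg G v = 5) (ha : G.Adj v a) (hb : G.Adj v b)
    (hc : G.Adj v c) (hd : G.Adj v d) (hab : a ≠ b) (hac : a ≠ c) (had : a ≠ d) (hbc : b ≠ c)
    (hbd : b ≠ d) (hcd : c ≠ d) :
    ∃ e, (∀ x, G.Adj v x ↔ x = a ∨ x = b ∨ x = c ∨ x = d ∨ x = e) ∧
      a ≠ e ∧ b ≠ e ∧ c ≠ e ∧ d ≠ e := by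
  obtain ⟨r, s, hn, h1⟩ := nb5_of3 h ha hb hc hab hac hbc
  rcases (hn d).1 hd with h | h | h | h | h
  · exact absurd h.symm had
  · exact absurd h.symm hbd
  · exact absurd h.symm hcd
  · exact ⟨s, by intro x; rw [hn]; subst h; tauto, by subst h; tauto⟩
  · exact ⟨r, by intro x; rw [hn]; subst h; tauto, by subst h; tauto⟩

theorem nb5_of5 {G : SimpleGraph V} {v a b c d e : V} (h : dg G v = 5) (ha : G.Adj v a) (hb : G.Adj v b)
    (hc : G.Adj v c) (hd : G.Adj v d) (he : G.Adj v e) (hab : a ≠ b) (hac : a ≠ c) (had : a ≠ d)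
    (hae : a ≠ e) (hbc : b ≠ c) (hbd : b ≠ d) (hbe : b ≠ e) (hcd : c ≠ d) (hce : c ≠ e) (hde : d ≠ e) :
    ∀ x, G.Adj v x ↔ x = a ∨ x = b ∨ x = c ∨ x = d ∨ x = e := by
  obtain ⟨r, hn, h1⟩ := nb5_of4 h ha hb hc hd hab hac had hbc hbd hcd
  rcases (hn e).1 he with h | h | h | h | h
  · exact absurd h.symm hae
  · exact absurd h.symm hbe
  · exact absurd h.symm hce
  · exact absurd h.symm hde
  · subst h; exact hn

end
end K4T

namespace K4T

open Classical

set_option linter.unusedSectionVars false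
set_option linter.unusedVariables false

section
variable {V : Type*} [Fintype V]

theorem ne_of_dg (G : SimpleGraph V) {a b : V} (h : dg G a ≠ dg G b) : a ≠ b := by
  rintro rfl; exact h rfl

/-- Five mutually adjacent vertices of degree 5, first two with neighbours of degree 4. -/
structure K5 (G : SimpleGraph V) (k0 k1 k2 k3 k4 : V) : Prop where
  d0 : dg G k0 = 5
  d1 : dg G k1 = 5
  d2 : dg G k2 = 5
  d3 : dg G k3 = 5
  d4 : dg G k4 = 5
  a01 : G.Adj k0 k1
  a02 : G.Adj k0 k2
  a03 : G.Adj k0 k3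
  a04 : G.Adj k0 k4
  a12 : G.Adj k1 k2
  a13 : G.Adj k1 k3
  a14 : G.Adj k1 k4
  a23 : G.Adj k2 k3
  a24 : G.Adj k2 k4
  a34 : G.Adj k3 k4

theorem A_core {G : SimpleGraph V} (hG : Bad G) {k0 k1 k2 k3 k4 b0 b1 : V}
    (K : K5 G k0 k1 k2 k3 k4) (h0 : G.Adj k0 b0) (e0 : dg G b0 = 4)
    (h1 : G.Adj k1 b1) (e1 : dg G b1 = 4) :
    Cl (d2 G k0 k1) ∧ F (d2 G k0 k1) + (- 5 + bo (dg (del G k0) b1)) ≤ -4 ∧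
      dg (d2 G k0 k1) k2 = 3 ∧ dg (d2 G k0 k1) k3 = 3 ∧ dg (d2 G k0 k1) k4 = 3 := by
  obtain ⟨d0, d1, d2', d3, d4, a01, a02, a03, a04, a12, a13, a14, a23, a24, a34⟩ := K
  obtain ⟨hF, hK⟩ := hG.del_good d0 {b0} (by simp [h0, e0])
  simp at hF
  have c1 := dg_del_adj a01
  have c2 := dg_del_adj a02
  have c3 := dg_del_adj a03
  have c4 := dg_del_adj a04
  have n2 : b1 ≠ k2 := ne_of_dg G (by omega)
  have n3 : b1 ≠ k3 := ne_of_dg G (by omega)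
  have n4 : b1 ≠ k4 := ne_of_dg G (by omega)
  have n0 : b1 ≠ k0 := ne_of_dg G (by omega)
  have h := Fd4 hK.m3 (v := k1) (a := k2) (b := k3) (c := k4) (d := b1) ⟨a12, a01.ne', a02.ne'⟩
    ⟨a13, a01.ne', a03.ne'⟩ ⟨a14, a01.ne', a04.ne'⟩ ⟨h1, a01.ne', n0⟩ a23.ne a24.ne n2.symm a34.ne
    n3.symm n4.symm
  rw [show dg (del G k0) k1 = 4 by omega, show dg (del G k0) k2 = 4 by omega,
    show dg (del G k0) k3 = 4 by omega, show dg (del G k0) k4 = 4 by omega, base4, bo4] at h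
  have := kd12 a01.ne a02 a12
  have := kd12 a01.ne a03 a13
  have := kd12 a01.ne a04 a14
  refine ⟨hK.cl (by omega), by unfold d2; omega, by omega, by omega, by omega⟩

theorem A_eq {G : SimpleGraph V} (hG : Bad G) {k0 k1 k2 k3 k4 b : V}
    (K : K5 G k0 k1 k2 k3 k4) (h0 : G.Adj k0 b) (e0 : dg G b = 4)
    (h1 : G.Adj k1 b) : False := by
  obtain ⟨c, f, e2, e3, e4⟩ := A_core hG K h0 e0 h1 e0
  have := dg_del_adj h0
  rw [show dg (del G k0) b = 3 by omega, bo3] at f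
  have := c.tri0 (a := k2) (b := k3) (c := k4) ⟨⟨K.a23, K.a02.ne', K.a03.ne'⟩, K.a12.ne', K.a13.ne'⟩
    ⟨⟨K.a34, K.a03.ne', K.a04.ne'⟩, K.a13.ne', K.a14.ne'⟩
    ⟨⟨K.a24, K.a02.ne', K.a04.ne'⟩, K.a12.ne', K.a14.ne'⟩ e2 e3 e4
  omega

theorem A_ne {G : SimpleGraph V} (hG : Bad G) {k0 k1 k2 k3 k4 b0 b1 b2 : V}
    (K : K5 G k0 k1 k2 k3 k4) (h0 : G.Adj k0 b0) (e0 : dg G b0 = 4)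
    (h1 : G.Adj k1 b1) (e1 : dg G b1 = 4) (h2 : G.Adj k2 b2) (f2 : dg G b2 = 4)
    (n01 : b0 ≠ b1) (n02 : b0 ≠ b2) (n12 : b1 ≠ b2) : False := by
  obtain ⟨c, f, e2, e3, e4⟩ := A_core hG K h0 e0 h1 e1
  have o := hG.one4
  have q1 : ¬ G.Adj k0 b1 := fun h => n01 (o _ _ _ K.d0 h0 h e0 e1)
  have q2 : ¬ G.Adj k0 b2 := fun h => n02 (o _ _ _ K.d0 h0 h e0 f2)
  have q3 : ¬ G.Adj k1 b2 := fun h => n12 (o _ _ _ K.d1 h1 h e1 f2)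
  have d0 := K.d0
  have d1 := K.d1
  rw [dg_del_nadj (ne_of_dg G (by omega)) q1, e1, bo4] at f
  have := kd0 (r := k0) (s := k1) (t := b2) (ne_of_dg G (by omega)) (ne_of_dg G (by omega)) q2 q3
  have := c.tri1 (a := k2) (b := k3) (c := k4) ⟨⟨K.a23, K.a02.ne', K.a03.ne'⟩, K.a12.ne', K.a13.ne'⟩
    ⟨⟨K.a34, K.a03.ne', K.a04.ne'⟩, K.a13.ne', K.a14.ne'⟩
    ⟨⟨K.a24, K.a02.ne', K.a04.ne'⟩, K.a12.ne', K.a14.ne'⟩ e2 e3 e4 b2 (by omega)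
  omega

/-- Outside neighbour of degree 5. -/
theorem A_five {G : SimpleGraph V} (hG : Bad G) {v w1 w2 w3 w4 z b : V}
    (K : K5 G v w1 w2 w3 w4) (hz : G.Adj v z) (dz : dg G z = 4)
    (hv : ∀ x, G.Adj v x ↔ x = z ∨ x = w1 ∨ x = w2 ∨ x = w3 ∨ x = w4)
    (hb : G.Adj w1 b) (db : dg G b = 5) (n0 : b ≠ v) (n2 : b ≠ w2) (n3 : b ≠ w3) (n4 : b ≠ w4) :
    False := by
  obtain ⟨d0, d1, d2', d3, d4, a01, a02, a03, a04, a12, a13, a14, a23, a24, a34⟩ := K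
  have nz : b ≠ z := ne_of_dg G (by omega)
  have n1 := hb.ne'
  have nv : ¬ G.Adj v b := by rw [hv]; tauto
  have P := hG.pg11 d0 db n0.symm nv dz hz d1 a01 hb.symm
  have low : ∀ w, G.Adj v w → dg G w = 5 → b ≠ w → ¬ G.Adj b w → 4 ≤ dg (d2 G v b) w := by
    intro w h1 h2 h3 h4
    have := kd1 h3.symm h1 h4
    omega
  by_cases q2 : G.Adj b w2
  · by_cases q3 : G.Adj b w3
    · exact hG.p13 d0 db n0.symm nv dz hz a12.ne a13.ne a23.ne ⟨hb.symm, .inr ⟨d1, a01⟩⟩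
        ⟨q2, .inr ⟨d2', a02⟩⟩ ⟨q3, .inr ⟨d3, a03⟩⟩
    · exact P.w3 d1 a01 hb.symm a12 a14 a13 a24 a23.ne' a34.ne a02.ne' n2.symm a04.ne' n4.symm a03.ne'
        n3.symm (low _ a03 d3 n3 q3)
  · exact P.w3 d1 a01 hb.symm a13 a14 a12 a34 a23.ne a24.ne a03.ne' n3.symm a04.ne' n4.symm a02.ne'
        n2.symm (low _ a02 d2' n2 q2)

theorem LemA {G : SimpleGraph V} (hG : Bad G) {v w1 w2 w3 w4 z : V}
    (K : K5 G v w1 w2 w3 w4) (hz : G.Adj v z) (dz : dg G z = 4) : False := by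
  obtain ⟨d0, d1, d2', d3, d4, a01, a02, a03, a04, a12, a13, a14, a23, a24, a34⟩ := id K
  have hz1 : z ≠ w1 := ne_of_dg G (by omega)
  have hz2 : z ≠ w2 := ne_of_dg G (by omega)
  have hz3 : z ≠ w3 := ne_of_dg G (by omega)
  have hz4 : z ≠ w4 := ne_of_dg G (by omega)
  have hv := nb5_of5 d0 hz a01 a02 a03 a04 hz1 hz2 hz3 hz4 a12.ne a13.ne a14.ne a23.ne a24.ne a34.ne
  obtain ⟨b1, hb1, m1, m2, m3, m4⟩ := nb5_of4 d1 a01.symm a12 a13 a14 a02.ne a03.ne a04.ne a23.ne a24.ne a34.ne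
  obtain ⟨b2, hb2, l1, l2, l3, l4⟩ := nb5_of4 d2' a02.symm a12.symm a23 a24 a01.ne a03.ne a04.ne a13.ne a14.ne a34.ne
  have g1 : G.Adj w1 b1 := by simp [hb1]
  have g2 : G.Adj w2 b2 := by simp [hb2]
  rcases hG.no3 _ _ d1 g1 with e1 | e1
  swap
  · exact A_five hG K hz dz hv g1 e1 m1.symm m2.symm m3.symm m4.symm
  rcases hG.no3 _ _ d2' g2 with e2 | e2
  swap
  · exact A_five hG (v := v) (w1 := w2) (w2 := w1) (w3 := w3) (w4 := w4) (b := b2)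
      ⟨d0, d2', d1, d3, d4, a02, a01, a03, a04, a12.symm, a23, a24, a13, a14, a34⟩ hz dz
      (by intro x; rw [hv]; tauto) g2 e2 l1.symm l2.symm l3.symm l4.symm
  by_cases n01 : z = b1
  · subst n01; exact A_eq hG K hz dz g1
  by_cases n02 : z = b2
  · subst n02
    exact A_eq hG (k0 := v) (k1 := w2) (k2 := w1) (k3 := w3) (k4 := w4)
      ⟨d0, d2', d1, d3, d4, a02, a01, a03, a04, a12.symm, a23, a24, a13, a14, a34⟩ hz dz g2
  by_cases n12 : b1 = b2
  · subst n12
    exact A_eq hG (k0 := w1) (k1 := w2) (k2 := v) (k3 := w3) (k4 := w4)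
      ⟨d1, d2', d0, d3, d4, a12, a01.symm, a13, a14, a02.symm, a23, a24, a03, a04, a34⟩ g1 e1 g2
  exact A_ne hG K hz dz g1 e1 g2 e2 n01 n02 n12

end
end K4T

namespace K4T

open Classical

set_option linter.unusedSectionVars false
set_option linter.unusedVariables false

section
variable {V : Type*} [Fintype V]

theorem d2_comm (G : SimpleGraph V) (r s : V) : d2 G r s = d2 G s r := by
  ext a b
  show (G.Adj a b ∧ _ ∧ _) ∧ _ ∧ _ ↔ (G.Adj a b ∧ _ ∧ _) ∧ _ ∧ _
  tauto

theorem PG.symm {G : SimpleGraph V} {r s : V} (P : PG G r s) : PG G s r :=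
  ⟨P.ds, P.dr, P.ne.symm, fun h => P.nadj h.symm, d2_comm G r s ▸ P.good, d2_comm G r s ▸ P.hF⟩

theorem ne_of_adj {G : SimpleGraph V} {a b c : V} (h : G.Adj c a) (h' : ¬ G.Adj c b) : a ≠ b := by
  rintro rfl; exact absurd h h'

section
end

/-- Four common neighbours are impossible. -/
theorem Bad.p04 {G : SimpleGraph V} (hG : Bad G) {r s a b c d : V} (hr : dg G r = 5)
    (hs : dg G s = 5) (hrs : r ≠ s) (hn : ¬ G.Adj r s)
    (hab : a ≠ b) (hac : a ≠ c) (had : a ≠ d) (hbc : b ≠ c) (hbd : b ≠ d) (hcd : c ≠ d)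
    (ha : G.Adj r a ∧ G.Adj s a ∧ dg G a = 5)
    (hb : G.Adj r b ∧ G.Adj s b ∧ dg G b = 5)
    (hc : G.Adj r c ∧ G.Adj s c ∧ dg G c = 5)
    (hd : G.Adj r d ∧ G.Adj s d ∧ dg G d = 5) : False := by
  have := hG.pair hr hs hrs hn ∅ {a, b, c, d} (by simp) (by
    intro t ht
    simp at ht
    rcases ht with rfl | rfl | rfl | rfl <;> tauto)
  rw [Finset.card_insert_of_notMem (by simp [hab, hac, had]),
    Finset.card_insert_of_notMem (by simp [hbc, hbd]), Finset.card_pair hcd] at this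
  simp at this

theorem Bad.pg02 {G : SimpleGraph V} (hG : Bad G) {r s a b : V} (hr : dg G r = 5)
    (hs : dg G s = 5) (hrs : r ≠ s) (hn : ¬ G.Adj r s)
    (hab : a ≠ b)
    (ha : G.Adj r a ∧ G.Adj s a ∧ dg G a = 5)
    (hb : G.Adj r b ∧ G.Adj s b ∧ dg G b = 5) : PG G r s := by
  refine hG.pg hr hs hrs hn ∅ {a, b} (by simp) (by
    intro t ht
    simp at ht
    rcases ht with rfl | rfl <;> tauto) ?_
  rw [Finset.card_pair hab]; simp

theorem B1core {G : SimpleGraph V} (hG : Bad G) {v z r e a b c : V} (dv : dg G v = 5)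
    (dz : dg G z = 4) (vz : G.Adj v z) (dr : dg G r = 5) (vr : G.Adj v r)
    (re : G.Adj r e) (ra : G.Adj r a) (rb : G.Adj r b) (rc : G.Adj r c)
    (ev : e ≠ v) (av : a ≠ v) (bv : b ≠ v) (cv : c ≠ v)
    (ea : e ≠ a) (eb : e ≠ b) (ec : e ≠ c) (ab : a ≠ b) (ac : a ≠ c) (bc : b ≠ c)
    (de : dg G e = 5) (da : dg G a = 5) (db : dg G b = 5) (dc : dg G c = 5)
    (va : ¬ G.Adj v a) (vb : ¬ G.Adj v b) (vc : ¬ G.Adj v c) : False := by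
  have Pa := hG.pg11 dv da av.symm va dz vz dr vr ra.symm
  have Pb := hG.pg11 dv db bv.symm vb dz vz dr vr rb.symm
  have Aab := (Pa.w1 dr vr ra.symm db rb bv ab.symm).resolve_left vb
  have Aac := (Pa.w1 dr vr ra.symm dc rc cv ac.symm).resolve_left vc
  have Abc := (Pb.w1 dr vr rb.symm dc rc cv bc.symm).resolve_left vc
  by_cases heb : G.Adj e b
  · refine Pa.w3 dr vr ra.symm re rb rc heb ec.symm bc.symm ev ea bv ab.symm cv ac.symm ?_
    have := kd2 Pa.ne cv vc Aac
    omega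
  by_cases hea : G.Adj e a
  · refine Pb.w3 dr vr rb.symm re ra rc hea ec.symm ac.symm ev eb av ab cv bc.symm ?_
    have := kd2 Pb.ne cv vc Abc
    omega
  · refine Pa.w3 dr vr ra.symm rb rc re Abc eb ec bv ab.symm cv ac.symm ev ea ?_
    by_cases h : G.Adj v e
    · have := kd1 ea h (fun h => hea h.symm)
      omega
    · rw [kd0 ev ea h (fun h => hea h.symm)]; omega

/-- A vertex of degree 5 with its neighbourhood. -/
structure St (G : SimpleGraph V) (v z a b c d : V) : Prop where
  dv : dg G v = 5
  dz : dg G z = 4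
  da : dg G a = 5
  db : dg G b = 5
  dc : dg G c = 5
  dd : dg G d = 5
  hv : ∀ x, G.Adj v x ↔ x = z ∨ x = a ∨ x = b ∨ x = c ∨ x = d
  ab : a ≠ b
  ac : a ≠ c
  ad : a ≠ d
  bc : b ≠ c
  bd : b ≠ d
  cd : c ≠ d

theorem St.sw1 {G : SimpleGraph V} {v z a b c d : V} (S : St G v z a b c d) : St G v z b a c d :=
  ⟨S.dv, S.dz, S.db, S.da, S.dc, S.dd, by intro x; rw [S.hv]; tauto, S.ab.symm, S.bc, S.bd, S.ac, S.ad, S.cd⟩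

theorem St.sw2 {G : SimpleGraph V} {v z a b c d : V} (S : St G v z a b c d) : St G v z a c b d :=
  ⟨S.dv, S.dz, S.da, S.dc, S.db, S.dd, by intro x; rw [S.hv]; tauto, S.ac, S.ab, S.ad, S.bc.symm, S.cd, S.bd⟩

theorem St.sw3 {G : SimpleGraph V} {v z a b c d : V} (S : St G v z a b c d) : St G v z a b d c :=
  ⟨S.dv, S.dz, S.da, S.db, S.dd, S.dc, by intro x; rw [S.hv]; tauto, S.ab, S.ad, S.ac, S.bd, S.bc, S.cd.symm⟩

theorem St.swp {G : SimpleGraph V} {v z a b c d : V} (S : St G v z a b c d) : St G v z c d a b :=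
  S.sw2.sw1.sw3.sw2

theorem St.va {G : SimpleGraph V} {v z a b c d : V} (S : St G v z a b c d) : G.Adj v a := by
  rw [S.hv]; tauto
theorem St.vz {G : SimpleGraph V} {v z a b c d : V} (S : St G v z a b c d) : G.Adj v z := by
  rw [S.hv]; tauto

/-- `B1`: vertex `a` without 4-neighbours, not adjacent to `b` and `c`. -/
theorem St.B1 {G : SimpleGraph V} {v z a b c d : V} (hG : Bad G) (S : St G v z a b c d)
    (h4 : ∀ x, G.Adj a x → dg G x = 5) (nb : ¬ G.Adj a b) (nc : ¬ G.Adj a c) : False := by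
  have hv : ∀ x, G.Adj a x → x ≠ d → ¬ G.Adj v x := by
    intro x hx hd h
    have := h4 x hx
    have hz := S.dz
    rcases (S.hv x).1 h with h | h | h | h | h
    · subst h; omega
    · subst h; exact hx.ne rfl
    · subst h; tauto
    · subst h; tauto
    · tauto
  have va := S.va
  by_cases had : G.Adj a d
  · have vd := S.sw3.sw2.sw1.va
    obtain ⟨p, q, r, hn, n1, n2, n3, n4, n5, n6, n7, n8, n9⟩ := nb5_of2 S.da va.symm had vd.ne
    have ap : G.Adj a p := by simp [hn]
    have aq : G.Adj a q := by simp [hn]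
    have ar : G.Adj a r := by simp [hn]
    exact B1core hG S.dv S.dz S.vz S.da va had ap aq ar vd.ne' n1.symm n2.symm n3.symm n4 n5 n6 n7 n8 n9
      S.dd (h4 _ ap) (h4 _ aq) (h4 _ ar) (hv _ ap n4.symm) (hv _ aq n5.symm) (hv _ ar n6.symm)
  · obtain ⟨e, p, q, r, hn, n0, n1, n2, n3, n4, n5, n6, n7, n8, n9⟩ := nb5_of S.da va.symm
    have ae : G.Adj a e := by simp [hn]
    have ap : G.Adj a p := by simp [hn]
    have aq : G.Adj a q := by simp [hn]
    have ar : G.Adj a r := by simp [hn]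
    exact B1core hG S.dv S.dz S.vz S.da va ae ap aq ar n0.symm n1.symm n2.symm n3.symm n4 n5 n6 n7 n8 n9
      (h4 _ ae) (h4 _ ap) (h4 _ aq) (h4 _ ar) (hv _ ap (ne_of_adj ap had)) (hv _ aq (ne_of_adj aq had))
      (hv _ ar (ne_of_adj ar had))

theorem Bad.four {G : SimpleGraph V} (hG : Bad G) {a : V} (ha : dg G a = 5) :
    (∀ x, G.Adj a x → dg G x = 5) ∨ ∃ y, G.Adj a y ∧ dg G y = 4 := by
  by_cases h : ∃ y, G.Adj a y ∧ dg G y = 4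
  · exact .inr h
  · left
    intro x hx
    rcases hG.no3 a x ha hx with h' | h'
    · exact absurd ⟨x, hx, h'⟩ h
    · exact h'

theorem St.pg {G : SimpleGraph V} {v z a b c d : V} (hG : Bad G) (S : St G v z a b c d)
    (nab : ¬ G.Adj a b) : PG G a b := by
  have va := S.va
  have vb := S.sw1.va
  rcases hG.four S.da with h | ⟨y, hy, dy⟩
  · rcases hG.four S.db with h' | ⟨y, hy, dy⟩
    · have e1 : G.Adj a c := by
        by_contra hn; exact S.B1 hG h nab hn
      have e2 : G.Adj b c := by
        by_contra hn; exact S.sw1.B1 hG h' (fun h => nab h.symm) hn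
      exact hG.pg02 S.da S.db S.ab nab (S.sw2.sw1.va.ne) ⟨va.symm, vb.symm, S.dv⟩ ⟨e1, e2, S.dc⟩
    · exact (hG.pg11 S.db S.da S.ab.symm (fun h => nab h.symm) dy hy S.dv vb.symm va.symm).symm
  · exact hG.pg11 S.da S.db S.ab nab dy hy S.dv va.symm vb.symm

theorem St.B2 {G : SimpleGraph V} {v z a b c d : V} (hG : Bad G) (S : St G v z a b c d)
    (hz : ∀ x, G.Adj v x → ¬ G.Adj x z)
    (nab : ¬ G.Adj a b) : ¬ G.Adj c d ∧ (G.Adj a c ∨ G.Adj b c) ∧ (G.Adj a d ∨ G.Adj b d) := by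
  have P := S.pg hG nab
  have va := S.va
  have vb := S.sw1.va
  have vc := S.swp.va
  have vd := S.swp.sw1.va
  have za : z ≠ a := ne_of_dg G (by rw [S.dz, S.da]; omega)
  have zb : z ≠ b := ne_of_dg G (by rw [S.dz, S.db]; omega)
  have zc : z ≠ c := ne_of_dg G (by rw [S.dz, S.dc]; omega)
  have zd : z ≠ d := ne_of_dg G (by rw [S.dz, S.dd]; omega)
  refine ⟨?_, P.w1 S.dv va.symm vb.symm S.dc vc S.ac.symm S.bc.symm,
    P.w1 S.dv va.symm vb.symm S.dd vd S.ad.symm S.bd.symm⟩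
  intro hcd
  refine P.w3 S.dv va.symm vb.symm vc vd S.vz hcd zc zd S.ac.symm S.bc.symm S.ad.symm S.bd.symm za zb ?_
  rw [kd0 za zb (hz _ va) (hz _ vb), S.dz]

/-- The 4-cycle: no 4-neighbours. -/
theorem St.C0 {G : SimpleGraph V} {v z a b c d : V} (hG : Bad G) (S : St G v z a b c d)
    (nab : ¬ G.Adj a b) (ac : G.Adj a c) (ad : G.Adj a d) (bc : G.Adj b c) (bd : G.Adj b d) :
    (∀ x, G.Adj a x → dg G x = 5) := by
  have va := S.va
  have vb := S.sw1.va
  have vc := S.swp.va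
  have vd := S.swp.sw1.va
  rcases hG.four S.da with h | ⟨y, hy, dy⟩
  · exact h
  · exact (hG.p13 S.da S.db S.ab nab dy hy vc.ne vd.ne S.cd ⟨vb.symm, .inr ⟨S.dv, va.symm⟩⟩
      ⟨bc, .inr ⟨S.dc, ac⟩⟩ ⟨bd, .inr ⟨S.dd, ad⟩⟩).elim

theorem St.C1 {G : SimpleGraph V} {v z a b c d : V} (hG : Bad G) (S : St G v z a b c d)
    (nab : ¬ G.Adj a b) (ncd : ¬ G.Adj c d) (ac : G.Adj a c) (ad : G.Adj a d) (bc : G.Adj b c)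
    (bd : G.Adj b d) : ∃ x y, (∀ u, G.Adj c u ↔ u = v ∨ u = a ∨ u = b ∨ u = x ∨ u = y) ∧
      dg G x = 5 ∧ dg G y = 5 ∧ G.Adj x y ∧ G.Adj a y ∧ G.Adj b x ∧ ¬ G.Adj a x ∧ ¬ G.Adj b y ∧
      ¬ G.Adj v x ∧ ¬ G.Adj v y ∧ x ≠ v ∧ y ≠ v := by
  have va := S.va
  have vb := S.sw1.va
  have vc := S.swp.va
  have vd := S.swp.sw1.va
  have h4 := S.swp.C0 hG ncd ac.symm bc.symm ad.symm bd.symm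
  have P := hG.pg02 S.da S.db S.ab nab vc.ne ⟨va.symm, vb.symm, S.dv⟩ ⟨ac, bc, S.dc⟩
  obtain ⟨x, y, hn, vx, vy, ax, ay, bx, by', xy⟩ := nb5_of3 S.dc vc.symm ac.symm bc.symm va.ne vb.ne S.ab
  have key : ∀ x, G.Adj c x → x ≠ v → x ≠ a → x ≠ b →
      dg G x = 5 ∧ ¬ G.Adj v x ∧ (G.Adj a x ∨ G.Adj b x) ∧ ¬ (G.Adj a x ∧ G.Adj b x) ∧ PG G v x := by
    intro x hx h1 h2 h3
    have dx := h4 x hx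
    have nvx : ¬ G.Adj v x := by
      rw [S.hv]
      rintro (h | h | h | h | h)
      · have := S.dz; subst h; omega
      · tauto
      · tauto
      · subst h; exact hx.ne rfl
      · subst h; tauto
    have xd : d ≠ x := (ne_of_adj hx ncd).symm
    refine ⟨dx, nvx, P.w1 S.dc ac bc dx hx h2 h3, ?_, hG.pg11 S.dv dx h1.symm nvx S.dz S.vz S.dc vc hx.symm⟩
    rintro ⟨q1, q2⟩
    exact hG.p04 S.da S.db S.ab nab vc.ne vd.ne h1.symm S.cd hx.ne xd ⟨va.symm, vb.symm, S.dv⟩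
      ⟨ac, bc, S.dc⟩ ⟨ad, bd, S.dd⟩ ⟨q1, q2, dx⟩
  have cx : G.Adj c x := by simp [hn]
  have cy : G.Adj c y := by simp [hn]
  obtain ⟨dx, nvx, x1, x2, Px⟩ := key x cx vx.symm ax.symm bx.symm
  obtain ⟨dy, nvy, y1, y2, Py⟩ := key y cy vy.symm ay.symm by'.symm
  have Axy := (Px.w1 S.dc vc cx.symm dy cy vy.symm xy.symm).resolve_left nvy
  by_cases q1 : G.Adj a x
  · by_cases q2 : G.Adj a y
    · exfalso
      have r1 : ¬ G.Adj b x := fun h => x2 ⟨q1, h⟩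
      refine Px.w3 S.dc vc cx.symm ac.symm cy bc.symm q2 S.ab.symm by' va.ne' ax vy.symm xy.symm vb.ne' bx ?_
      have := kd1 bx vb (fun h => r1 h.symm)
      have := S.db
      omega
    · exact ⟨y, x, by intro u; rw [hn]; tauto, dy, dx, Axy.symm, q1, by tauto, q2, by tauto, nvy, nvx,
        vy.symm, vx.symm⟩
  · by_cases q2 : G.Adj a y
    · exact ⟨x, y, hn, dx, dy, Axy, q2, by tauto, q1, by tauto, nvx, nvy, vx.symm, vy.symm⟩
    · exfalso
      have := x1.resolve_left q1
      refine Px.w3 S.dc vc cx.symm bc.symm cy ac.symm (y1.resolve_left q2) S.ab ay vb.ne' bx vy.symm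
        xy.symm va.ne' ax ?_
      have := kd1 ax va (fun h => q1 h.symm)
      have := S.da
      omega

theorem St.C4 {G : SimpleGraph V} {v z r1 r2 s t : V} (hG : Bad G) (S : St G v z r1 r2 s t)
    (nr : ¬ G.Adj r1 r2) (nst : ¬ G.Adj s t) (r1s : G.Adj r1 s) (r1t : G.Adj r1 t) (r2s : G.Adj r2 s)
    (r2t : G.Adj r2 t) : False := by
  obtain ⟨a, b, hs, da, db, ab, r1b, r2a, nr1a, nr2b, nva, nvb, av, bv⟩ := S.C1 hG nr nst r1s r1t r2s r2t
  obtain ⟨a', b', ht, da', db', ab', r1b', r2a', nr1a', nr2b', nva', nvb', av', bv'⟩ :=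
    S.sw3.C1 hG nr (fun h => nst h.symm) r1t r1s r2t r2s
  have vr1 := S.va
  have vr2 := S.sw1.va
  have vs := S.swp.va
  have vt := S.swp.sw1.va
  have sa : G.Adj s a := by simp [hs]
  have sb : G.Adj s b := by simp [hs]
  have ta' : G.Adj t a' := by simp [ht]
  have tb' : G.Adj t b' := by simp [ht]
  have nc : ∀ q, dg G q = 5 → q ≠ v → q ≠ r1 → q ≠ r2 → G.Adj s q → G.Adj t q → False := by
    intro q dq h1 h2 h3 h4 h5
    exact hG.p04 S.dc S.dd S.cd nst vr1.ne vr2.ne h1.symm S.ab h2.symm h3.symm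
      ⟨vs.symm, vt.symm, S.dv⟩ ⟨r1s.symm, r1t.symm, S.da⟩ ⟨r2s.symm, r2t.symm, S.db⟩ ⟨h4, h5, dq⟩
  have nta : ¬ G.Adj t a := nc a da av (ne_of_adj r2a (fun h => nr h.symm)) r2a.ne' sa |> fun h h' => h h'
  have ntb : ¬ G.Adj t b := fun h => nc b db bv r1b.ne' (ne_of_adj r1b nr) sb h
  have nsa' : ¬ G.Adj s a' := fun h => nc a' da' av' (ne_of_adj r2a' (fun h => nr h.symm)) r2a'.ne' h ta'
  have nsb' : ¬ G.Adj s b' := fun h => nc b' db' bv' r1b'.ne' (ne_of_adj r1b' nr) h tb'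
  have Pb := hG.pg11 S.dv db bv.symm nvb S.dz S.vz S.da vr1 r1b.symm
  have Pa := hG.pg11 S.dv da av.symm nva S.dz S.vz S.db vr2 r2a.symm
  have bb' : b ≠ b' := ne_of_adj sb nsb'
  have aa' : a ≠ a' := ne_of_adj sa nsa'
  have ab'' : b' ≠ a := ne_of_adj r1b' nr1a
  have a'b : b ≠ a' := ne_of_adj r1b nr1a'
  have Abb := (Pb.w1 S.da vr1 r1b.symm db' r1b' bv' bb'.symm).resolve_left nvb'
  have Aaa := (Pa.w1 S.db vr2 r2a.symm da' r2a' av' aa'.symm).resolve_left nva'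
  have tva : t ≠ a := ne_of_adj vt nva
  have tvb : t ≠ b := ne_of_adj vt nvb
  have r1a : r1 ≠ a := ne_of_adj vr1 nva
  have r2b : r2 ≠ b := ne_of_adj vr2 nvb
  have S1 := S.da
  have S2 := S.db
  have S3 := S.dc
  have S4 := S.dd
  by_cases q1 : G.Adj a' b
  · by_cases q2 : G.Adj b' a
    · have sa' : s ≠ a' := (ne_of_adj vs nva')
      have P := hG.pg02 S.dc da' sa' nsa' (r2a.ne) ⟨r2s.symm, r2a'.symm, S.db⟩ ⟨sa, Aaa.symm, da⟩
      refine P.w2 (v := b') (a := a) (b := b) q2 Abb.symm ab.ne (ne_of_adj vs nvb').symm ab'.ne' sa.ne' aa'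
        sb.ne' a'b ?_ ?_ ?_
      · have := kd2 P.ne (ne_of_adj vs nvb').symm nsb' ab'
        omega
      · have := kd12 P.ne sa Aaa.symm
        omega
      · have := kd12 P.ne sb q1
        omega
    · refine Pa.w4 (v := b') (a := r1) (b := t) (c := a') (d := b) r1b'.symm tb'.symm ab'.symm Abb.symm
        r1t.ne (ne_of_adj vr1 nva') (ne_of_adj vr1 nvb) (ne_of_adj vt nva') tvb a'b.symm bv' ab'' vr1.ne' r1a
        vt.ne' tva av' aa'.symm bv ab.ne' ?_ ?_ ?_ ?_ ?_
      · rw [kd0 bv' ab'' nvb' (fun h => q2 h.symm), db']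
      · have := kd1 r1a vr1 (fun h => nr1a h.symm); omega
      · have := kd1 tva vt (fun h => nta h.symm); omega
      · have := kd2 Pa.ne av' nva' Aaa; omega
      · have := kd2 Pa.ne bv nvb ab; omega
  · refine Pb.w4 (v := a') (a := r2) (b := t) (c := a) (d := b') r2a'.symm ta'.symm Aaa.symm ab'
        r2t.ne (ne_of_adj vr2 nva) (ne_of_adj vr2 nvb') tva (ne_of_adj vt nvb') ab''.symm av' a'b.symm vr2.ne' r2b
        vt.ne' tvb av ab.ne bv' bb'.symm ?_ ?_ ?_ ?_ ?_
    · rw [kd0 av' a'b.symm nva' (fun h => q1 h.symm), da']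
    · have := kd1 r2b vr2 (fun h => nr2b h.symm); omega
    · have := kd1 tvb vt (fun h => ntb h.symm); omega
    · have := kd2 Pb.ne av nva ab.symm; omega
    · have := kd2 Pb.ne bv' nvb' Abb; omega

/-- Lemma B, from a non-adjacent pair. -/
theorem St.LB {G : SimpleGraph V} {v z a b c d : V} (hG : Bad G) (S : St G v z a b c d)
    (hz : ∀ x, G.Adj v x → ¬ G.Adj x z) (nab : ¬ G.Adj a b) :
    (∀ w, w = a ∨ w = b ∨ w = c ∨ w = d → ∃ y, G.Adj w y ∧ dg G y = 4) ∧
    ((G.Adj a c ∧ G.Adj b d ∧ ¬ G.Adj a d ∧ ¬ G.Adj b c ∧ ¬ G.Adj a b ∧ ¬ G.Adj c d) ∨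
     (G.Adj a d ∧ G.Adj b c ∧ ¬ G.Adj a c ∧ ¬ G.Adj b d ∧ ¬ G.Adj a b ∧ ¬ G.Adj c d)) := by
  have nab' : ¬ G.Adj b a := fun h => nab h.symm
  obtain ⟨h1, h2, h3⟩ := S.B2 hG hz nab
  have h1' : ¬ G.Adj d c := fun h => h1 h.symm
  have h4 := S.swp.B2 hG hz h1
  have main : ((G.Adj a c ∧ G.Adj b d ∧ ¬ G.Adj a d ∧ ¬ G.Adj b c ∧ ¬ G.Adj a b ∧ ¬ G.Adj c d) ∨
     (G.Adj a d ∧ G.Adj b c ∧ ¬ G.Adj a c ∧ ¬ G.Adj b d ∧ ¬ G.Adj a b ∧ ¬ G.Adj c d)) := by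
    by_cases q1 : G.Adj a c
    · by_cases q2 : G.Adj a d
      · by_cases q3 : G.Adj b c
        · by_cases q4 : G.Adj b d
          · exact (S.C4 hG nab h1 q1 q2 q3 q4).elim
          · have := S.sw1.sw3.sw2.B2 hG hz q4
            tauto
        · have := S.sw1.sw2.B2 hG hz q3
          tauto
      · have := S.sw3.sw2.B2 hG hz q2
        have e1 : G.Adj b d := by tauto
        have e2 : ¬ G.Adj b c := by tauto
        tauto
    · have := S.sw2.B2 hG hz q1
      have e1 : G.Adj a d := by tauto
      have e2 : ¬ G.Adj b d := by tauto
      tauto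
  refine ⟨?_, main⟩
  have key : ∀ a b c d, St G v z a b c d → ¬ G.Adj a b → ¬ G.Adj a c → ∃ y, G.Adj a y ∧ dg G y = 4 := by
    intro a b c d S h1 h2
    rcases hG.four S.da with h | h
    · exact (S.B1 hG h h1 h2).elim
    · exact h
  have nn : ∀ x y, ¬ G.Adj x y → ¬ G.Adj y x := fun x y h h' => h h'.symm
  rintro w (rfl | rfl | rfl | rfl)
  · rcases main with m | m
    · exact key w b d c S.sw3 (by tauto) (by tauto)
    · exact key w b c d S (by tauto) (by tauto)
  · rcases main with m | m
    · exact key w a c d S.sw1 (by tauto) (by tauto)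
    · exact key w a d c S.sw1.sw3 (by tauto) (by tauto)
  · rcases main with m | m
    · exact key w d b a S.swp.sw3 h1 (nn _ _ (by tauto))
    · exact key w d a b S.swp h1 (nn _ _ (by tauto))
  · rcases main with m | m
    · exact key w c a b S.swp.sw1 h1' (nn _ _ (by tauto))
    · exact key w c b a S.swp.sw1.sw3 h1' (nn _ _ (by tauto))

end
end K4T

namespace K4T

open Classical

set_option linter.unusedSectionVars false
set_option linter.unusedVariables false

section
variable {V : Type*} [Fintype V]

theorem Bad.five {G : SimpleGraph V} (hG : Bad G) {v z x : V} (dv : dg G v = 5) (vz : G.Adj v z)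
    (dz : dg G z = 4) (vx : G.Adj v x) (hx : z ≠ x) : dg G x = 5 := by
  rcases hG.no3 v x dv vx with h | h
  · exact absurd (hG.one4 v z x dv vz vx dz h) hx
  · exact h

theorem Bad.st {G : SimpleGraph V} (hG : Bad G) {v z a : V} (dv : dg G v = 5) (vz : G.Adj v z)
    (dz : dg G z = 4) (va : G.Adj v a) (da : dg G a = 5) : ∃ b c d, St G v z a b c d := by
  have za : z ≠ a := ne_of_dg G (by omega)
  obtain ⟨b, c, d, hn, h1, h2, h3, h4, h5, h6, h7, h8, h9⟩ := nb5_of2 dv vz va za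
  exact ⟨b, c, d, dv, dz, da, hG.five dv vz dz (by simp [hn]) h1, hG.five dv vz dz (by simp [hn]) h2,
    hG.five dv vz dz (by simp [hn]) h3, hn, h4, h5, h6, h7, h8, h9⟩

theorem Bad.st2 {G : SimpleGraph V} (hG : Bad G) {v z a b : V} (dv : dg G v = 5) (vz : G.Adj v z)
    (dz : dg G z = 4) (va : G.Adj v a) (da : dg G a = 5) (vb : G.Adj v b) (db : dg G b = 5)
    (ab : a ≠ b) : ∃ c d, St G v z a b c d := by
  obtain ⟨p, q, r, S⟩ := hG.st dv vz dz va da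
  rcases (S.hv b).1 vb with h | h | h | h | h
  · subst h; omega
  · exact absurd h.symm ab
  · subst h; exact ⟨_, _, S⟩
  · subst h; exact ⟨_, _, S.sw2⟩
  · subst h; exact ⟨_, _, S.sw3.sw2⟩

theorem Bad.st3 {G : SimpleGraph V} (hG : Bad G) {v z a b c : V} (dv : dg G v = 5) (vz : G.Adj v z)
    (dz : dg G z = 4) (va : G.Adj v a) (da : dg G a = 5) (vb : G.Adj v b) (db : dg G b = 5)
    (vc : G.Adj v c) (dc : dg G c = 5)
    (ab : a ≠ b) (ac : a ≠ c) (bc : b ≠ c) : ∃ d, St G v z a b c d := by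
  obtain ⟨q, r, S⟩ := hG.st2 dv vz dz va da vb db ab
  rcases (S.hv c).1 vc with h | h | h | h | h
  · subst h; omega
  · exact absurd h.symm ac
  · exact absurd h.symm bc
  · subst h; exact ⟨_, S⟩
  · subst h; exact ⟨_, S.sw3⟩

/-- Lemmas A and B combined. -/
theorem St.LAB {G : SimpleGraph V} {v z a b c d : V} (hG : Bad G) (S : St G v z a b c d)
    (hz : ∀ x, G.Adj v x → ¬ G.Adj x z) :
    (∀ w, G.Adj v w → dg G w = 5 → ∃ y, G.Adj w y ∧ dg G y = 4) ∧
    (∀ w x y, G.Adj v w → G.Adj v x → G.Adj v y → dg G w = 5 → dg G x = 5 → dg G y = 5 →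
      x ≠ y → G.Adj w x → G.Adj w y → False) := by
  have main : ∀ a b c d, St G v z a b c d → ¬ G.Adj a b →
    (∀ w, G.Adj v w → dg G w = 5 → ∃ y, G.Adj w y ∧ dg G y = 4) ∧
    (∀ w x y, G.Adj v w → G.Adj v x → G.Adj v y → dg G w = 5 → dg G x = 5 → dg G y = 5 →
      x ≠ y → G.Adj w x → G.Adj w y → False) := by
    intro a b c d S nab
    obtain ⟨h1, h2⟩ := S.LB hG hz nab
    have cl : ∀ w, G.Adj v w → dg G w = 5 → w = a ∨ w = b ∨ w = c ∨ w = d := by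
      intro w hw dw
      rcases (S.hv w).1 hw with h | h
      · have := S.dz
        subst h; omega
      · exact h
    refine ⟨fun w hw dw => h1 w (cl w hw dw), ?_⟩
    intro w x y vw vx vy dw dx dy xy wx wy
    have uniq : ∃ m, ∀ x, x = a ∨ x = b ∨ x = c ∨ x = d → G.Adj w x → x = m := by
      rcases h2 with ⟨-, -, k1, k2, k3, k4⟩ | ⟨-, -, k1, k2, k3, k4⟩
      · rcases cl w vw dw with h | h | h | h <;> subst h
        · refine ⟨c, ?_⟩
          rintro x (h | h | h | h) hx <;> subst h <;> first | rfl | exact absurd hx (by assumption) | exact absurd hx.symm (by assumption) | exact absurd rfl hx.ne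
        · refine ⟨d, ?_⟩
          rintro x (h | h | h | h) hx <;> subst h <;> first | rfl | exact absurd hx (by assumption) | exact absurd hx.symm (by assumption) | exact absurd rfl hx.ne
        · refine ⟨a, ?_⟩
          rintro x (h | h | h | h) hx <;> subst h <;> first | rfl | exact absurd hx (by assumption) | exact absurd hx.symm (by assumption) | exact absurd rfl hx.ne
        · refine ⟨b, ?_⟩
          rintro x (h | h | h | h) hx <;> subst h <;> first | rfl | exact absurd hx (by assumption) | exact absurd hx.symm (by assumption) | exact absurd rfl hx.ne
      · rcases cl w vw dw with h | h | h | h <;> subst h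
        · refine ⟨d, ?_⟩
          rintro x (h | h | h | h) hx <;> subst h <;> first | rfl | exact absurd hx (by assumption) | exact absurd hx.symm (by assumption) | exact absurd rfl hx.ne
        · refine ⟨c, ?_⟩
          rintro x (h | h | h | h) hx <;> subst h <;> first | rfl | exact absurd hx (by assumption) | exact absurd hx.symm (by assumption) | exact absurd rfl hx.ne
        · refine ⟨b, ?_⟩
          rintro x (h | h | h | h) hx <;> subst h <;> first | rfl | exact absurd hx (by assumption) | exact absurd hx.symm (by assumption) | exact absurd rfl hx.ne
        · refine ⟨a, ?_⟩
          rintro x (h | h | h | h) hx <;> subst h <;> first | rfl | exact absurd hx (by assumption) | exact absurd hx.symm (by assumption) | exact absurd rfl hx.ne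
    obtain ⟨m, hm⟩ := uniq
    exact xy ((hm x (cl x vx dx) wx).trans (hm y (cl y vy dy) wy).symm)
  by_cases q1 : G.Adj a b
  · by_cases q2 : G.Adj a c
    · by_cases q3 : G.Adj a d
      · by_cases q4 : G.Adj b c
        · by_cases q5 : G.Adj b d
          · by_cases q6 : G.Adj c d
            · exact (LemA hG ⟨S.dv, S.da, S.db, S.dc, S.dd, S.va, S.sw1.va, S.swp.va, S.swp.sw1.va,
                q1, q2, q3, q4, q5, q6⟩ S.vz S.dz).elim
            · exact main _ _ _ _ S.swp q6
          · exact main _ _ _ _ S.sw1.sw3.sw2 q5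
        · exact main _ _ _ _ S.sw1.sw2 q4
      · exact main _ _ _ _ S.sw3.sw2 q3
    · exact main _ _ _ _ S.sw2 q2
  · exact main _ _ _ _ S q1

theorem Bad.two5 {G : SimpleGraph V} (hG : Bad G) {a v w : V} (da : dg G a = 5) (av : G.Adj a v)
    (aw : G.Adj a w) (vw : v ≠ w) : ∃ p q, G.Adj a p ∧ G.Adj a q ∧ p ≠ q ∧ p ≠ v ∧ p ≠ w ∧ q ≠ v ∧
      q ≠ w ∧ dg G p = 5 ∧ dg G q = 5 := by
  obtain ⟨p, q, r, hn, h1, h2, h3, h4, h5, h6, h7, h8, h9⟩ := nb5_of2 da av aw vw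
  have ap : G.Adj a p := by simp [hn]
  have aq : G.Adj a q := by simp [hn]
  have ar : G.Adj a r := by simp [hn]
  rcases hG.no3 a p da ap with h | h
  · exact ⟨q, r, aq, ar, h9, h2.symm, h5.symm, h3.symm, h6.symm, hG.five da ap h aq h7, hG.five da ap h ar h8⟩
  rcases hG.no3 a q da aq with h' | h'
  · exact ⟨p, r, ap, ar, h8, h1.symm, h4.symm, h3.symm, h6.symm, h, hG.five da aq h' ar h9⟩
  · exact ⟨p, q, ap, aq, h7, h1.symm, h4.symm, h2.symm, h5.symm, h, h'⟩

theorem ruleA {G : SimpleGraph V} (hG : Bad G) {v w z a e : V} (dv : dg G v = 5) (dw : dg G w = 5)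
    (dz : dg G z = 4) (da : dg G a = 5) (de : dg G e = 5) (vw : G.Adj v w) (vz : G.Adj v z)
    (wz : G.Adj w z) (va : G.Adj v a) (wa : G.Adj w a) (ae : G.Adj a e) (ev : e ≠ v) (ew : e ≠ w) :
    G.Adj v e ∨ G.Adj w e := by
  by_contra hc
  push Not at hc
  obtain ⟨h1, h2⟩ := hc
  have P := hG.pg11 dv de ev.symm h1 dz vz da va ae.symm
  have nez : ¬ G.Adj e z := fun h => hG.F2 dv de ev.symm h1 dz vz h
  have ze : z ≠ e := ne_of_dg G (by omega)
  have za : z ≠ a := ne_of_dg G (by omega)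
  refine P.w2 (v := w) (a := a) (b := z) wa wz za.symm vw.ne' ew.symm va.ne' ae.ne vz.ne' ze ?_ ?_ ?_
  · have := kd1 ew.symm vw (fun h => h2 h.symm); omega
  · have := kd12 P.ne va ae.symm; omega
  · have := kd1 ze vz nez; omega

theorem C3 {G : SimpleGraph V} (hG : Bad G) {v w z a b c : V} (S : St G v z w a b c)
    (wz : G.Adj w z) (wa : G.Adj w a) (wb : G.Adj w b) (wc : G.Adj w c) : False := by
  have vw := S.va
  have vz := S.vz
  have key : ∀ a b c, St G v z w a b c → G.Adj w a → G.Adj w b → G.Adj w c → G.Adj a b ∧ G.Adj a c := by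
    intro a b c S wa wb wc
    have va := S.sw1.va
    have wz' : z ≠ v := vz.ne'
    have T := nb5_of5 S.da wz vw.symm wa wb wc wz' (ne_of_dg G (by rw [S.dz, S.db]; omega))
      (ne_of_dg G (by rw [S.dz, S.dc]; omega)) (ne_of_dg G (by rw [S.dz, S.dd]; omega))
      va.ne (S.swp.va).ne (S.swp.sw1.va).ne S.bc S.bd S.cd
    obtain ⟨p, q, ap, aq, pq, pv, pw, qv, qw, dp, dq⟩ := hG.two5 S.db va.symm wa.symm vw.ne
    have cl : ∀ e, G.Adj a e → dg G e = 5 → e ≠ v → e ≠ w → e = b ∨ e = c := by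
      intro e ae de ev ew
      have h := ruleA hG S.dv S.da S.dz S.db de vw vz wz va wa ae ev ew
      have ez : e ≠ z := ne_of_dg G (by rw [S.dz, de]; omega)
      have ea := ae.ne'
      rw [T, S.hv] at h
      tauto
    rcases cl p ap dp pv pw with h | h <;> rcases cl q aq dq qv qw with h' | h' <;> subst h <;> subst h' <;> tauto
  obtain ⟨ab, ac⟩ := key a b c S wa wb wc
  obtain ⟨bc, -⟩ := key b c a S.sw2.sw3 wb wc wa
  exact LemA hG ⟨S.dv, S.da, S.db, S.dc, S.dd, S.va, S.sw1.va, S.swp.va, S.swp.sw1.va,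
                wa, wb, wc, ab, ac, bc⟩ S.vz S.dz

theorem C2 {G : SimpleGraph V} (hG : Bad G) {v w z p q y : V} (S : St G v z w p q y)
    (wz : G.Adj w z) (wp : G.Adj w p) (wq : G.Adj w q) (wy : ¬ G.Adj w y) : False := by
  have vw := S.va
  have vz := S.vz
  have vp := S.sw1.va
  have vq := S.swp.va
  have vy := S.swp.sw1.va
  obtain ⟨x, T⟩ := hG.st3 S.da wz S.dz vw.symm S.dv wp S.db wq S.dc vp.ne vq.ne S.bc
  have dx := T.dd
  have dy := S.dd
  have wx := T.swp.sw1.va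
  have vx : ¬ G.Adj v x := by
    rw [S.hv]
    rintro (h | h | h | h | h)
    · have := S.dz
      subst h; omega
    · exact wx.ne h.symm
    · exact T.bd h.symm
    · exact T.cd h.symm
    · subst h; exact wy wx
  have xv : x ≠ v := T.ad.symm
  have yw : y ≠ w := S.ad.symm
  have cl : ∀ a, G.Adj v a → G.Adj w a → dg G a = 5 → ∀ e, G.Adj a e → dg G e = 5 → e ≠ v → e ≠ w →
      e = p ∨ e = q ∨ e = x ∨ e = y := by
    intro a va wa da e ae de ev ew
    have h := ruleA hG S.dv S.da S.dz da de vw vz wz va wa ae ev ew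
    have ez : e ≠ z := ne_of_dg G (by rw [S.dz, de]; omega)
    rw [T.hv, S.hv] at h
    tauto
  have two : ∀ a b, (a = p ∧ b = q) ∨ (a = q ∧ b = p) → ¬ G.Adj a y → G.Adj a b ∧ G.Adj a x := by
    intro a b hab nay
    have h : G.Adj v a ∧ G.Adj w a ∧ dg G a = 5 := by
      rcases hab with ⟨h, -⟩ | ⟨h, -⟩ <;> subst h
      · exact ⟨vp, wp, S.db⟩
      · exact ⟨vq, wq, S.dc⟩
    obtain ⟨va, wa, da⟩ := h
    obtain ⟨e, f, ae, af, ef, ev, ew, fv, fw, de, df⟩ := hG.two5 da va.symm wa.symm vw.ne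
    have h1 : ∀ e, G.Adj a e → dg G e = 5 → e ≠ v → e ≠ w → e = b ∨ e = x := by
      intro e ae de ev ew
      have := cl a va wa da e ae de ev ew
      have hea := ae.ne'
      have : e ≠ y := ne_of_adj ae nay
      rcases hab with ⟨h, h'⟩ | ⟨h, h'⟩ <;> rw [h'] <;> rw [h] at hea <;> tauto
    rcases h1 e ae de ev ew with h | h <;> rcases h1 f af df fv fw with h' | h' <;> subst h <;>
      first | exact absurd h'.symm ef | (subst h'; exact ⟨ae, af⟩) | (subst h'; exact ⟨af, ae⟩)
  have half : ∀ p q, G.Adj v p → G.Adj w p → G.Adj v q → G.Adj w q → dg G p = 5 → dg G q = 5 →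
      p ≠ y → q ≠ y → G.Adj p y → ¬ G.Adj q y → G.Adj q p → False := by
    intro p q vp wp vq wq dp dq py' qy' py nqy qp
    have P := hG.pg11 S.da dy yw.symm wy S.dz wz S.dv vw.symm vy.symm
    refine P.w2 (v := q) (a := v) (b := p) vq.symm qp vp.ne wq.ne' qy' vw.ne vy.ne wp.ne' py' ?_ ?_ ?_
    · have := kd1 qy' wq (fun h => nqy h.symm); omega
    · have := kd12 P.ne vw.symm vy.symm
      have := S.dv; omega
    · have := kd12 P.ne wp py.symm; omega
  by_cases py : G.Adj p y
  · by_cases qy : G.Adj q y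
    · exact hG.p13 S.da dy yw.symm wy S.dz wz vp.ne vq.ne S.bc ⟨vy.symm, .inr ⟨S.dv, vw.symm⟩⟩
        ⟨py.symm, .inr ⟨S.db, wp⟩⟩ ⟨qy.symm, .inr ⟨S.dc, wq⟩⟩
    · obtain ⟨h1, -⟩ := two q p (by tauto) qy
      exact half p q vp wp vq wq S.db S.dc S.bd S.cd py qy h1
  · obtain ⟨h1, h2⟩ := two p q (by tauto) py
    by_cases qy : G.Adj q y
    · exact half q p vq wq vp wp S.dc S.db S.cd S.bd qy py h1
    · obtain ⟨h3, h4⟩ := two q p (by tauto) qy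
      exact hG.p13 S.dv dx xv.symm vx S.dz vz wp.ne wq.ne S.bc ⟨wx.symm, .inr ⟨S.da, vw⟩⟩
        ⟨h2.symm, .inr ⟨S.db, vp⟩⟩ ⟨h4.symm, .inr ⟨S.dc, vq⟩⟩

theorem C1 {G : SimpleGraph V} (hG : Bad G) {v w z p y1 y2 : V} (S : St G v z w p y1 y2)
    (wz : G.Adj w z) (wp : G.Adj w p) (wy1 : ¬ G.Adj w y1) (wy2 : ¬ G.Adj w y2) : False := by
  have vw := S.va
  have vz := S.vz
  have vp := S.sw1.va
  obtain ⟨x1, x2, T⟩ := hG.st2 S.da wz S.dz vw.symm S.dv wp S.db vp.ne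
  have sep : ∀ v w y1 y2 x1 x2, St G v z w p y1 y2 → St G w z v p x1 x2 → ¬ G.Adj w y1 →
      ¬ G.Adj w y2 → ¬ G.Adj v x1 ∧ ¬ G.Adj v x2 ∧ x1 ≠ v ∧ x2 ≠ v := by
    intro v w y1 y2 x1 x2 S T h1 h2
    have key : ∀ x, G.Adj w x → dg G x = 5 → x ≠ p → ¬ G.Adj v x := by
      intro x wx dx xp
      rw [S.hv]
      rintro (h | h | h | h | h)
      · have := S.dz
        subst h; omega
      · exact wx.ne h.symm
      · exact xp h
      · subst h; exact h1 wx
      · subst h; exact h2 wx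
    exact ⟨key x1 T.swp.va T.dc T.bc.symm, key x2 T.swp.sw1.va T.dd T.bd.symm, T.ac.symm, T.ad.symm⟩
  obtain ⟨vx1, vx2, -, -⟩ := sep _ _ _ _ _ _ S T wy1 wy2
  have two : ∀ v w x1 x2, St G w z v p x1 x2 → G.Adj v z → G.Adj w z → ¬ G.Adj v x1 → ¬ G.Adj v x2 →
      G.Adj v p → G.Adj p x1 → G.Adj p x2 → False := by
    intro v w x1 x2 T vz wz vx1 vx2 vp px1 px2
    have wv := T.va
    have wp := T.sw1.va
    have wx1 := T.swp.va
    have wx2 := T.swp.sw1.va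
    have P := hG.pg11 T.da T.dc T.ac vx1 T.dz vz T.dv wv.symm wx1.symm
    have x12 := (P.w1 T.dv wv.symm wx1.symm T.dd wx2 T.ad.symm T.cd.symm).resolve_left vx2
    have e1 := T.dv
    have e2 := T.db
    have e3 := T.dd
    refine P.w2 (v := x2) (a := w) (b := p) wx2.symm px2.symm wp.ne T.ad.symm T.cd.symm wv.ne wx1.ne vp.ne'
      px1.ne ?_ ?_ ?_
    · have := kd2 P.ne T.ad.symm vx2 x12; omega
    · have := kd12 P.ne wv.symm wx1.symm; omega
    · have := kd12 P.ne vp px1.symm; omega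
  have core : ∀ x1 x2 y1 y2, St G v z w p y1 y2 → St G w z v p x1 x2 → ¬ G.Adj w y1 → ¬ G.Adj w y2 →
      G.Adj p x1 → G.Adj p y1 → False := by
    intro x1 x2 y1 y2 S T wy1 wy2 px1 py1
    obtain ⟨vx1, vx2, nx1, nx2⟩ := sep _ _ _ _ _ _ S T wy1 wy2
    have wx1 := T.swp.va
    have wx2 := T.swp.sw1.va
    have vy1 := S.swp.va
    have vy2 := S.swp.sw1.va
    have px2 : ¬ G.Adj p x2 := fun h => two v w x1 x2 T vz wz vx1 vx2 vp px1 h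
    have py2 : ¬ G.Adj p y2 := fun h => two w v y1 y2 S wz vz wy1 wy2 wp py1 h
    have xy : x1 ≠ y1 := ne_of_adj wx1 wy1
    obtain ⟨β, hn, b1, b2, b3, b4⟩ := nb5_of4 S.db vp.symm wp.symm px1 py1 vw.ne T.ac S.swp.va.ne
      wx1.ne S.ac xy
    have pb : G.Adj p β := by simp [hn]
    have db : dg G β = 4 := by
      rcases hG.no3 p β S.db pb with h | h
      · exact h
      · exfalso
        have h' := ruleA hG S.dv S.da S.dz S.db h vw vz wz vp wp pb b1.symm b2.symm
        have ez : β ≠ z := ne_of_dg G (by rw [S.dz, h]; omega)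
        have := pb.ne'
        have : β ≠ x2 := ne_of_adj pb px2
        have : β ≠ y2 := ne_of_adj pb py2
        rw [T.hv, S.hv] at h'
        tauto
    have e1 := T.dv
    have e2 := T.db
    have e3 := S.dv
    have e4 := S.dz
    by_cases bz : β = z
    · subst bz
      have P := hG.pg11 S.dv T.dd nx2.symm vx2 db vz S.da vw wx2.symm
      have bx2 : β ≠ x2 := ne_of_dg G (by rw [db, T.dd]; omega)
      refine P.w2 (v := p) (a := w) (b := β) wp.symm pb b2 vp.ne' T.bd vw.ne' wx2.ne vz.ne' bx2 ?_ ?_ ?_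
      · have := kd1 T.bd vp (fun h => px2 h.symm); omega
      · have := kd12 P.ne vw wx2.symm; omega
      · have := kd1 (r := v) (s := x2) bx2 vz (fun h => hG.F2 S.dv T.dd nx2.symm vx2 db vz h); omega
    have S' : St G p β v w x1 y1 := ⟨S.db, db, S.dv, S.da, T.dc, S.dc, by intro x; rw [hn]; tauto, vw.ne,
      T.ac, S.swp.va.ne, wx1.ne, S.ac, xy⟩
    have := (S'.LAB hG ?_).2 w v x1 wp.symm vp.symm px1 S.da S.dv T.dc T.ac vw.symm wx1
    · exact this
    intro x hx hxb
    rw [hn] at hx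
    rcases hx with h | h | h | h | h
    · subst h; exact bz (hG.one4 x β z S.dv hxb vz db e4)
    · subst h; exact bz (hG.one4 x β z S.da hxb wz db e4)
    · subst h
      exact hG.p13 S.dv T.dc nx1.symm vx1 e4 vz wp.ne b2 pb.ne ⟨wx1.symm, .inr ⟨S.da, vw⟩⟩
        ⟨px1.symm, .inr ⟨S.db, vp⟩⟩ ⟨hxb, .inl db⟩
    · subst h
      exact hG.p13 S.da S.dc S.ac wy1 e4 wz vp.ne b1 pb.ne ⟨vy1.symm, .inr ⟨S.dv, vw.symm⟩⟩
        ⟨py1.symm, .inr ⟨S.db, wp⟩⟩ ⟨hxb, .inl db⟩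
    · subst h; exact hxb.ne rfl
  obtain ⟨e, f, pe, pf, ef, ev, ew, fv, fw, de, df⟩ := hG.two5 S.db vp.symm wp.symm vw.ne
  have cl : ∀ e, G.Adj p e → dg G e = 5 → e ≠ v → e ≠ w → e = y1 ∨ e = y2 ∨ e = x1 ∨ e = x2 := by
    intro e ae de ev ew
    have h := ruleA hG S.dv S.da S.dz S.db de vw vz wz vp wp ae ev ew
    have ez : e ≠ z := ne_of_dg G (by rw [S.dz, de]; omega)
    have := ae.ne'
    rw [T.hv, S.hv] at h
    tauto
  have nxx : ¬ (G.Adj p x1 ∧ G.Adj p x2) := fun h => two v w x1 x2 T vz wz vx1 vx2 vp h.1 h.2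
  have nyy : ¬ (G.Adj p y1 ∧ G.Adj p y2) := fun h => two w v y1 y2 S wz vz wy1 wy2 wp h.1 h.2
  have c11 := core x1 x2 y1 y2 S T wy1 wy2
  have c12 := core x1 x2 y2 y1 S.sw3 T wy2 wy1
  have c21 := core x2 x1 y1 y2 S T.sw3 wy1 wy2
  have c22 := core x2 x1 y2 y1 S.sw3 T.sw3 wy2 wy1
  rcases cl e pe de ev ew with h | h | h | h <;> rcases cl f pf df fv fw with h' | h' | h' | h' <;>
    first
    | exact ef (h.trans h'.symm)
    | (rw [h] at pe; rw [h'] at pf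
       first
       | exact c11 pe pf | exact c12 pe pf | exact c21 pe pf | exact c22 pe pf
       | exact c11 pf pe | exact c12 pf pe | exact c21 pf pe | exact c22 pf pe
       | exact nxx ⟨pe, pf⟩ | exact nxx ⟨pf, pe⟩ | exact nyy ⟨pe, pf⟩ | exact nyy ⟨pf, pe⟩)

/-- The structure of the remaining neighbours when there is no common neighbour. -/
theorem C0a {G : SimpleGraph V} (hG : Bad G) {v w z a b c : V} (S : St G v z w a b c)
    (wz : G.Adj w z) (wa : ¬ G.Adj w a) (wb : ¬ G.Adj w b) (wc : ¬ G.Adj w c) :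
    G.Adj a b ∧ G.Adj a c ∧ ∃ e f, (∀ x, G.Adj a x ↔ x = v ∨ x = b ∨ x = c ∨ x = e ∨ x = f) ∧
      dg G e = 5 ∧ dg G f = 4 ∧ G.Adj e f ∧ ¬ G.Adj v e ∧ f ≠ z ∧ e ≠ v ∧ e ≠ b ∧ e ≠ c ∧
      ¬ G.Adj w e := by
  have vw := S.va
  have vz := S.vz
  have va := S.sw1.va
  have vb := S.swp.va
  have vc := S.swp.sw1.va
  have Pa := hG.pg11 S.da S.db S.ab wa S.dz wz S.dv vw.symm va.symm
  have Pb := hG.pg11 S.da S.dc S.ac wb S.dz wz S.dv vw.symm vb.symm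
  have Aab := (Pa.w1 S.dv vw.symm va.symm S.dc vb S.ac.symm S.bc.symm).resolve_left wb
  have Aac := (Pa.w1 S.dv vw.symm va.symm S.dd vc S.ad.symm S.bd.symm).resolve_left wc
  have Abc := (Pb.w1 S.dv vw.symm vb.symm S.dd vc S.ad.symm S.cd.symm).resolve_left wc
  refine ⟨Aab, Aac, ?_⟩
  obtain ⟨e, f, hn, h1, h2, h3, h4, h5, h6, h7⟩ := nb5_of3 S.db va.symm Aab Aac vb.ne vc.ne S.cd
  have ae : G.Adj a e := by simp [hn]
  have af : G.Adj a f := by simp [hn]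
  have naz : ¬ G.Adj a z := fun h => hG.F2 S.da S.db S.ab wa S.dz wz h
  have naw : ¬ G.Adj a w := fun h => wa h.symm
  have nv : ∀ x, G.Adj a x → x ≠ b → x ≠ c → ¬ G.Adj v x := by
    intro x ax xb xc
    rw [S.hv]
    rintro (h | h | h | h | h)
    · subst h; exact naz ax
    · subst h; exact naw ax
    · exact ax.ne h.symm
    · tauto
    · tauto
  have key : ∀ e f, (∀ x, G.Adj a x ↔ x = v ∨ x = b ∨ x = c ∨ x = e ∨ x = f) → G.Adj a e → G.Adj a f →
      v ≠ e → v ≠ f → b ≠ e → b ≠ f → c ≠ e → c ≠ f → e ≠ f → dg G e = 5 → 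
      ∃ e f, (∀ x, G.Adj a x ↔ x = v ∨ x = b ∨ x = c ∨ x = e ∨ x = f) ∧
      dg G e = 5 ∧ dg G f = 4 ∧ G.Adj e f ∧ ¬ G.Adj v e ∧ f ≠ z ∧ e ≠ v ∧ e ≠ b ∧ e ≠ c ∧ ¬ G.Adj w e := by
    intro e f hn ae af h1 h2 h3 h4 h5 h6 h7 de
    have nve := nv e ae h3.symm h5.symm
    have nvf := nv f af h4.symm h6.symm
    have P := hG.pg11 S.dv de h1 nve S.dz vz S.db va ae.symm
    have hw3 := P.w3 S.db va ae.symm Aab Aac af Abc h4.symm h6.symm vb.ne' h3 vc.ne' h5 h2.symm h7.symm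
    have df := hG.no3 a f S.db af
    have ef : G.Adj e f := by
      by_contra h
      apply hw3
      rw [kd0 h2.symm h7.symm nvf h]
      omega
    have df4 : dg G f = 4 := by
      have := kd2 P.ne h2.symm nvf ef
      by_contra h
      apply hw3
      omega
    refine ⟨e, f, hn, de, df4, ef, nve, (ne_of_adj af naz), h1.symm, h3.symm, h5.symm, ?_⟩
    intro hwe
    have zv := vz.ne'
    have ze : z ≠ e := ne_of_dg G (by rw [S.dz, de]; omega)
    exact hG.p13 S.db S.da S.ab.symm naw df4 af zv ze h1 ⟨wz, .inl S.dz⟩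
      ⟨vw.symm, .inr ⟨S.dv, va.symm⟩⟩ ⟨hwe, .inr ⟨de, ae⟩⟩
  rcases hG.no3 a e S.db ae with h | h
  · exact key f e (by intro x; rw [hn]; tauto) af ae h2 h1 h4 h3 h6 h5 h7.symm (hG.five S.db ae h af h7)
  · exact key e f hn ae af h1 h2 h3 h4 h5 h6 h7 h

theorem C0 {G : SimpleGraph V} (hG : Bad G) {v w z a b c : V} (S : St G v z w a b c)
    (wz : G.Adj w z) (wa : ¬ G.Adj w a) (wb : ¬ G.Adj w b) (wc : ¬ G.Adj w c) : False := by
  obtain ⟨ab, ac, e1, f1, hn1, de1, df1, ef1, ve1, fz1, ev1, eb1, ec1, we1⟩ := C0a hG S wz wa wb wc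
  obtain ⟨bc, ba, e2, f2, hn2, de2, df2, ef2, ve2, fz2, ev2, ec2, ea2, we2⟩ :=
    C0a hG S.sw2.sw3 wz wb wc wa
  obtain ⟨ca, cb, e3, f3, hn3, de3, df3, ef3, ve3, fz3, ev3, ea3, eb3, we3⟩ :=
    C0a hG S.sw3.sw2 wz wc wa wb
  have vw := S.va
  have vz := S.vz
  have va := S.sw1.va
  have vb := S.swp.va
  have vc := S.swp.sw1.va
  have ae1 : G.Adj a e1 := by simp [hn1]
  have af1 : G.Adj a f1 := by simp [hn1]
  have be2 : G.Adj b e2 := by simp [hn2]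
  have bf2 : G.Adj b f2 := by simp [hn2]
  have ce3 : G.Adj c e3 := by simp [hn3]
  have dist : ∀ a b e f, dg G a = 5 → dg G b = 5 → a ≠ b → G.Adj v a → G.Adj v b → G.Adj a e → G.Adj b e →
      G.Adj e f → dg G f = 4 → ¬ G.Adj v e → e ≠ v → dg G e = 5 → False := by
    intro a b e f da db ab va vb ae be ef df ve ev de
    exact hG.p13 S.dv de ev.symm ve S.dz vz ab (ne_of_dg G (by omega)) (ne_of_dg G (by omega))
      ⟨ae.symm, .inr ⟨da, va⟩⟩ ⟨be.symm, .inr ⟨db, vb⟩⟩ ⟨ef, .inl df⟩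
  have nae2 : ¬ G.Adj a e2 := fun h => dist a b e2 f2 S.db S.dc S.bc va vb h be2 ef2 df2 ve2 ev2 de2
  have nce2 : ¬ G.Adj c e2 := fun h => dist c b e2 f2 S.dd S.dc S.cd.symm vc vb h be2 ef2 df2 ve2 ev2 de2
  have naw : ¬ G.Adj a w := fun h => wa h.symm
  have zv := vz.ne'
  obtain ⟨q1, -, q3⟩ := hG.pair S.db S.da S.ab.symm naw {f1} {z, v} (by simp [af1, df1]) (by
    intro t ht
    simp at ht
    rcases ht with h | h <;> subst h
    · exact ⟨wz, .inl S.dz⟩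
    · exact ⟨vw.symm, .inr ⟨S.dv, va.symm⟩⟩)
  rw [Finset.card_pair zv] at q1 q3
  simp at q1 q3
  -- the remainder
  have hea : e2 ≠ a := ea2
  have hew : e2 ≠ w := (ne_of_adj vw ve2).symm
  have d1 : dg (d2 G a w) e2 = 5 := by rw [kd0 hea hew nae2 we2, de2]
  have adj : ∀ x, G.Adj e2 x → x ≠ a → x ≠ w → (d2 G a w).Adj e2 x := fun x h1 h2 h3 =>
    ⟨⟨h1, hea, h2⟩, hew, h3⟩
  have no3 : ∀ x, (d2 G a w).Adj e2 x → 4 ≤ dg (d2 G a w) x := by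
    intro x hx
    have h3 := q3.ge3 hx
    by_contra hcon
    have := W1 q3 hx d1 (by omega)
    omega
  have ebK := adj b be2.symm S.bc.symm S.ac.symm
  have f2a : f2 ≠ a := ne_of_dg G (by rw [df2, S.db]; omega)
  have f2w : f2 ≠ w := ne_of_dg G (by rw [df2, S.da]; omega)
  have f2b : b ≠ f2 := bf2.ne
  have efK := adj f2 ef2 f2a f2w
  have db : dg (d2 G a w) b = 4 := by
    have := kd1 S.ac.symm ab wb
    have := S.dc
    omega
  have df : dg (d2 G a w) f2 = 4 := by
    have := no3 f2 efK
    have : dg (d2 G a w) f2 ≤ dg G f2 := (dg_del_le _ _ _).trans (dg_del_le _ _ _)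
    omega
  have hF := Fd2 q3.m3 ebK efK f2b
  rw [d1, db, df, base5, bo4] at hF
  have G' := q3.step (u := e2) (by omega) no3 (by omega)
  have hce : c ≠ e2 := (ne_of_adj vc ve2)
  have hve : v ≠ e2 := ev2.symm
  have hbe : b ≠ e2 := be2.ne
  have dc : dg (del (d2 G a w) e2) c = 4 := by
    rw [dg_del_nadj (G := d2 G a w) hce (fun h => nce2 h.1.1.symm)]
    have := kd1 S.ad.symm ac wc
    have := S.dd
    omega
  have dv : dg (del (d2 G a w) e2) v = 3 := by
    rw [dg_del_nadj (G := d2 G a w) hve (fun h => ve2 h.1.1.symm)]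
    have := kd12 S.ab.symm va.symm vw.symm
    have := S.dv
    omega
  have db' : dg (del (d2 G a w) e2) b = 3 := by
    have := dg_del_adj ebK
    omega
  have := W2 G' (v := c) (a := v) (b := b) ⟨⟨⟨vc.symm, S.bd.symm, va.ne⟩, S.ad.symm, vw.ne⟩, hce, hve⟩
    ⟨⟨⟨cb, S.bd.symm, S.bc.symm⟩, S.ad.symm, S.ac.symm⟩, hce, hbe⟩ vb.ne dc dv db'
  omega

section
end

/-- Lemma C. -/
theorem LemC {G : SimpleGraph V} (hG : Bad G) {v w z : V} (dv : dg G v = 5) (dw : dg G w = 5)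
    (dz : dg G z = 4) (vw : G.Adj v w) (vz : G.Adj v z) (wz : G.Adj w z) : False := by
  obtain ⟨a, b, c, S⟩ := hG.st dv vz dz vw dw
  by_cases wa : G.Adj w a
  · by_cases wb : G.Adj w b
    · by_cases wc : G.Adj w c
      · exact C3 hG S wz wa wb wc
      · exact C2 hG S wz wa wb wc
    · by_cases wc : G.Adj w c
      · exact C2 hG S.sw3 wz wa wc wb
      · exact C1 hG S wz wa wb wc
  · by_cases wb : G.Adj w b
    · by_cases wc : G.Adj w c
      · exact C2 hG S.sw2.sw3 wz wb wc wa
      · exact C1 hG S.sw2 wz wb wa wc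
    · by_cases wc : G.Adj w c
      · exact C1 hG S.sw3.sw2 wz wc wa wb
      · exact C0 hG S wz wa wb wc

end
end K4T

namespace K4T

open Classical

set_option linter.unusedSectionVars false
set_option linter.unusedVariables false

section
variable {V : Type*} [Fintype V]

/-- Hypotheses of the cascade lemma. -/
structure Casc (K : SimpleGraph V) (Y : Set V) : Prop where
  d5 : ∀ y ∈ Y, dg K y = 5
  closed : ∀ y ∈ Y, ∀ x, K.Adj y x → dg K x = 5 → x ∈ Y
  act : ∀ y ∈ Y, ∃ x, K.Adj y x ∧ dg K x ≤ 4
  nocl : ∀ u ∈ Y, ∀ x y t, K.Adj u x → K.Adj u y → K.Adj u t → dg K x = 5 → dg K y = 5 → dg K t = 5 →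
    K.Adj x y → K.Adj x t → K.Adj y t → False

theorem Casc.remove {K : SimpleGraph V} {Y : Set V} (h : Casc K Y) (hK : Good K) {u : V} (hu : dg K u = 5) :
    Casc (del K u) {y | y ∈ Y ∧ dg (del K u) y = 5} := by
  have up : ∀ x, dg (del K u) x = 5 → dg K x = 5 := by
    intro x hx
    have := dg_del_le K u x
    have := hK.d5 x
    omega
  refine ⟨fun y hy => hy.2, ?_, ?_, ?_⟩
  · intro y hy x hx dx
    exact ⟨h.closed y hy.1 x hx.1 (up x dx), dx⟩
  · intro y hy
    obtain ⟨x, hx, dx⟩ := h.act y hy.1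
    have hyu : y ≠ u := by
      rintro rfl
      have := hy.2
      rw [dg_del_self] at this
      omega
    exact ⟨x, ⟨hx, hyu, ne_of_dg K (by omega)⟩, (dg_del_le K u x).trans dx⟩
  · intro v hv x y t h1 h2 h3 e1 e2 e3 a1 a2 a3
    exact h.nocl v hv.1 x y t h1.1 h2.1 h3.1 (up _ e1) (up _ e2) (up _ e3) a1.1 a2.1 a3.1

theorem cascade (n : ℕ) : ∀ (K : SimpleGraph V) (Y : Set V), mu K ≤ n → Good K → Casc K Y →
    ∀ u ∈ Y, ∀ p q, p ≠ q → K.Adj u p → K.Adj u q → dg K p ≤ 4 → dg K q ≤ 4 → -3 ≤ F K := by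
  induction n with
  | zero =>
    intro K Y hm hK hC u hu p q pq up uq dp dq
    have := mu_del (dg_pos_of_adj up)
    omega
  | succ n ih =>
    intro K Y hm hK hC u hu p q pq up uq dp dq
    by_contra hF
    have no3 : ∀ v x, K.Adj v x → dg K v = 5 → 4 ≤ dg K x := by
      intro v x hvx dv
      have := hK.ge3 hvx
      by_contra hcon
      have := W1 hK hvx dv (by omega)
      omega
    have no4 : ∀ v a b c, dg K v = 5 → K.Adj v a → K.Adj v b → K.Adj v c → a ≠ b → a ≠ c → b ≠ c →
        dg K a = 5 ∨ dg K b = 5 ∨ dg K c = 5 := by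
      intro v a b c dv ha hb hc ab ac bc
      by_contra hcon
      have h1 := hK.d5 a
      have h2 := hK.d5 b
      have h3 := hK.d5 c
      have h4 := no3 v a ha dv
      have h5 := no3 v b hb dv
      have h6 := no3 v c hc dv
      have := W4' hK ha hb hc ab ac bc dv (by omega) (by omega) (by omega)
      omega
    have du := hC.d5 u hu
    have dp4 := no3 u p up du
    have dq4 := no3 u q uq du
    obtain ⟨x, y, t, hn, h1, h2, h3, h4, h5, h6, h7, h8, h9⟩ := nb5_of2 du up uq pq
    have five : ∀ x, K.Adj u x → p ≠ x → q ≠ x → dg K x = 5 := by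
      intro x ux px qx
      have := no4 u p q x du up uq ux pq px qx
      omega
    have ux : K.Adj u x := by simp [hn]
    have uy : K.Adj u y := by simp [hn]
    have ut : K.Adj u t := by simp [hn]
    have dx := five x ux h1 h4
    have dy := five y uy h2 h5
    have dt := five t ut h3 h6
    have core : ∀ x y t, (∀ s, K.Adj u s ↔ s = p ∨ s = q ∨ s = x ∨ s = y ∨ s = t) → K.Adj u x →
        dg K x = 5 → K.Adj u t → ¬ K.Adj x y → False := by
      intro x y t hn ux dx ut nxy
      have hr : ∃ r, K.Adj x r ∧ r ≠ u ∧ r ≠ t ∧ dg K r = 5 := by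
        by_cases xt : K.Adj x t
        · obtain ⟨c, d, e, hm, m1, m2, m3, m4, m5, m6, m7, m8, m9⟩ := nb5_of2 dx ux.symm xt ut.ne
          have xc : K.Adj x c := by simp [hm]
          have xd : K.Adj x d := by simp [hm]
          have xe : K.Adj x e := by simp [hm]
          rcases no4 x c d e dx xc xd xe m7 m8 m9 with h | h | h
          · exact ⟨c, xc, m1.symm, m4.symm, h⟩
          · exact ⟨d, xd, m2.symm, m5.symm, h⟩
          · exact ⟨e, xe, m3.symm, m6.symm, h⟩
        · obtain ⟨b, c, d, e, hm, m0, m1, m2, m3, m4, m5, m6, m7, m8, m9⟩ := nb5_of dx ux.symm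
          have xc : K.Adj x c := by simp [hm]
          have xd : K.Adj x d := by simp [hm]
          have xe : K.Adj x e := by simp [hm]
          rcases no4 x c d e dx xc xd xe m7 m8 m9 with h | h | h
          · exact ⟨c, xc, m1.symm, ne_of_adj xc xt, h⟩
          · exact ⟨d, xd, m2.symm, ne_of_adj xd xt, h⟩
          · exact ⟨e, xe, m3.symm, ne_of_adj xe xt, h⟩
      obtain ⟨r, xr, ru, rt, dr⟩ := hr
      have ry : r ≠ y := ne_of_adj xr nxy
      have rp : r ≠ p := ne_of_dg K (by omega)
      have rq : r ≠ q := ne_of_dg K (by omega)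
      have rx := xr.ne'
      have nur : ¬ K.Adj u r := by rw [hn]; tauto
      have hx : x ∈ Y := hC.closed u hu x ux dx
      have hr : r ∈ Y := hC.closed x hx r xr dr
      have hF2 := Fd2 hK.m3 up uq pq
      rw [du, show dg K p = 4 by omega, show dg K q = 4 by omega, base5, bo4] at hF2
      have hK' := hK.step (u := u) (by omega) (fun s hs => no3 u s hs du) (by omega)
      have hm' := mu_del (dg_pos_of_adj up)
      have dr' : dg (del K u) r = 5 := by rw [dg_del_nadj ru nur, dr]
      obtain ⟨m, rm, dm⟩ := hC.act r hr
      have mx : m ≠ x := ne_of_dg K (by omega)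
      have dx' := dg_del_adj ux
      have := ih (del K u) _ (by omega) hK' (hC.remove hK du) r ⟨hr, dr'⟩ m x mx
        ⟨rm, ru, ne_of_dg K (by omega)⟩ ⟨xr.symm, ru, ux.ne'⟩ ((dg_del_le K u m).trans dm) (by omega)
      omega
    by_cases xy : K.Adj x y
    · by_cases xt : K.Adj x t
      · by_cases yt : K.Adj y t
        · exact hC.nocl u hu x y t ux uy ut dx dy dt xy xt yt
        · exact core y t x (by intro s; rw [hn]; tauto) uy dy ux yt
      · exact core x t y (by intro s; rw [hn]; tauto) ux dx uy xt
    · exact core x y t hn ux dx ut xy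

theorem Bad.LABC {G : SimpleGraph V} (hG : Bad G) {v z : V} (dv : dg G v = 5) (vz : G.Adj v z)
    (dz : dg G z = 4) :
    (∀ w, G.Adj v w → dg G w = 5 → ∃ y, G.Adj w y ∧ dg G y = 4) ∧
    (∀ w x y, G.Adj v w → G.Adj v x → G.Adj v y → dg G w = 5 → dg G x = 5 → dg G y = 5 →
      x ≠ y → G.Adj w x → G.Adj w y → False) := by
  obtain ⟨a, b, c, d, hn, h1, h2, h3, h4, h5⟩ := nb5_of dv vz
  have va : G.Adj v a := by simp [hn]
  have da := hG.five dv vz dz va h1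
  obtain ⟨b, c, d, S⟩ := hG.st dv vz dz va da
  refine S.LAB hG ?_
  intro x vx xz
  exact LemC hG dv (hG.five dv vz dz vx xz.ne') dz vx vz xz

theorem Bad.elim {G : SimpleGraph V} (hG : Bad G) {v z : V} (dv : dg G v = 5) (vz : G.Adj v z)
    (dz : dg G z = 4) : False := by
  obtain ⟨hF, hK⟩ := hG.del_good dv {z} (by simp [vz, dz])
  simp at hF
  have C0 : Casc G {y | dg G y = 5 ∧ ∃ s, G.Adj y s ∧ dg G s = 4} := by
    refine ⟨fun y hy => hy.1, ?_, ?_, ?_⟩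
    · rintro y ⟨dy, s, ys, ds⟩ x yx dx
      exact ⟨dx, (hG.LABC dy ys ds).1 x yx dx⟩
    · rintro y ⟨dy, s, ys, ds⟩
      exact ⟨s, ys, ds.le⟩
    · rintro u ⟨dy, s, ys, ds⟩ x y t ux uy ut dx dy' dt xy xt yt
      exact (hG.LABC dy ys ds).2 x y t ux uy ut dx dy' dt yt.ne xy xt
  have C1 := C0.remove hG.good dv
  obtain ⟨w, b, c, d, hn, h1, h2, h3, h4, h5⟩ := nb5_of dv vz
  have vw : G.Adj v w := by simp [hn]
  have dw := hG.five dv vz dz vw h1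
  obtain ⟨L1, L2⟩ := hG.LABC dv vz dz
  obtain ⟨z', wz', dz'⟩ := L1 w vw dw
  obtain ⟨b, c, d, S⟩ := hG.st dw wz' dz' vw.symm dv
  have wb := S.sw1.va
  have wc := S.swp.va
  have fin : ∀ a, G.Adj w a → dg G a = 5 → a ≠ v → ¬ G.Adj v a → False := by
    intro a wa da av nva
    obtain ⟨s, as', ds⟩ := (hG.LABC dw wz' dz').1 a wa da
    have da' : dg (del G v) a = 5 := by rw [dg_del_nadj av nva, da]
    have := dg_del_adj vw
    have := cascade _ (del G v) _ le_rfl hK C1 a ⟨⟨da, s, as', ds⟩, da'⟩ s w (ne_of_dg G (by omega))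
      ⟨as', av, ne_of_dg G (by omega)⟩ ⟨wa.symm, av, vw.ne'⟩ ((dg_del_le G v s).trans ds.le) (by omega)
    omega
  by_cases vb : G.Adj v b
  · by_cases vc : G.Adj v c
    · exact L2 w b c vw vb vc dw S.db S.dc S.bc wb wc
    · exact fin c wc S.dc S.ac.symm vc
  · exact fin b wb S.db S.ab.symm vb

theorem case5c : Case5c V := by
  intro G tc ih m3 d5 h5 h34
  by_contra hF
  have hB : Bad G := Bad.mk' ⟨tc, m3, d5, ih⟩ (by omega)
  obtain ⟨v, dv⟩ := h5
  obtain ⟨t, dt⟩ := h34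
  have nn : ∀ y z, dg G y = 5 → G.Adj y z → dg G z = 5 := by
    intro y z dy yz
    rcases hB.no3 y z dy yz with h | h
    · exact (hB.elim dy yz h).elim
    · exact h
  obtain ⟨x, vx⟩ := dg_pos.1 (show 0 < dg G v by omega)
  obtain ⟨s, ts⟩ := dg_pos.1 (show 0 < dg G t by omega)
  have := tc.1 {y | dg G y = 5} (fun a b hab ha => nn a b ha hab) ⟨v, dv, x, vx⟩ t s ts
  have : dg G t = 5 := this
  omega

end
end K4T

theorem statement13 {V : Type*} [Fintype V] (G : SimpleGraph V)
    (hconn : G.Connected) :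
    phiSum G ≥ (16 / 3) * (transNum G : ℝ) - 1 := K4T.final K4T.case5c G hconn
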